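/- Let 𝔽 be a fixed quadratic number field and let 3 ≤ X < Y be real numbers. Then C_{𝔽,1}(X,Y) = ρ_𝔽·Y + O(X·Y^{1/2}·(log Y)^7 + X^2), where the implied constant depends only on 𝔽. -/

import Mathlib

open NumberField Classical

/-- The Möbius function of a nonzero integral ideal: `0` if the ideal is not squarefree,
and `(-1)^r` if it is a product of `r` distinct prime ideals. -/
noncomputable def idealMu {F : Type} [Field F] [NumberField F] (I : Ideal (𝓞 F)) : ℤ :=
  if Squarefree I then (-1) ^ Multiset.card (UniqueFactorizationMonoid.factors I) else 0

/-- The Ramanujan sum `c_m(n) = Σ_{d ∣ m, d ∣ n} N(d)·μ(m/d)`, written as a sum over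
factorizations `m = d·e` with `d ∣ n` of `N(d)·μ(e)`. -/
noncomputable def ramanujanSum {F : Type} [Field F] [NumberField F]
    (m n : Ideal (𝓞 F)) : ℤ :=
  ∑ᶠ p ∈ {p : Ideal (𝓞 F) × Ideal (𝓞 F) | p.1 * p.2 = m ∧ p.1 ∣ n},
    (Ideal.absNorm p.1 : ℤ) * idealMu p.2

/-- `C_{𝔽,1}(X,Y) = Σ_{0 ≠ n, N(n) ≤ Y} Σ_{0 ≠ m, N(m) ≤ X} c_m(n)`. -/
noncomputable def C1 (F : Type) [Field F] [NumberField F] (X Y : ℝ) : ℤ :=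
  ∑ᶠ n ∈ {n : Ideal (𝓞 F) | n ≠ 0 ∧ (Ideal.absNorm n : ℝ) ≤ Y},
    ∑ᶠ m ∈ {m : Ideal (𝓞 F) | m ≠ 0 ∧ (Ideal.absNorm m : ℝ) ≤ X}, ramanujanSum m n

section

/-- Data of a periodic coefficient sequence `χ`, with `a = 1 * χ`, and counting function. -/
structure QD where
  q : ℕ
  χ : ℕ → ℝ
  a : ℕ → ℝ
  ρ : ℝ
  c : ℝ
  hq : 0 < q
  per : ∀ n, χ (n + q) = χ n
  bd : ∀ n, |χ n| ≤ 1
  a_eq : ∀ n, 1 ≤ n → a n = ∑ b ∈ n.divisors, χ b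
  a_nonneg : ∀ n, 0 ≤ a n
  land : ∀ n : ℕ, 1 ≤ n → |∑ m ∈ Finset.Ioc 0 n, a m - ρ * n| ≤ c * Real.sqrt n

namespace QD

open Finset

variable (Q : QD)

/-- Summatory function of `a`. -/
noncomputable def A (n : ℕ) : ℝ := ∑ m ∈ Ioc 0 n, Q.a m

/-- Summatory function of `χ`. -/
noncomputable def S (n : ℕ) : ℝ := ∑ m ∈ Ioc 0 n, Q.χ m

theorem S_zero : Q.S 0 = 0 := by simp [S]

theorem S_succ (n : ℕ) : Q.S (n + 1) = Q.S n + Q.χ (n + 1) := by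
  simp [S, Finset.sum_Ioc_succ_top]

theorem A_succ (n : ℕ) : Q.A (n + 1) = Q.A n + Q.a (n + 1) := by
  simp [A, Finset.sum_Ioc_succ_top]

theorem A_eq (n : ℕ) : Q.A n = ∑ b ∈ Ioc 0 n, Q.χ b * ((n / b : ℕ) : ℝ) := by
  let f : ArithmeticFunction ℝ := ⟨fun n => if n = 0 then 0 else Q.χ n, by simp⟩
  have hf : ∀ b, b ≠ 0 → f b = Q.χ b := fun b hb => by
    change (if b = 0 then 0 else Q.χ b) = _
    simp [hb]
  have h := ArithmeticFunction.sum_Ioc_mul_zeta_eq_sum f n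
  have h1 : Q.A n = ∑ m ∈ Ioc 0 n, (f * (ArithmeticFunction.zeta : ArithmeticFunction ℝ)) m := by
    unfold A
    refine sum_congr rfl fun m hm => ?_
    rw [mem_Ioc] at hm
    rw [Q.a_eq m hm.1, ArithmeticFunction.coe_mul_zeta_apply]
    refine sum_congr rfl fun b hb => ?_
    rw [hf b (Nat.pos_of_mem_divisors hb).ne']
  rw [h1, h]
  refine sum_congr rfl fun b hb => ?_
  rw [mem_Ioc] at hb
  rw [hf b hb.1.ne']

/-- Hyperbola method. -/
theorem A_hyp (n B : ℕ) (hB : 0 < B) (hBn : B ≤ n) :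
    Q.A n = ∑ b ∈ Ioc 0 B, Q.χ b * ((n / b : ℕ) : ℝ) +
      ∑ k ∈ Ioc 0 (n / B), (Q.S (n / k) - Q.S B) := by
  rw [A_eq, ← Finset.sum_Ioc_consecutive _ (Nat.zero_le B) hBn]
  congr 1
  have h1 : ∀ b ∈ Ioc B n, Q.χ b * ((n / b : ℕ) : ℝ) = ∑ k ∈ Ioc 0 (n / b), Q.χ b := by
    intro b _
    simp [mul_comm]
  rw [sum_congr rfl h1]
  have h2 : ∀ k ∈ Ioc 0 (n / B), Q.S (n / k) - Q.S B = ∑ b ∈ Ioc B (n / k), Q.χ b := by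
    intro k hk
    rw [mem_Ioc] at hk
    have : B ≤ n / k := by
      rw [Nat.le_div_iff_mul_le hk.1]
      have := (Nat.le_div_iff_mul_le hB).1 hk.2
      linarith [mul_comm k B]
    unfold S
    rw [← Finset.sum_Ioc_consecutive _ (Nat.zero_le B) this]
    ring
  rw [sum_congr rfl h2]
  apply Finset.sum_comm'
  intro b k
  simp only [mem_Ioc]
  constructor
  · rintro ⟨⟨h1, h2⟩, h3, h4⟩
    have h5 := (Nat.le_div_iff_mul_le (by omega)).1 h4
    refine ⟨⟨h1, ?_⟩, h3, ?_⟩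
    · rw [Nat.le_div_iff_mul_le h3]; linarith [mul_comm k b]
    · rw [Nat.le_div_iff_mul_le hB]; nlinarith
  · rintro ⟨⟨h1, h2⟩, h3, h4⟩
    have h5 := (Nat.le_div_iff_mul_le (by omega)).1 h2
    refine ⟨⟨h1, ?_⟩, h3, ?_⟩
    · nlinarith
    · rw [Nat.le_div_iff_mul_le (by omega)]; linarith [mul_comm k b]

end QD

/-- Partial sums of a periodic mean zero sequence are bounded. -/
theorem sum_range_periodic {q : ℕ} {f : ℕ → ℝ} (hper : ∀ n, f (n + q) = f n)
    (h0 : ∑ i ∈ Finset.range q, f i = 0) (n : ℕ) :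
    ∑ i ∈ Finset.range (n + q), f i = ∑ i ∈ Finset.range n, f i := by
  induction n with
  | zero => simpa using h0
  | succ n ih =>
    rw [show n + 1 + q = n + q + 1 by ring, Finset.sum_range_succ, Finset.sum_range_succ, ih, hper]

theorem periodic_sum_bound {q : ℕ} (hq : 0 < q) {f : ℕ → ℝ} {M : ℝ} (hper : ∀ n, f (n + q) = f n)
    (h0 : ∑ i ∈ Finset.range q, f i = 0) (hM : ∀ n, |f n| ≤ M) (n : ℕ) :
    |∑ i ∈ Finset.range n, f i| ≤ q * M := by
  induction n using Nat.strong_induction_on with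
  | _ n ih =>
    by_cases h : n < q
    · calc |∑ i ∈ Finset.range n, f i| ≤ ∑ i ∈ Finset.range n, |f i| := Finset.abs_sum_le_sum_abs _ _
        _ ≤ ∑ i ∈ Finset.range n, M := Finset.sum_le_sum fun i _ => hM i
        _ = n * M := by simp
        _ ≤ q * M := by
          have : 0 ≤ M := (abs_nonneg _).trans (hM 0)
          gcongr
    · obtain ⟨m, rfl⟩ := Nat.exists_eq_add_of_le (not_lt.1 h)
      rw [add_comm, sum_range_periodic hper h0]
      exact ih m (by omega)

/-- Abel-type bound: sum of a sequence with bounded partial sums against antitone weights. -/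
theorem abel_bound {f w : ℕ → ℝ} {M : ℝ} (hf : ∀ n, |∑ i ∈ Finset.range n, f i| ≤ M)
    (hw : ∀ n, w (n + 1) ≤ w n) (hw0 : ∀ n, 0 ≤ w n) (n : ℕ) :
    |∑ i ∈ Finset.range n, f i * w i| ≤ M * w 0 := by
  have key : ∀ n, ∑ i ∈ Finset.range n, f i * w i =
      (∑ i ∈ Finset.range n, f i) * w n +
        ∑ i ∈ Finset.range n, (∑ j ∈ Finset.range (i + 1), f j) * (w i - w (i + 1)) := by
    intro n
    induction n with
    | zero => simp
    | succ n ih =>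
      rw [Finset.sum_range_succ, ih, Finset.sum_range_succ (fun i => (∑ j ∈ Finset.range (i + 1), f j) * (w i - w (i + 1))),
        Finset.sum_range_succ]
      ring
  rw [key]
  calc _ ≤ |(∑ i ∈ Finset.range n, f i) * w n| + |∑ i ∈ Finset.range n, (∑ j ∈ Finset.range (i + 1), f j) * (w i - w (i + 1))| := abs_add_le _ _
    _ ≤ M * w n + ∑ i ∈ Finset.range n, M * (w i - w (i + 1)) := by
      gcongr
      · rw [abs_mul, abs_of_nonneg (hw0 n)]
        exact mul_le_mul_of_nonneg_right (hf n) (hw0 n)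
      · refine (Finset.abs_sum_le_sum_abs _ _).trans (Finset.sum_le_sum fun i _ => ?_)
        have : 0 ≤ w i - w (i + 1) := by linarith [hw i]
        rw [abs_mul, abs_of_nonneg this]
        exact mul_le_mul_of_nonneg_right (hf _) this
    _ = M * w 0 := by
      rw [← Finset.mul_sum, Finset.sum_range_sub']
      ring

namespace QD

open Finset

variable (Q : QD)

theorem sum_Ioc_eq_range (f : ℕ → ℝ) (n : ℕ) :
    ∑ m ∈ Ioc 0 n, f m = ∑ i ∈ range n, f (i + 1) := by
  induction n with
  | zero => simp
  | succ n ih => rw [Finset.sum_Ioc_succ_top (Nat.zero_le _), ih, sum_range_succ]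

theorem A_sub_sum (n : ℕ) : |Q.A n - n * ∑ b ∈ Ioc 0 n, Q.χ b / b| ≤ n := by
  rw [A_eq, mul_sum, ← sum_sub_distrib]
  refine (abs_sum_le_sum_abs _ _).trans ?_
  calc _ ≤ ∑ b ∈ Ioc 0 n, (1 : ℝ) := by
        refine sum_le_sum fun b hb => ?_
        rw [mem_Ioc] at hb
        have hb' : (0 : ℝ) < b := by exact_mod_cast hb.1
        have e : Q.χ b * ((n / b : ℕ) : ℝ) - n * (Q.χ b / b) = Q.χ b * (((n / b : ℕ) : ℝ) - n / b) := by
          field_simp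
        rw [e, abs_mul]
        have h1 := Nat.floor_div_eq_div (K := ℝ) n b
        have h2 := Nat.floor_le (a := (n : ℝ) / b) (by positivity)
        have h3 := Nat.lt_floor_add_one ((n : ℝ) / b)
        rw [h1] at h2 h3
        calc _ ≤ (1 : ℝ) * 1 := by
              gcongr
              · exact Q.bd b
              · rw [abs_le]; constructor <;> linarith
          _ = 1 := by ring
    _ = n := by simp

theorem c_nonneg : 0 ≤ Q.c := by
  have := (abs_nonneg _).trans (Q.land 1 le_rfl)
  simpa using this

theorem mean_zero : ∑ i ∈ range Q.q, Q.χ (i + 1) = 0 := by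
  set σ := ∑ i ∈ range Q.q, Q.χ (i + 1) with hσ
  have hq : (0 : ℝ) < Q.q := by exact_mod_cast Q.hq
  have hb : ∀ n, |∑ i ∈ range n, (Q.χ (i + 1) - σ / Q.q)| ≤ Q.q * (1 + |σ / Q.q|) := by
    apply periodic_sum_bound Q.hq
    · intro n
      rw [show n + Q.q + 1 = n + 1 + Q.q by ring, Q.per]
    · rw [sum_sub_distrib]; simp only [sum_const, card_range, nsmul_eq_mul]
      rw [← hσ]; field_simp; simp
    · intro n
      exact (abs_sub _ _).trans (add_le_add (Q.bd _) le_rfl)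
  have hb2 : ∀ n, |∑ i ∈ range n, (Q.χ (i + 1) - σ / Q.q) * (1 / ((i : ℝ) + 1))| ≤
      Q.q * (1 + |σ / Q.q|) * 1 := by
    intro n
    have := abel_bound (w := fun i => 1 / ((i : ℝ) + 1)) hb (fun n => by
      push_cast
      gcongr
      linarith) (fun n => by positivity) n
    simpa using this
  by_contra hne
  have hpos : 0 < |σ / Q.q| := by positivity
  have hH : ∀ n : ℕ, 1 ≤ n → |σ / Q.q| * ∑ i ∈ range n, 1 / ((i : ℝ) + 1) ≤
      Q.q * (1 + |σ / Q.q|) + (1 + |Q.ρ| + Q.c) := by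
    intro n hn
    have hn' : (1 : ℝ) ≤ n := by exact_mod_cast hn
    have h1 := Q.A_sub_sum n
    have h2 := Q.land n hn
    have h2' : |Q.A n - Q.ρ * n| ≤ Q.c * n := by
      refine h2.trans (mul_le_mul_of_nonneg_left ?_ Q.c_nonneg)
      rw [Real.sqrt_le_left (by positivity)]; nlinarith
    have h3 : |n * ∑ b ∈ Ioc 0 n, Q.χ b / b| ≤ n * (1 + |Q.ρ| + Q.c) := by
      have e : n * ∑ b ∈ Ioc 0 n, Q.χ b / b = -(Q.A n - n * ∑ b ∈ Ioc 0 n, Q.χ b / b) + (Q.A n - Q.ρ * n) + Q.ρ * n := by ring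
      rw [e]
      refine (abs_add_three _ _ _).trans ?_
      rw [abs_neg, abs_mul Q.ρ, abs_of_nonneg (by positivity : (0:ℝ) ≤ n)]
      nlinarith
    rw [abs_mul, abs_of_nonneg (by positivity : (0:ℝ) ≤ n)] at h3
    have h4 := le_of_mul_le_mul_left h3 (by linarith)
    rw [sum_Ioc_eq_range (fun b => Q.χ b / b)] at h4
    have h5 := hb2 n
    have e : σ / Q.q * ∑ i ∈ range n, 1 / ((i : ℝ) + 1) = ∑ i ∈ range n, Q.χ (i + 1) / ((i + 1 : ℕ) : ℝ) -
      ∑ i ∈ range n, (Q.χ (i + 1) - σ / Q.q) * (1 / ((i : ℝ) + 1)) := by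
      rw [mul_sum, ← sum_sub_distrib]
      refine sum_congr rfl fun i _ => ?_
      push_cast
      ring
    have e2 : |σ / Q.q * ∑ i ∈ range n, 1 / ((i : ℝ) + 1)| = |σ / Q.q| * ∑ i ∈ range n, 1 / ((i : ℝ) + 1) := by
      rw [abs_mul, abs_of_nonneg (a := ∑ i ∈ range n, 1 / ((i : ℝ) + 1)) (sum_nonneg fun i _ => by positivity)]
    rw [← e2, e]
    refine (abs_sub _ _).trans ?_
    linarith
  have ht := Real.tendsto_sum_range_one_div_nat_succ_atTop
  have ht2 := (ht.const_mul_atTop hpos).eventually_gt_atTop (Q.q * (1 + |σ / Q.q|) + (1 + |Q.ρ| + Q.c))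
  obtain ⟨n, hn1, hn2⟩ := (ht2.and (Filter.eventually_ge_atTop 1)).exists
  exact absurd (hH n hn2) (not_le.2 hn1)

theorem S_eq_range (n : ℕ) : Q.S n = ∑ i ∈ range n, Q.χ (i + 1) := sum_Ioc_eq_range _ _

theorem S_per (n : ℕ) : Q.S (n + Q.q) = Q.S n := by
  rw [S_eq_range, S_eq_range]
  refine sum_range_periodic (f := fun i => Q.χ (i + 1)) (fun n => ?_) Q.mean_zero n
  rw [show n + Q.q + 1 = n + 1 + Q.q by ring, Q.per]

theorem S_bd (n : ℕ) : |Q.S n| ≤ Q.q := by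
  rw [S_eq_range]
  have := periodic_sum_bound Q.hq (f := fun i => Q.χ (i + 1)) (M := 1) (fun n => by
    rw [show n + Q.q + 1 = n + 1 + Q.q by ring, Q.per]) Q.mean_zero (fun n => Q.bd _) n
  simpa using this

/-- Mean of `S`. -/
noncomputable def Sb : ℝ := (∑ i ∈ range Q.q, Q.S i) / Q.q

theorem q_pos : (0 : ℝ) < Q.q := by exact_mod_cast Q.hq

theorem q_one : (1 : ℝ) ≤ Q.q := by exact_mod_cast Q.hq

theorem Sb_bd : |Q.Sb| ≤ Q.q := by
  unfold Sb
  rw [abs_div, abs_of_pos Q.q_pos, div_le_iff₀ Q.q_pos]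
  refine (abs_sum_le_sum_abs _ _).trans ((sum_le_sum fun i _ => Q.S_bd i).trans ?_)
  simp

/-- Centered `S`. -/
noncomputable def s (n : ℕ) : ℝ := Q.S n - Q.Sb

theorem s_per (n : ℕ) : Q.s (n + Q.q) = Q.s n := by simp [s, S_per]

theorem s_bd (n : ℕ) : |Q.s n| ≤ 2 * Q.q := by
  have := abs_sub (Q.S n) Q.Sb
  have := Q.S_bd n
  have := Q.Sb_bd
  unfold s
  linarith

theorem s_mean : ∑ i ∈ range Q.q, Q.s i = 0 := by
  unfold s
  rw [sum_sub_distrib]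
  have := Q.q_pos
  simp only [sum_const, card_range, nsmul_eq_mul, Sb]
  field_simp
  simp

theorem s_sum_bd (n : ℕ) : |∑ i ∈ range n, Q.s i| ≤ 2 * (Q.q : ℝ) ^ 2 := by
  have := periodic_sum_bound Q.hq Q.s_per Q.s_mean Q.s_bd n
  nlinarith

end QD

end

section

namespace QD

open Finset

variable (Q : QD)

/-- Error term in the ideal counting problem. -/
noncomputable def Dl (n : ℕ) : ℝ := Q.A n - Q.ρ * n

/-- Partial sums of `L(1, χ)`. -/
noncomputable def Lb (B : ℕ) : ℝ := ∑ b ∈ Ioc 0 B, Q.χ b / b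

/-- Second order remainder of the partial sums. -/
noncomputable def ee (B : ℕ) : ℝ := Q.Lb B - Q.ρ - Q.s B / B

theorem Lb_bd (B : ℕ) (hB : 0 < B) : |Q.Lb B - Q.ρ| ≤ (1 + 2 * Q.q + Q.c) / B := by
  have hB' : (0 : ℝ) < B := by exact_mod_cast hB
  have h := Q.A_hyp (B * B) B hB (Nat.le_mul_of_pos_left B hB)
  rw [Nat.mul_div_cancel _ hB] at h
  have h1 : |∑ b ∈ Ioc 0 B, Q.χ b * ((B * B / b : ℕ) : ℝ) - B * B * Q.Lb B| ≤ B := by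
    unfold Lb
    rw [mul_sum, ← sum_sub_distrib]
    refine (abs_sum_le_sum_abs _ _).trans ?_
    calc _ ≤ ∑ b ∈ Ioc 0 B, (1 : ℝ) := by
          refine sum_le_sum fun b hb => ?_
          rw [mem_Ioc] at hb
          have hb' : (0 : ℝ) < b := by exact_mod_cast hb.1
          have e : Q.χ b * ((B * B / b : ℕ) : ℝ) - B * B * (Q.χ b / b) =
              Q.χ b * (((B * B / b : ℕ) : ℝ) - ((B * B : ℕ) : ℝ) / b) := by
            push_cast
            field_simp
          rw [e, abs_mul]
          have h1 := Nat.floor_div_eq_div (K := ℝ) (B * B) b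
          have h2 := Nat.floor_le (a := ((B * B : ℕ) : ℝ) / b) (by positivity)
          have h3 := Nat.lt_floor_add_one (((B * B : ℕ) : ℝ) / b)
          rw [h1] at h2 h3
          calc _ ≤ (1 : ℝ) * 1 := by
                gcongr
                · exact Q.bd b
                · rw [abs_le]; constructor <;> linarith
            _ = 1 := by ring
      _ = B := by simp
  have h2 : |∑ k ∈ Ioc 0 B, (Q.S (B * B / k) - Q.S B)| ≤ 2 * Q.q * B := by
    refine (abs_sum_le_sum_abs _ _).trans ?_
    calc _ ≤ ∑ k ∈ Ioc 0 B, (2 * Q.q : ℝ) := by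
          refine sum_le_sum fun k _ => ?_
          have := abs_sub (Q.S (B * B / k)) (Q.S B)
          have := Q.S_bd (B * B / k)
          have := Q.S_bd B
          linarith
      _ = _ := by simp; ring
  have h3 := Q.land (B * B) (Nat.mul_pos hB hB)
  push_cast at h3
  rw [Real.sqrt_mul_self hB'.le] at h3
  change |Q.A (B * B) - _| ≤ _ at h3
  rw [le_div_iff₀ hB']
  have h4 : |Q.Lb B - Q.ρ| * B * B ≤ (1 + 2 * Q.q + Q.c) * B := by
    have e : |Q.Lb B - Q.ρ| * B * B = |B * B * Q.Lb B - Q.ρ * (B * B)| := by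
      rw [show (B:ℝ) * B * Q.Lb B - Q.ρ * (B * B) = (Q.Lb B - Q.ρ) * (B * B) by ring, abs_mul,
        abs_of_pos (by positivity : (0:ℝ) < B * B)]
      ring
    rw [e]
    rw [abs_le] at h1 h2 h3 ⊢
    constructor <;> linarith
  exact le_of_mul_le_mul_right h4 hB'

theorem ee_bd (B : ℕ) (hB : 0 < B) : |Q.ee B| ≤ 4 * (Q.q : ℝ) ^ 2 / (B : ℝ) ^ 2 := by
  have hB' : (0 : ℝ) < B := by exact_mod_cast hB
  have step : ∀ k, Q.ee (B + k) - Q.ee B =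
      ∑ i ∈ range k, Q.s (B + i) * (1 / (((B : ℝ) + i) * (B + i + 1))) := by
    intro k
    induction k with
    | zero => simp
    | succ k ih =>
      rw [sum_range_succ, ← ih]
      have hk : (0 : ℝ) < B + k := by positivity
      have e1 : Q.Lb (B + (k + 1)) = Q.Lb (B + k) + Q.χ (B + k + 1) / ((B : ℝ) + k + 1) := by
        unfold Lb
        rw [← add_assoc, Finset.sum_Ioc_succ_top (Nat.zero_le _)]
        push_cast
        rfl
      have e2 : Q.s (B + (k + 1)) = Q.s (B + k) + Q.χ (B + k + 1) := by
        unfold s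
        rw [← add_assoc, S_succ]
        ring
      unfold ee
      rw [e1, e2]
      push_cast
      field_simp
      ring
  have hs : ∀ n, |∑ i ∈ range n, Q.s (B + i)| ≤ 4 * (Q.q : ℝ) ^ 2 := by
    intro n
    have h := Finset.sum_range_add Q.s B n
    have h1 := Q.s_sum_bd (B + n)
    have h2 := Q.s_sum_bd B
    rw [abs_le] at h1 h2 ⊢
    constructor <;> linarith
  have hst : ∀ k, |Q.ee (B + k) - Q.ee B| ≤ 4 * (Q.q : ℝ) ^ 2 / (B : ℝ) ^ 2 := by
    intro k
    rw [step]
    have := abel_bound (w := fun i : ℕ => 1 / (((B : ℝ) + i) * (B + i + 1))) hs (fun n => by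
      push_cast
      gcongr <;> linarith) (fun n => by positivity) k
    refine this.trans ?_
    rw [mul_one_div]
    push_cast
    gcongr
    nlinarith
  have hlim : Filter.Tendsto (fun k : ℕ => 4 * (Q.q : ℝ) ^ 2 / (B : ℝ) ^ 2 + (1 + 4 * Q.q + Q.c) / (k + 1))
      Filter.atTop (nhds (4 * (Q.q : ℝ) ^ 2 / (B : ℝ) ^ 2 + 0)) := by
    apply Filter.Tendsto.add tendsto_const_nhds
    have := (tendsto_one_div_add_atTop_nhds_zero_nat (𝕜 := ℝ)).const_mul (1 + 4 * (Q.q : ℝ) + Q.c)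
    simpa [div_eq_mul_inv] using this
  rw [add_zero] at hlim
  refine ge_of_tendsto' hlim fun k => ?_
  have h1 := hst k
  have hk : (0 : ℝ) < ((B + k : ℕ) : ℝ) := by push_cast; positivity
  have h2 : |Q.ee (B + k)| ≤ (1 + 4 * Q.q + Q.c) / (k + 1) := by
    have h3 := Q.Lb_bd (B + k) (by omega)
    have h4 : |Q.s (B + k) / ((B + k : ℕ) : ℝ)| ≤ 2 * Q.q / ((B + k : ℕ) : ℝ) := by
      rw [abs_div, abs_of_pos hk]
      gcongr
      exact Q.s_bd _
    have h5 : |Q.ee (B + k)| ≤ (1 + 4 * Q.q + Q.c) / ((B + k : ℕ) : ℝ) := by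
      unfold ee
      refine (abs_sub _ _).trans ((add_le_add h3 h4).trans (le_of_eq ?_))
      ring
    refine h5.trans ?_
    have := Q.c_nonneg
    gcongr
    push_cast
    have : (1 : ℝ) ≤ B := by exact_mod_cast hB
    linarith
  have : |Q.ee B| ≤ |Q.ee (B + k)| + |Q.ee (B + k) - Q.ee B| := by
    have := abs_sub (Q.ee (B + k)) (Q.ee (B + k) - Q.ee B)
    simpa using this
  linarith

/-- Centered sawtooth. -/
noncomputable def w (b n : ℕ) : ℝ := ((b : ℝ) - 1) / (2 * b) - ((n % b : ℕ) : ℝ) / b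

theorem div_eq (b n : ℕ) (hb : 0 < b) :
    ((n / b : ℕ) : ℝ) = n / b + w b n - ((b : ℝ) - 1) / (2 * b) := by
  have hb' : (b : ℝ) ≠ 0 := by positivity
  have h : (n : ℝ) = b * ((n / b : ℕ) : ℝ) + ((n % b : ℕ) : ℝ) := by
    exact_mod_cast (Nat.div_add_mod n b).symm
  unfold w
  field_simp
  linarith

/-- The constant in the decomposition. -/
noncomputable def K0 : ℝ := 64 * (Q.q : ℝ) ^ 2 + 2 * Q.q + (Q.q + (|Q.ρ| + (1 + 2 * Q.q + Q.c)))

theorem dec (n B : ℕ) (hB : 0 < B) (hBn : B ≤ n) (hn : n ≤ 16 * B ^ 2) :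
    |Q.Dl n - (∑ b ∈ Ioc 0 B, Q.χ b * w b n + ∑ k ∈ Ioc 0 (n / B), Q.s (n / k))| ≤ Q.K0 := by
  have hB' : (0 : ℝ) < B := by exact_mod_cast hB
  have hB1 : (1 : ℝ) ≤ B := by exact_mod_cast hB
  have e1 : ∑ b ∈ Ioc 0 B, Q.χ b * ((n / b : ℕ) : ℝ) =
      n * Q.Lb B + ∑ b ∈ Ioc 0 B, Q.χ b * w b n - (Q.S B - Q.Lb B) / 2 := by
    unfold Lb S
    rw [← sum_sub_distrib, sum_div, mul_sum, ← sum_add_distrib, ← sum_sub_distrib]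
    refine sum_congr rfl fun b hb => ?_
    rw [mem_Ioc] at hb
    have hb' : (b : ℝ) ≠ 0 := by have := hb.1; positivity
    rw [div_eq b n hb.1]
    field_simp
  have e2 : ∑ k ∈ Ioc 0 (n / B), (Q.S (n / k) - Q.S B) =
      ∑ k ∈ Ioc 0 (n / B), Q.s (n / k) - ((n / B : ℕ) : ℝ) * Q.s B := by
    have : ∀ k ∈ Ioc 0 (n / B), (Q.S (n / k) - Q.S B) = Q.s (n / k) - Q.s B := fun k _ => by
      unfold s; ring
    rw [sum_congr rfl this, sum_sub_distrib]
    simp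
  have e3 : Q.Dl n - (∑ b ∈ Ioc 0 B, Q.χ b * w b n + ∑ k ∈ Ioc 0 (n / B), Q.s (n / k)) =
      n * Q.ee B + Q.s B * ((n : ℝ) / B - ((n / B : ℕ) : ℝ)) - (Q.S B - Q.Lb B) / 2 := by
    unfold Dl
    rw [Q.A_hyp n B hB hBn, e1, e2]
    unfold ee
    field_simp
    ring
  rw [e3]
  have h1 := Nat.floor_div_eq_div (K := ℝ) n B
  have h2 := Nat.floor_le (a := (n : ℝ) / B) (by positivity)
  have h3 := Nat.lt_floor_add_one ((n : ℝ) / B)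
  rw [h1] at h2 h3
  have b1 : |n * Q.ee B| ≤ 64 * (Q.q : ℝ) ^ 2 := by
    rw [abs_mul, abs_of_nonneg (by positivity : (0 : ℝ) ≤ n)]
    calc (n : ℝ) * |Q.ee B| ≤ (16 * (B : ℝ) ^ 2) * (4 * (Q.q : ℝ) ^ 2 / (B : ℝ) ^ 2) := by
          gcongr
          · exact_mod_cast hn
          · exact Q.ee_bd B hB
      _ = _ := by field_simp; ring
  have b2 : |Q.s B * ((n : ℝ) / B - ((n / B : ℕ) : ℝ))| ≤ 2 * Q.q := by
    rw [abs_mul]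
    calc _ ≤ (2 * Q.q : ℝ) * 1 := by
          gcongr
          · exact Q.s_bd B
          · rw [abs_le]; constructor <;> linarith
      _ = _ := by ring
  have b3 : |Q.Lb B| ≤ |Q.ρ| + (1 + 2 * Q.q + Q.c) := by
    have := Q.Lb_bd B hB
    have h4 : (1 + 2 * (Q.q : ℝ) + Q.c) / B ≤ 1 + 2 * Q.q + Q.c :=
      div_le_self (by have := Q.c_nonneg; positivity) hB1
    have h5 := abs_add_le (Q.Lb B - Q.ρ) Q.ρ
    simp only [sub_add_cancel] at h5
    linarith
  have b4 : |(Q.S B - Q.Lb B) / 2| ≤ Q.q + (|Q.ρ| + (1 + 2 * Q.q + Q.c)) := by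
    have h6 := abs_sub (Q.S B) (Q.Lb B)
    have h7 := Q.S_bd B
    rw [abs_div, abs_of_pos (by norm_num : (0 : ℝ) < 2)]
    have := abs_nonneg (Q.S B - Q.Lb B)
    linarith
  have h8 := abs_sub (n * Q.ee B + Q.s B * ((n : ℝ) / B - ((n / B : ℕ) : ℝ))) ((Q.S B - Q.Lb B) / 2)
  have h9 := abs_add_le (n * Q.ee B) (Q.s B * ((n : ℝ) / B - ((n / B : ℕ) : ℝ)))
  unfold K0
  linarith

theorem w_bd (b n : ℕ) (hb : 0 < b) : |w b n| ≤ 1 := by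
  have hb' : (0 : ℝ) < b := by exact_mod_cast hb
  have h1 : ((n % b : ℕ) : ℝ) + 1 ≤ b := by exact_mod_cast Nat.mod_lt n hb
  have h2 : (0 : ℝ) ≤ ((n % b : ℕ) : ℝ) := by positivity
  have hb1 : (1 : ℝ) ≤ b := by exact_mod_cast hb
  have e : w b n = ((b : ℝ) - 1 - 2 * ((n % b : ℕ) : ℝ)) / (2 * b) := by
    unfold w; field_simp
  rw [e, abs_div, abs_of_pos (by positivity : (0 : ℝ) < 2 * b), div_le_one (by positivity), abs_le]
  constructor <;> linarith

theorem w_per (b n : ℕ) : w b (n + b) = w b n := by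
  unfold w; simp

theorem w_mean (b : ℕ) (hb : 0 < b) : ∑ i ∈ range b, w b i = 0 := by
  have hb' : (b : ℝ) ≠ 0 := by positivity
  have : ∀ i ∈ range b, w b i = ((b : ℝ) - 1) / (2 * b) - (i : ℝ) / b := by
    intro i hi
    unfold w
    rw [Nat.mod_eq_of_lt (mem_range.1 hi)]
  rw [sum_congr rfl this, sum_sub_distrib, ← sum_div (range b) (fun i => (i : ℝ)) (b : ℝ)]
  have h2 : (∑ i ∈ range b, (i : ℝ)) = b * ((b : ℝ) - 1) / 2 := by
    have := Finset.sum_range_id_mul_two b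
    have h3 : ((∑ i ∈ range b, i : ℕ) : ℝ) * 2 = ((b * (b - 1) : ℕ) : ℝ) := by exact_mod_cast this
    push_cast [Nat.cast_sub (show 1 ≤ b from hb)] at h3
    linarith
  rw [h2]
  simp only [sum_const, card_range, nsmul_eq_mul]
  field_simp
  ring

theorem sum_div_range (g : ℕ → ℝ) (k q : ℕ) (hk : 0 < k) :
    ∑ i ∈ range (k * q), g (i / k) = k * ∑ j ∈ range q, g j := by
  induction q with
  | zero => simp
  | succ q ih =>
    rw [Nat.mul_succ, sum_range_add, ih, sum_range_succ, mul_add]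
    congr 1
    have : ∀ i ∈ range k, g ((k * q + i) / k) = g q := by
      intro i hi
      rw [Nat.mul_add_div hk, Nat.div_eq_of_lt (mem_range.1 hi), add_zero]
    rw [sum_congr rfl this]
    simp

theorem sdiv_per (k n : ℕ) (hk : 0 < k) : Q.s ((n + k * Q.q) / k) = Q.s (n / k) := by
  rw [Nat.add_mul_div_left _ _ hk, s_per]

theorem sdiv_mean (k : ℕ) (hk : 0 < k) : ∑ i ∈ range (k * Q.q), Q.s (i / k) = 0 := by
  rw [sum_div_range _ _ _ hk, s_mean, mul_zero]

theorem Ico_bound {f : ℕ → ℝ} {M : ℝ} (hf : ∀ n, |∑ i ∈ range n, f i| ≤ M) (x y : ℕ) :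
    |∑ i ∈ Ico x y, f i| ≤ 2 * M := by
  by_cases h : x ≤ y
  · rw [Finset.sum_Ico_eq_sub _ h]
    have := abs_sub (∑ i ∈ range y, f i) (∑ i ∈ range x, f i)
    have := hf x
    have := hf y
    linarith
  · rw [Finset.Ico_eq_empty_of_le (by omega)]
    have := (abs_nonneg _).trans (hf 0)
    simp; linarith

theorem sum_block : ∃ C : ℝ, 0 ≤ C ∧ ∀ N M : ℕ, 1 ≤ N → M ≤ 2 * N →
    |∑ n ∈ Ico N M, Q.Dl n| ≤ C * N := by
  refine ⟨2 + 4 * (Q.q : ℝ) ^ 2 * 64 + Q.K0, ?_, ?_⟩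
  · have := Q.c_nonneg
    unfold K0; positivity
  intro N M hN hM
  set B := Nat.sqrt N with hBdef
  have hB : 0 < B := Nat.sqrt_pos.2 hN
  have hBN : B * B ≤ N := Nat.sqrt_le N
  have hNB : N < (B + 1) * (B + 1) := Nat.lt_succ_sqrt N
  have hN4 : N ≤ 4 * B ^ 2 := by nlinarith
  have hK : 0 ≤ Q.K0 := by
    have := Q.c_nonneg
    unfold K0; positivity
  have hd : ∀ n ∈ Ico N M, |Q.Dl n - (∑ b ∈ Ioc 0 B, Q.χ b * w b n + ∑ k ∈ Ioc 0 (n / B), Q.s (n / k))| ≤ Q.K0 := by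
    intro n hn
    rw [mem_Ico] at hn
    exact Q.dec n B hB (by nlinarith) (by nlinarith)
  have h1 : |∑ n ∈ Ico N M, (Q.Dl n - (∑ b ∈ Ioc 0 B, Q.χ b * w b n + ∑ k ∈ Ioc 0 (n / B), Q.s (n / k)))| ≤ N * Q.K0 := by
    refine (abs_sum_le_sum_abs _ _).trans ((sum_le_sum hd).trans ?_)
    simp only [sum_const, Nat.card_Ico, nsmul_eq_mul]
    gcongr
    omega
  have h2 : |∑ n ∈ Ico N M, ∑ b ∈ Ioc 0 B, Q.χ b * w b n| ≤ 2 * N := by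
    rw [sum_comm]
    refine (abs_sum_le_sum_abs _ _).trans ?_
    calc _ ≤ ∑ b ∈ Ioc 0 B, (2 * B : ℝ) := by
          refine sum_le_sum fun b hb => ?_
          rw [mem_Ioc] at hb
          rw [← mul_sum, abs_mul]
          have := Ico_bound (periodic_sum_bound hb.1 (w_per b) (w_mean b hb.1) (fun n => w_bd b n hb.1)) N M
          calc _ ≤ (1 : ℝ) * (2 * (b * 1)) := by
                gcongr
                exact Q.bd b
            _ ≤ _ := by
              have : (b : ℝ) ≤ B := by exact_mod_cast hb.2
              linarith
      _ = 2 * ((B * B : ℕ) : ℝ) := by simp; ring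
      _ ≤ _ := by
        have : ((B * B : ℕ) : ℝ) ≤ N := by exact_mod_cast hBN
        linarith
  have h3 : |∑ n ∈ Ico N M, ∑ k ∈ Ioc 0 (n / B), Q.s (n / k)| ≤ 4 * (Q.q : ℝ) ^ 2 * 64 * N := by
    have e : ∑ n ∈ Ico N M, ∑ k ∈ Ioc 0 (n / B), Q.s (n / k) =
        ∑ k ∈ Ioc 0 (8 * B), ∑ n ∈ Ico (max N (k * B)) M, Q.s (n / k) := by
      apply Finset.sum_comm'
      intro n k
      simp only [mem_Ico, mem_Ioc, Nat.le_div_iff_mul_le hB, max_le_iff]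
      constructor
      · rintro ⟨⟨h1, h2⟩, h3, h4⟩
        refine ⟨⟨⟨h1, h4⟩, h2⟩, h3, ?_⟩
        nlinarith
      · rintro ⟨⟨⟨h1, h4⟩, h2⟩, h3, _⟩
        exact ⟨⟨h1, h2⟩, h3, h4⟩
    rw [e]
    refine (abs_sum_le_sum_abs _ _).trans ?_
    calc _ ≤ ∑ k ∈ Ioc 0 (8 * B), (4 * (Q.q : ℝ) ^ 2 * (8 * B)) := by
          refine sum_le_sum fun k hk => ?_
          rw [mem_Ioc] at hk
          have := Ico_bound (periodic_sum_bound (Nat.mul_pos hk.1 Q.hq) (f := fun n => Q.s (n / k))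
            (fun n => Q.sdiv_per k n hk.1) (Q.sdiv_mean k hk.1) (fun n => Q.s_bd _)) (max N (k * B)) M
          refine this.trans ?_
          have hk2 : (k : ℝ) ≤ 8 * B := by exact_mod_cast hk.2
          push_cast
          calc _ = 4 * (Q.q : ℝ) ^ 2 * k := by ring
            _ ≤ _ := by gcongr
      _ = 4 * (Q.q : ℝ) ^ 2 * 64 * ((B * B : ℕ) : ℝ) := by simp; ring
      _ ≤ _ := by gcongr
  rw [sum_sub_distrib, sum_add_distrib] at h1
  rw [abs_le] at h1 h2 h3 ⊢
  constructor <;> linarith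

theorem sum_Dl : ∃ C : ℝ, 0 ≤ C ∧ ∀ M : ℕ, 1 ≤ M → |∑ n ∈ Ico 1 M, Q.Dl n| ≤ C * ((M : ℝ) - 1) := by
  obtain ⟨C, hC, h⟩ := Q.sum_block
  refine ⟨4 * C, by positivity, ?_⟩
  intro M
  induction M using Nat.strong_induction_on with
  | _ M ih =>
    intro hM
    by_cases h2 : M = 1
    · subst h2; simp
    have hM2 : 2 ≤ M := by omega
    set N := (M + 1) / 2 with hN
    have h3 := ih N (by omega) (by omega)
    have h4 := h N M (by omega) (by omega)
    rw [← Finset.sum_Ico_consecutive _ (show 1 ≤ N by omega) (show N ≤ M by omega)]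
    refine (abs_add_le _ _).trans ((add_le_add h3 h4).trans ?_)
    have h5 : (2 : ℝ) * N ≤ M + 1 := by exact_mod_cast (show 2 * N ≤ M + 1 by omega)
    have h6 : (2 : ℝ) ≤ M := by exact_mod_cast hM2
    nlinarith

end QD

end

section

open Finset

/-- Additive character. -/
noncomputable def ec (x : ℝ) : ℂ := Complex.exp (2 * Real.pi * Complex.I * x)

theorem ec_add (x y : ℝ) : ec (x + y) = ec x * ec y := by
  unfold ec; rw [← Complex.exp_add]; push_cast; ring_nf

theorem ec_norm (x : ℝ) : ‖ec x‖ = 1 := by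
  unfold ec
  rw [show (2 * Real.pi * Complex.I * x : ℂ) = ((2 * Real.pi * x : ℝ) : ℂ) * Complex.I by push_cast; ring]
  exact Complex.norm_exp_ofReal_mul_I _

theorem ec_nat_mul (x : ℝ) (n : ℕ) : ec (x * n) = ec x ^ n := by
  unfold ec; rw [← Complex.exp_nat_mul]; push_cast; ring_nf

theorem ec_neg (x : ℝ) : ec (-x) = (starRingEnd ℂ) (ec x) := by
  unfold ec; rw [← Complex.exp_conj]; simp [Complex.conj_ofNat]

theorem ec_nat (n : ℕ) : ec n = 1 := by
  unfold ec
  rw [show (2 * Real.pi * Complex.I * ((n : ℝ) : ℂ) : ℂ) = n * (2 * Real.pi * Complex.I) by push_cast; ring]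
  exact Complex.exp_nat_mul_two_pi_mul_I n

theorem ec_sub_one_norm (x : ℝ) : ‖ec x - 1‖ = 2 * |Real.sin (Real.pi * x)| := by
  have := Complex.norm_exp_I_mul_ofReal_sub_one (2 * Real.pi * x)
  unfold ec
  rw [show (2 * Real.pi * Complex.I * x : ℂ) = Complex.I * ((2 * Real.pi * x : ℝ) : ℂ) by push_cast; ring,
    this, show 2 * Real.pi * x / 2 = Real.pi * x by ring]
  simp

/-- `1/‖e(x)-1‖ ≤ (1/|x| + 1/(1-|x|))/4`. -/
theorem ec_low (x : ℝ) (h0 : 0 < x) (h1 : x < 1) :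
    1 / ‖ec x - 1‖ ≤ (1 / x + 1 / (1 - x)) / 4 ∧ 0 < ‖ec x - 1‖ := by
  rw [ec_sub_one_norm]
  have hpi := Real.pi_pos
  by_cases h : x ≤ 1 / 2
  · have := Real.mul_le_sin (x := Real.pi * x) (by positivity) (by nlinarith)
    have e : 2 / Real.pi * (Real.pi * x) = 2 * x := by field_simp
    rw [e] at this
    rw [abs_of_nonneg (by linarith)]
    refine ⟨?_, by linarith⟩
    have h2 : 1 / (2 * Real.sin (Real.pi * x)) ≤ 1 / (4 * x) := by
      apply one_div_le_one_div_of_le <;> linarith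
    have h3 : 0 < 1 / (1 - x) := by apply one_div_pos.2; linarith
    have h4 : 1 / (4 * x) = 1 / x / 4 := by field_simp
    linarith
  · push Not at h
    have := Real.mul_le_sin (x := Real.pi * (1 - x)) (by nlinarith) (by nlinarith)
    have e : 2 / Real.pi * (Real.pi * (1 - x)) = 2 * (1 - x) := by field_simp
    rw [e, show Real.pi * (1 - x) = Real.pi - Real.pi * x by ring, Real.sin_pi_sub] at this
    rw [abs_of_nonneg (by linarith)]
    refine ⟨?_, by linarith⟩
    have h2 : 1 / (2 * Real.sin (Real.pi * x)) ≤ 1 / (4 * (1 - x)) := by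
      apply one_div_le_one_div_of_le <;> linarith
    have h3 : 0 < 1 / x := by apply one_div_pos.2; linarith
    have h5 : 0 < 1 - x := by linarith
    have h4 : 1 / (4 * (1 - x)) = 1 / (1 - x) / 4 := by field_simp
    linarith

/-- geometric sum bound over an interval -/
theorem ec_geom (x : ℝ) (h0 : 0 < |x|) (h1 : |x| < 1) (a b : ℕ) :
    ‖∑ n ∈ Ico a b, ec (x * n)‖ ≤ (1 / |x| + 1 / (1 - |x|)) / 2 := by
  have key : ∀ x : ℝ, 0 < x → x < 1 → ‖∑ n ∈ Ico a b, ec (x * n)‖ ≤ (1 / x + 1 / (1 - x)) / 2 := by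
    intro x h0 h1
    obtain ⟨h, hp⟩ := ec_low x h0 h1
    by_cases hab : a ≤ b
    · have hne : ec x ≠ 1 := by
        intro h; rw [h] at hp; simp at hp
      simp_rw [ec_nat_mul]
      rw [geom_sum_Ico hne hab, norm_div]
      have : ‖ec x ^ b - ec x ^ a‖ ≤ 2 := by
        refine (norm_sub_le _ _).trans ?_
        simp [norm_pow, ec_norm]; norm_num
      calc _ ≤ 2 / ‖ec x - 1‖ := by gcongr
        _ = 2 * (1 / ‖ec x - 1‖) := by ring
        _ ≤ _ := by linarith
    · rw [Ico_eq_empty (by omega)]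
      simp only [sum_empty, norm_zero]
      have : 0 < 1 - x := by linarith
      positivity
  rcases abs_cases x with ⟨h, h'⟩ | ⟨h, h'⟩
  · rw [h] at h0 h1 ⊢; exact key x h0 h1
  · rw [h] at h0 h1 ⊢
    have := key (-x) h0 h1
    have e : ∑ n ∈ Ico a b, ec (-x * n) = (starRingEnd ℂ) (∑ n ∈ Ico a b, ec (x * n)) := by
      rw [map_sum]
      refine sum_congr rfl fun n _ => ?_
      rw [neg_mul, ec_neg]
    rw [e, RCLike.norm_conj] at this
    exact this

/-- Harmonic type bound for spaced points. -/
theorem spaced_sum {ι : Type*} (s : Finset ι) (y : ι → ℝ) (D : ℕ) (hD : 0 < D)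
    (hy : ∀ i ∈ s, 1 ≤ D * y i ∧ y i ≤ 1)
    (hs : ∀ i ∈ s, ∀ j ∈ s, i ≠ j → 1 ≤ D * |y i - y j|) :
    ∑ i ∈ s, 1 / y i ≤ D * (1 + Real.log D) := by
  have hD' : (0 : ℝ) < D := by exact_mod_cast hD
  let l : ι → ℕ := fun i => ⌊D * y i⌋₊
  have hinj : Set.InjOn l s := by
    intro i hi j hj hij
    by_contra hne
    have h := hs i hi j hj hne
    have hi1 := (hy i hi).1
    have hj1 := (hy j hj).1
    have a1 := Nat.floor_le (by linarith : 0 ≤ (D : ℝ) * y i)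
    have a2 := Nat.lt_floor_add_one ((D : ℝ) * y i)
    have b1 := Nat.floor_le (by linarith : 0 ≤ (D : ℝ) * y j)
    have b2 := Nat.lt_floor_add_one ((D : ℝ) * y j)
    have hij' : ⌊(D : ℝ) * y i⌋₊ = ⌊(D : ℝ) * y j⌋₊ := hij
    rw [hij'] at a1 a2
    have : (D : ℝ) * |y i - y j| < 1 := by
      rw [← abs_of_pos hD', ← abs_mul, abs_lt]
      constructor <;> linarith
    linarith
  have hle : ∀ i ∈ s, 1 / y i ≤ D * ((l i : ℝ)⁻¹) := by
    intro i hi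
    have hi1 := (hy i hi).1
    have a1 := Nat.floor_le (by linarith : 0 ≤ (D : ℝ) * y i)
    have a0 : 1 ≤ ⌊(D : ℝ) * y i⌋₊ := by
      apply Nat.le_floor; simpa using hi1
    have a0' : (1 : ℝ) ≤ l i := by exact_mod_cast a0
    have hyp : 0 < y i := by
      by_contra h; push Not at h; nlinarith
    rw [div_le_iff₀ hyp, mul_right_comm, ← div_eq_mul_inv, le_div_iff₀ (by linarith)]
    simpa using a1
  calc ∑ i ∈ s, 1 / y i ≤ ∑ i ∈ s, D * ((l i : ℝ)⁻¹) := sum_le_sum hle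
    _ = D * ∑ n ∈ s.image l, (n : ℝ)⁻¹ := by
      rw [← mul_sum, sum_image hinj]
    _ ≤ D * ∑ n ∈ Icc 1 D, (n : ℝ)⁻¹ := by
      apply mul_le_mul_of_nonneg_left _ hD'.le
      apply sum_le_sum_of_subset_of_nonneg
      · intro n hn
        obtain ⟨i, hi, rfl⟩ := mem_image.1 hn
        rw [mem_Icc]
        constructor
        · apply Nat.le_floor; simpa using (hy i hi).1
        · apply Nat.floor_le_of_le
          have := (hy i hi).2
          nlinarith
      · intros; positivity
    _ ≤ _ := by
      gcongr
      have := harmonic_le_one_add_log D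
      rw [harmonic_eq_sum_Icc] at this
      push_cast at this
      exact this

theorem large_sieve {ι : Type*} [DecidableEq ι] (s : Finset ι) (θ : ι → ℝ) (c : ι → ℂ) (t : ι → ℕ) (a b : ℕ)
    (D : ℕ) (hD : 0 < D)
    (hs : ∀ i ∈ s, ∀ j ∈ s, i ≠ j → 1 ≤ D * |θ i - θ j| ∧ 1 ≤ D * (1 - |θ i - θ j|)) :
    ∑ n ∈ Ico a b, ‖∑ i ∈ s, c i * (if t i ≤ n then ec (θ i * n) else 0)‖ ^ 2 ≤
      (((b - a : ℕ) : ℝ) + 2 * D * (1 + Real.log D)) * ∑ i ∈ s, ‖c i‖ ^ 2 := by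
  have hD' : (0 : ℝ) < D := by exact_mod_cast hD
  set f : ℕ → ι → ℂ := fun n i => (if t i ≤ n then ec (θ i * n) else 0) with hf
  -- expand
  let K : ι → ι → ℂ := fun i j => ∑ n ∈ Ico a b, f n i * (starRingEnd ℂ) (f n j)
  have hexp : ((∑ n ∈ Ico a b, ‖∑ i ∈ s, c i * f n i‖ ^ 2 : ℝ) : ℂ) =
      ∑ i ∈ s, ∑ j ∈ s, c i * (starRingEnd ℂ) (c j) * K i j := by
    push_cast
    have : ∀ n, ((‖∑ i ∈ s, c i * f n i‖ : ℂ)) ^ 2 = ∑ i ∈ s, ∑ j ∈ s, c i * (starRingEnd ℂ) (c j) * (f n i * (starRingEnd ℂ) (f n j)) := by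
      intro n
      rw [← Complex.mul_conj', map_sum, sum_mul_sum]
      refine sum_congr rfl fun i _ => sum_congr rfl fun j _ => ?_
      rw [map_mul]; ring
    simp_rw [this]
    rw [sum_comm]
    refine sum_congr rfl fun i _ => ?_
    rw [sum_comm]
    refine sum_congr rfl fun j _ => ?_
    rw [← mul_sum]
  let k : ι → ι → ℝ := fun i j => if i = j then ((b - a : ℕ) : ℝ) else
    (1 / |θ i - θ j| + 1 / (1 - |θ i - θ j|)) / 2
  have hk : ∀ i ∈ s, ∀ j ∈ s, ‖K i j‖ ≤ k i j := by
    intro i hi j hj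
    by_cases hij : i = j
    · subst hij
      simp only [K, k, if_true]
      refine (norm_sum_le _ _).trans ?_
      calc _ ≤ ∑ n ∈ Ico a b, (1 : ℝ) := by
            refine sum_le_sum fun n _ => ?_
            rw [norm_mul, RCLike.norm_conj]
            simp only [hf]
            split_ifs <;> simp [ec_norm]
        _ = _ := by simp
    · obtain ⟨h1, h2⟩ := hs i hi j hj hij
      simp only [k, if_neg hij]
      have e : K i j = ∑ n ∈ Ico (max a (max (t i) (t j))) b, ec ((θ i - θ j) * n) := by
        have : Ico (max a (max (t i) (t j))) b = (Ico a b).filter (fun n => t i ≤ n ∧ t j ≤ n) := by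
          ext n; simp only [mem_Ico, mem_filter]; omega
        rw [this, sum_filter]
        refine sum_congr rfl fun n _ => ?_
        simp only [hf]
        by_cases h1 : t i ≤ n <;> by_cases h2 : t j ≤ n <;> simp [h1, h2]
        rw [← ec_neg, ← ec_add]; congr 1; ring
      rw [e]
      apply ec_geom
      · by_contra h; push Not at h; nlinarith
      · by_contra h; push Not at h; nlinarith
  have hsymm : ∀ i j, k i j = k j i := by
    intro i j
    simp only [k, abs_sub_comm (θ i) (θ j), eq_comm (a := i)]
  have hrow : ∀ i ∈ s, ∑ j ∈ s, k i j ≤ ((b - a : ℕ) : ℝ) + 2 * D * (1 + Real.log D) := by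
    intro i hi
    rw [← add_sum_erase s _ hi]
    simp only [k, if_true]
    gcongr
    have e1 : ∑ j ∈ s.erase i, (if i = j then ((b - a : ℕ) : ℝ) else
        (1 / |θ i - θ j| + 1 / (1 - |θ i - θ j|)) / 2) =
        (∑ j ∈ s.erase i, 1 / |θ i - θ j| + ∑ j ∈ s.erase i, 1 / (1 - |θ i - θ j|)) / 2 := by
      rw [← sum_add_distrib, sum_div]
      refine sum_congr rfl fun j hj => ?_
      rw [if_neg (ne_of_mem_erase hj).symm]
    rw [e1]
    have two : ∀ y : ι → ℝ, (y = (fun j => |θ i - θ j|) ∨ y = fun j => 1 - |θ i - θ j|) →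
        ∑ j ∈ s.erase i, 1 / y j ≤ 2 * (D * (1 + Real.log D)) := by
      intro y hy
      rw [← sum_filter_add_sum_filter_not (s.erase i) (fun j => θ i ≤ θ j)]
      have hb : ∀ j ∈ s.erase i, 1 ≤ D * y j ∧ y j ≤ 1 := by
        intro j hj
        have := hs i hi j (mem_of_mem_erase hj) (ne_of_mem_erase hj).symm
        have h0 := abs_nonneg (θ i - θ j)
        rcases hy with rfl | rfl
        · refine ⟨this.1, ?_⟩
          by_contra h; push Not at h
          have : 1 ≤ (D : ℝ) * (1 - |θ i - θ j|) := this.2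
          nlinarith
        · exact ⟨this.2, by linarith⟩
      rw [two_mul]
      apply add_le_add
      · apply spaced_sum _ _ D hD
        · intro j hj; exact hb j (mem_filter.1 hj).1
        · intro j hj j' hj' hne
          have h1 := (hs j (mem_of_mem_erase (mem_filter.1 hj).1) j' (mem_of_mem_erase (mem_filter.1 hj').1) hne).1
          have g1 := (mem_filter.1 hj).2
          have g2 := (mem_filter.1 hj').2
          refine h1.trans (le_of_eq ?_)
          rcases hy with rfl | rfl
          · simp only [abs_of_nonpos (sub_nonpos.2 g1), abs_of_nonpos (sub_nonpos.2 g2)]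
            congr 2; ring
          · simp only [abs_of_nonpos (sub_nonpos.2 g1), abs_of_nonpos (sub_nonpos.2 g2)]
            rw [abs_sub_comm]
            congr 2; ring
      · apply spaced_sum _ _ D hD
        · intro j hj; exact hb j (mem_filter.1 hj).1
        · intro j hj j' hj' hne
          have h1 := (hs j (mem_of_mem_erase (mem_filter.1 hj).1) j' (mem_of_mem_erase (mem_filter.1 hj').1) hne).1
          have g1 := (not_le.1 (mem_filter.1 hj).2).le
          have g2 := (not_le.1 (mem_filter.1 hj').2).le
          refine h1.trans (le_of_eq ?_)
          rcases hy with rfl | rfl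
          · simp only [abs_of_nonneg (sub_nonneg.2 g1), abs_of_nonneg (sub_nonneg.2 g2)]
            rw [abs_sub_comm]
            congr 2; ring
          · simp only [abs_of_nonneg (sub_nonneg.2 g1), abs_of_nonneg (sub_nonneg.2 g2)]
            congr 2; ring
    have t1 := two _ (Or.inl rfl)
    have t2 := two _ (Or.inr rfl)
    linarith
  have hfin : ∑ n ∈ Ico a b, ‖∑ i ∈ s, c i * f n i‖ ^ 2 ≤ ∑ i ∈ s, ∑ j ∈ s, ‖c i‖ * ‖c j‖ * k i j := by
    have h1 : ∑ n ∈ Ico a b, ‖∑ i ∈ s, c i * f n i‖ ^ 2 = ‖((∑ n ∈ Ico a b, ‖∑ i ∈ s, c i * f n i‖ ^ 2 : ℝ) : ℂ)‖ := by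
      rw [Complex.norm_real, Real.norm_of_nonneg]
      exact sum_nonneg fun n _ => by positivity
    rw [h1, hexp]
    refine (norm_sum_le _ _).trans (sum_le_sum fun i hi => (norm_sum_le _ _).trans (sum_le_sum fun j hj => ?_))
    rw [norm_mul, norm_mul, RCLike.norm_conj]
    gcongr
    exact hk i hi j hj
  refine hfin.trans ?_
  have hk0 : ∀ i ∈ s, ∀ j ∈ s, 0 ≤ k i j := fun i hi j hj => (norm_nonneg _).trans (hk i hi j hj)
  calc _ ≤ ∑ i ∈ s, ∑ j ∈ s, (‖c i‖ ^ 2 * k i j / 2 + ‖c j‖ ^ 2 * k j i / 2) := by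
        refine sum_le_sum fun i hi => sum_le_sum fun j hj => ?_
        rw [hsymm j i]
        have := hk0 i hi j hj
        nlinarith [mul_nonneg (sq_nonneg (‖c i‖ - ‖c j‖)) this]
    _ = ∑ i ∈ s, ∑ j ∈ s, ‖c i‖ ^ 2 * k i j := by
        simp_rw [sum_add_distrib]
        rw [sum_comm (f := fun i j => ‖c j‖ ^ 2 * k j i / 2), ← sum_add_distrib]
        refine sum_congr rfl fun i _ => ?_
        rw [← sum_add_distrib]
        refine sum_congr rfl fun j _ => ?_
        ring
    _ ≤ ∑ i ∈ s, ‖c i‖ ^ 2 * (((b - a : ℕ) : ℝ) + 2 * D * (1 + Real.log D)) := by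
        refine sum_le_sum fun i hi => ?_
        rw [← mul_sum]
        gcongr
        exact hrow i hi
    _ = _ := by rw [← sum_mul, mul_comm]

end

section

open Finset

/-- Index family of fractions `v/(rq)`. -/
def fam (R q : ℕ) : Finset (ℕ × ℕ) :=
  (Ioc 0 R ×ˢ Ioo 0 (R * q)).filter (fun p => p.2 < p.1 * q)

theorem mem_fam {R q : ℕ} {p : ℕ × ℕ} : p ∈ fam R q ↔ 0 < p.1 ∧ p.1 ≤ R ∧ 0 < p.2 ∧ p.2 < p.1 * q := by
  simp only [fam, mem_filter, mem_product, mem_Ioc, mem_Ioo]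
  constructor
  · rintro ⟨⟨⟨h1, h2⟩, h3, h4⟩, h5⟩; exact ⟨h1, h2, h3, h5⟩
  · rintro ⟨h1, h2, h3, h5⟩
    exact ⟨⟨⟨h1, h2⟩, h3, lt_of_lt_of_le h5 (Nat.mul_le_mul_right q h2)⟩, h5⟩

theorem sum_fam {R q : ℕ} (f : ℕ × ℕ → ℂ) :
    ∑ p ∈ fam R q, f p = ∑ r ∈ Ioc 0 R, ∑ v ∈ Ioo 0 (r * q), f (r, v) := by
  rw [Finset.sum_sigma']
  refine Finset.sum_nbij' (fun p => ⟨p.1, p.2⟩) (fun p => (p.1, p.2)) ?_ ?_ ?_ ?_ ?_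
  · intro p hp; rw [mem_fam] at hp; simp; tauto
  · intro p hp; rw [mem_fam]; simp at hp; tauto
  · intros; rfl
  · intros; rfl
  · intros; rfl

theorem sum_fam' {R q : ℕ} (f : ℕ × ℕ → ℝ) :
    ∑ p ∈ fam R q, f p = ∑ r ∈ Ioc 0 R, ∑ v ∈ Ioo 0 (r * q), f (r, v) := by
  rw [Finset.sum_sigma']
  refine Finset.sum_nbij' (fun p => ⟨p.1, p.2⟩) (fun p => (p.1, p.2)) ?_ ?_ ?_ ?_ ?_
  · intro p hp; rw [mem_fam] at hp; simp; tauto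
  · intro p hp; rw [mem_fam]; simp at hp; tauto
  · intros; rfl
  · intros; rfl
  · intros; rfl

theorem harm_le (n : ℕ) : ∑ j ∈ Icc 1 n, (1 : ℝ) / j ≤ 1 + Real.log n := by
  have := harmonic_le_one_add_log n
  rw [harmonic_eq_sum_Icc] at this
  push_cast at this
  simpa [one_div] using this

theorem fam_spaced {R q : ℕ} (p p' : ℕ × ℕ) (hp : p ∈ fam R q) (hp' : p' ∈ fam R q)
    (hg : Nat.gcd p.2 (p.1 * q) = Nat.gcd p'.2 (p'.1 * q)) (hne : p ≠ p') :
    1 ≤ (((R * q) ^ 2 : ℕ) : ℝ) * |(p.2 : ℝ) / (p.1 * q : ℕ) - (p'.2 : ℝ) / (p'.1 * q : ℕ)| ∧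
    1 ≤ (((R * q) ^ 2 : ℕ) : ℝ) * (1 - |(p.2 : ℝ) / (p.1 * q : ℕ) - (p'.2 : ℝ) / (p'.1 * q : ℕ)|) := by
  rw [mem_fam] at hp hp'
  obtain ⟨r, v⟩ := p
  obtain ⟨r', v'⟩ := p'
  simp only at *
  obtain ⟨h1, h2, h3, h4⟩ := hp
  obtain ⟨h1', h2', h3', h4'⟩ := hp'
  have hq : 0 < q := by
    rcases Nat.eq_zero_or_pos q with h | h
    · subst h; simp at h4
    · exact h
  have hmle : r * q ≤ R * q := Nat.mul_le_mul_right q h2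
  have hmle' : r' * q ≤ R * q := Nat.mul_le_mul_right q h2'
  have hm : 0 < r * q := by positivity
  have hm' : 0 < r' * q := by positivity
  have hneq : v * (r' * q) ≠ v' * (r * q) := by
    intro h
    have e1 : Nat.gcd (v * (r' * q)) ((r * q) * (r' * q)) = Nat.gcd v (r * q) * (r' * q) := Nat.gcd_mul_right _ _ _
    have e2 : Nat.gcd (v' * (r * q)) ((r' * q) * (r * q)) = Nat.gcd v' (r' * q) * (r * q) := Nat.gcd_mul_right _ _ _
    rw [h, mul_comm (r * q), e2, hg] at e1
    have hgp : 0 < Nat.gcd v' (r' * q) := Nat.gcd_pos_of_pos_left _ h3'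
    have e3 := Nat.eq_of_mul_eq_mul_left hgp e1
    have e4 : r = r' := Nat.eq_of_mul_eq_mul_right hq e3
    subst e4
    have e5 := Nat.eq_of_mul_eq_mul_right hm h
    subst e5
    exact hne rfl
  generalize r * q = m at *
  generalize r' * q = m' at *
  generalize R * q = M at *
  have hmR : (0 : ℝ) < m := by exact_mod_cast hm
  have hmR' : (0 : ℝ) < m' := by exact_mod_cast hm'
  set z : ℤ := (v : ℤ) * m' - v' * m with hz
  have hz0 : z ≠ 0 := by
    intro h; apply hneq; zify; linarith
  have hz1 : (1 : ℝ) ≤ |(z : ℝ)| := by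
    exact_mod_cast Int.one_le_abs hz0
  have hz2 : |(z : ℝ)| + 1 ≤ m * m' := by
    have : |z| + 1 ≤ m * m' := by
      rw [Int.add_one_le_iff, abs_lt]
      zify at h3 h4 h3' h4' hm hm'
      constructor <;> nlinarith
    exact_mod_cast this
  have e : (v : ℝ) / m - v' / m' = z / (m * m') := by
    rw [hz]; push_cast; field_simp
  rw [e, abs_div, abs_of_pos (mul_pos hmR hmR')]
  have hMM : (m : ℝ) * m' ≤ ((M ^ 2 : ℕ) : ℝ) := by
    push_cast; rw [sq]
    have : (m : ℝ) ≤ M := by exact_mod_cast hmle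
    have : (m' : ℝ) ≤ M := by exact_mod_cast hmle'
    gcongr
  have hp := mul_pos hmR hmR'
  constructor
  · rw [mul_div_assoc', le_div_iff₀ hp]
    nlinarith
  · rw [one_sub_div hp.ne', mul_div_assoc', le_div_iff₀ hp]
    nlinarith

theorem fam_ls (R q : ℕ) (hR : 0 < R) (hq : 0 < q) (c : ℕ × ℕ → ℂ) (t : ℕ × ℕ → ℕ) (a b : ℕ) :
    ∑ n ∈ Ico a b, ‖∑ p ∈ fam R q, c p * (if t p ≤ n then ec ((p.2 : ℝ) / (p.1 * q : ℕ) * n) else 0)‖ ^ 2 ≤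
      (1 + Real.log ((R * q : ℕ) : ℝ)) *
      ((((b - a : ℕ) : ℝ) + 2 * (((R * q) ^ 2 : ℕ) : ℝ) * (1 + Real.log (((R * q) ^ 2 : ℕ) : ℝ))) *
        ∑ p ∈ fam R q, (Nat.gcd p.2 (p.1 * q) : ℝ) * ‖c p‖ ^ 2) := by
  set f : ℕ → ℕ × ℕ → ℂ := fun n p => c p * (if t p ≤ n then ec ((p.2 : ℝ) / (p.1 * q : ℕ) * n) else 0) with hf
  set g : ℕ × ℕ → ℕ := fun p => Nat.gcd p.2 (p.1 * q) with hg
  have hmaps : ∀ p ∈ fam R q, g p ∈ Icc 1 (R * q) := by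
    intro p hp
    rw [mem_fam] at hp
    rw [mem_Icc]
    refine ⟨Nat.gcd_pos_of_pos_left _ hp.2.2.1, ?_⟩
    refine (Nat.gcd_le_left _ hp.2.2.1).trans (hp.2.2.2.le.trans (Nat.mul_le_mul_right q hp.2.1))
  set E : ℝ := (((b - a : ℕ) : ℝ) + 2 * (((R * q) ^ 2 : ℕ) : ℝ) * (1 + Real.log (((R * q) ^ 2 : ℕ) : ℝ))) with hE
  have hcs : ∀ n, ‖∑ p ∈ fam R q, f n p‖ ^ 2 ≤ (∑ j ∈ Icc 1 (R * q), (1 : ℝ) / j) *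
      ∑ j ∈ Icc 1 (R * q), (j : ℝ) * ‖∑ p ∈ fam R q with g p = j, f n p‖ ^ 2 := by
    intro n
    rw [← sum_fiberwise_of_maps_to hmaps]
    have h1 := norm_sum_le (Icc 1 (R * q)) (fun j => ∑ p ∈ fam R q with g p = j, f n p)
    refine (pow_le_pow_left₀ (norm_nonneg _) h1 2).trans ?_
    apply Finset.sum_sq_le_sum_mul_sum_of_sq_le_mul
    · intros; positivity
    · intros; positivity
    · intro j hj
      have : (j : ℝ) ≠ 0 := by
        have := (mem_Icc.1 hj).1
        positivity
      field_simp; exact le_rfl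
  have hls : ∀ j, ∑ n ∈ Ico a b, ‖∑ p ∈ fam R q with g p = j, f n p‖ ^ 2 ≤
      E * ∑ p ∈ fam R q with g p = j, ‖c p‖ ^ 2 := by
    intro j
    apply large_sieve _ (fun p => (p.2 : ℝ) / (p.1 * q : ℕ)) c t a b ((R * q) ^ 2) (by positivity)
    intro p hp p' hp' hne
    rw [mem_filter] at hp hp'
    exact fam_spaced p p' hp.1 hp'.1 (by rw [show Nat.gcd p.2 (p.1 * q) = j from hp.2]; exact hp'.2.symm) hne
  have hH := harm_le (R * q)
  have hE0 : 0 ≤ E := by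
    have : 0 ≤ Real.log (((R * q) ^ 2 : ℕ) : ℝ) := Real.log_natCast_nonneg _
    positivity
  calc _ ≤ ∑ n ∈ Ico a b, (∑ j ∈ Icc 1 (R * q), (1 : ℝ) / j) *
      ∑ j ∈ Icc 1 (R * q), (j : ℝ) * ‖∑ p ∈ fam R q with g p = j, f n p‖ ^ 2 := sum_le_sum fun n _ => hcs n
    _ = (∑ j ∈ Icc 1 (R * q), (1 : ℝ) / j) * ∑ j ∈ Icc 1 (R * q), (j : ℝ) *
        ∑ n ∈ Ico a b, ‖∑ p ∈ fam R q with g p = j, f n p‖ ^ 2 := by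
      rw [← mul_sum, sum_comm]
      congr 1
      refine sum_congr rfl fun j _ => ?_
      rw [mul_sum]
    _ ≤ (1 + Real.log ((R * q : ℕ) : ℝ)) * ∑ j ∈ Icc 1 (R * q), (j : ℝ) *
        (E * ∑ p ∈ fam R q with g p = j, ‖c p‖ ^ 2) := by
      apply mul_le_mul hH _ _ ((sum_nonneg fun j _ => by positivity).trans hH)
      · exact sum_le_sum fun j _ => mul_le_mul_of_nonneg_left (hls j) (by positivity)
      · exact sum_nonneg fun j _ => by positivity
    _ = _ := by
      congr 1
      rw [← sum_fiberwise_of_maps_to hmaps, mul_sum]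
      refine sum_congr rfl fun j _ => ?_
      rw [mul_left_comm, mul_sum]
      congr 1
      refine sum_congr rfl fun p hp => ?_
      rw [show Nat.gcd p.2 (p.1 * q) = j from (mem_filter.1 hp).2]

theorem gcd_sum (m : ℕ) (hm : 0 < m) :
    ∑ v ∈ Ioo 0 m, (Nat.gcd v m : ℝ) * (1 / v) ≤ (m.divisors.card : ℝ) * (1 + Real.log m) := by
  calc ∑ v ∈ Ioo 0 m, (Nat.gcd v m : ℝ) * (1 / v) ≤
      ∑ v ∈ Ioo 0 m, ∑ j ∈ m.divisors, (if j ∣ v then (j : ℝ) * (1 / v) else 0) := by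
        refine sum_le_sum fun v hv => ?_
        have hmem : Nat.gcd v m ∈ m.divisors := Nat.mem_divisors.2 ⟨Nat.gcd_dvd_right _ _, hm.ne'⟩
        refine le_trans ?_ (single_le_sum (f := fun j : ℕ => (if j ∣ v then (j : ℝ) * (1 / v) else 0)) ?_ hmem)
        · simp [Nat.gcd_dvd_left]
        · intro j _; split_ifs <;> positivity
    _ = ∑ j ∈ m.divisors, ∑ v ∈ Ioo 0 m, (if j ∣ v then (j : ℝ) * (1 / v) else 0) := sum_comm
    _ ≤ ∑ j ∈ m.divisors, (1 + Real.log m) := by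
        refine sum_le_sum fun j hj => ?_
        have hj0 : 0 < j := Nat.pos_of_mem_divisors hj
        refine le_trans ?_ (harm_le m)
        rw [← sum_filter]
        have hj' : (j : ℝ) ≠ 0 := by positivity
        have : ∑ v ∈ Ioo 0 m with j ∣ v, (j : ℝ) * (1 / v) = ∑ k ∈ ((Ioo 0 m).filter (j ∣ ·)).image (· / j), (1 : ℝ) / k := by
          rw [sum_image]
          · refine sum_congr rfl fun v hv => ?_
            obtain ⟨k, rfl⟩ := (mem_filter.1 hv).2
            rw [Nat.mul_div_cancel_left _ hj0]
            push_cast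
            by_cases hk : k = 0
            · subst hk; simp
            · have : (k : ℝ) ≠ 0 := by exact_mod_cast hk
              field_simp
          · intro v hv v' hv' h
            have a1 := (mem_filter.1 hv).2
            have a2 := (mem_filter.1 hv').2
            simp only at h
            rw [← Nat.div_mul_cancel a1, ← Nat.div_mul_cancel a2, h]
        rw [this]
        apply sum_le_sum_of_subset_of_nonneg
        · intro k hk
          obtain ⟨v, hv, rfl⟩ := mem_image.1 hk
          obtain ⟨hv1, k, rfl⟩ := mem_filter.1 hv
          rw [mem_Ioo] at hv1
          rw [Nat.mul_div_cancel_left _ hj0, mem_Icc]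
          constructor
          · exact Nat.pos_of_mul_pos_left hv1.1
          · exact (Nat.le_mul_of_pos_left k hj0).trans hv1.2.le
        · intros; positivity
    _ = _ := by simp; ring

theorem div_sum (R q : ℕ) (hq : 0 < q) :
    ∑ r ∈ Ioc 0 R, (1 / (r : ℝ)) * ((r * q).divisors.card : ℝ) ≤ q * (1 + Real.log ((R * q : ℕ) : ℝ)) ^ 2 := by
  have hq' : (q : ℝ) ≠ 0 := by positivity
  have h1 : ∀ r ∈ Ioc 0 R, (1 / (r : ℝ)) * ((r * q).divisors.card : ℝ) ≤
      ∑ j ∈ Icc 1 (R * q), (if j ∣ r * q then 1 / (r : ℝ) else 0) := by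
    intro r hr
    rw [mem_Ioc] at hr
    rw [← sum_filter, sum_const, nsmul_eq_mul, mul_comm]
    gcongr
    intro j hj
    rw [mem_filter, mem_Icc]
    have hd := Nat.dvd_of_mem_divisors hj
    refine ⟨⟨Nat.pos_of_mem_divisors hj, ?_⟩, hd⟩
    exact (Nat.le_of_dvd (by have := hr.1; positivity) hd).trans (Nat.mul_le_mul_right q hr.2)
  calc _ ≤ ∑ r ∈ Ioc 0 R, ∑ j ∈ Icc 1 (R * q), (if j ∣ r * q then 1 / (r : ℝ) else 0) := sum_le_sum h1
    _ = ∑ j ∈ Icc 1 (R * q), ∑ r ∈ Ioc 0 R, (if j ∣ r * q then 1 / (r : ℝ) else 0) := sum_comm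
    _ ≤ ∑ j ∈ Icc 1 (R * q), (1 / (j : ℝ)) * (q * (1 + Real.log ((R * q : ℕ) : ℝ))) := by
      refine sum_le_sum fun j hj => ?_
      rw [mem_Icc] at hj
      have hj0 : 0 < j := hj.1
      have hj' : (j : ℝ) ≠ 0 := by positivity
      rw [← sum_filter]
      have e : ∑ r ∈ Ioc 0 R with j ∣ r * q, 1 / (r : ℝ) =
          (1 / (j : ℝ)) * (q * ∑ k ∈ ((Ioc 0 R).filter (j ∣ · * q)).image (· * q / j), (1 : ℝ) / k) := by
        rw [sum_image, mul_sum, mul_sum]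
        · refine sum_congr rfl fun r hr => ?_
          have hr0 := (mem_Ioc.1 (mem_filter.1 hr).1).1
          have hr' : (r : ℝ) ≠ 0 := by positivity
          rw [Nat.cast_div (mem_filter.1 hr).2 hj']
          push_cast
          field_simp
        · intro v hv v' hv' h
          have a1 := (mem_filter.1 hv).2
          have a2 := (mem_filter.1 hv').2
          simp only at h a1 a2
          have : v * q = v' * q := by
            rw [← Nat.div_mul_cancel a1, ← Nat.div_mul_cancel a2, h]
          exact Nat.eq_of_mul_eq_mul_right hq this
      rw [e]
      gcongr
      refine le_trans ?_ (harm_le (R * q))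
      apply sum_le_sum_of_subset_of_nonneg
      · intro k hk
        obtain ⟨r, hr, rfl⟩ := mem_image.1 hk
        obtain ⟨hr1, hd⟩ := mem_filter.1 hr
        rw [mem_Ioc] at hr1
        rw [mem_Icc]
        constructor
        · apply Nat.div_pos (Nat.le_of_dvd _ hd) hj0
          have := hr1.1; positivity
        · exact (Nat.div_le_self _ _).trans (Nat.mul_le_mul_right q hr1.2)
      · intros; positivity
    _ ≤ (1 + Real.log ((R * q : ℕ) : ℝ)) * (q * (1 + Real.log ((R * q : ℕ) : ℝ))) := by
      rw [← sum_mul]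
      have : 0 ≤ Real.log ((R * q : ℕ) : ℝ) := Real.log_natCast_nonneg _
      gcongr
      exact harm_le (R * q)
    _ = _ := by ring

theorem fam_bound (R q : ℕ) (hR : 0 < R) (hq : 0 < q) (c : ℕ × ℕ → ℂ) (t : ℕ × ℕ → ℕ) (a b : ℕ)
    (κ : ℝ) (hκ : 0 ≤ κ)
    (hc : ∀ p ∈ fam R q, ‖c p‖ ^ 2 ≤ κ * (1 / (p.1 : ℝ)) * (1 / p.2 + 1 / ((p.1 * q - p.2 : ℕ) : ℝ))) :
    ∑ n ∈ Ico a b, ‖∑ p ∈ fam R q, c p * (if t p ≤ n then ec ((p.2 : ℝ) / (p.1 * q : ℕ) * n) else 0)‖ ^ 2 ≤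
      2 * κ * q * (((b - a : ℕ) : ℝ) + 4 * (((R * q) ^ 2 : ℕ) : ℝ)) * (1 + Real.log ((R * q : ℕ) : ℝ)) ^ 5 := by
  refine (fam_ls R q hR hq c t a b).trans ?_
  set H := 1 + Real.log ((R * q : ℕ) : ℝ) with hH
  have hl : 0 ≤ Real.log ((R * q : ℕ) : ℝ) := Real.log_natCast_nonneg _
  have hH1 : 1 ≤ H := by linarith
  have h1 : ∑ p ∈ fam R q, (Nat.gcd p.2 (p.1 * q) : ℝ) * ‖c p‖ ^ 2 ≤ 2 * κ * q * H ^ 3 := by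
    calc _ ≤ ∑ p ∈ fam R q, (Nat.gcd p.2 (p.1 * q) : ℝ) * (κ * (1 / (p.1 : ℝ)) * (1 / p.2 + 1 / ((p.1 * q - p.2 : ℕ) : ℝ))) :=
          sum_le_sum fun p hp => mul_le_mul_of_nonneg_left (hc p hp) (by positivity)
      _ = ∑ r ∈ Ioc 0 R, (κ * (1 / (r : ℝ))) * (2 * ∑ v ∈ Ioo 0 (r * q), (Nat.gcd v (r * q) : ℝ) * (1 / v)) := by
          rw [sum_fam']
          refine sum_congr rfl fun r hr => ?_
          have e2 : ∑ v ∈ Ioo 0 (r * q), (Nat.gcd v (r * q) : ℝ) * (1 / v) =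
              ∑ v ∈ Ioo 0 (r * q), (Nat.gcd v (r * q) : ℝ) * (1 / ((r * q - v : ℕ) : ℝ)) := by
            refine Finset.sum_nbij' (fun v => r * q - v) (fun v => r * q - v) ?_ ?_ ?_ ?_ ?_
            · intro v hv; rw [mem_Ioo] at *; omega
            · intro v hv; rw [mem_Ioo] at *; omega
            · intro v hv; rw [mem_Ioo] at *; omega
            · intro v hv; rw [mem_Ioo] at *; omega
            · intro v hv; rw [mem_Ioo] at *
              rw [Nat.sub_sub_self hv.2.le]
              congr 2
              rw [Nat.gcd_comm (r * q - v), Nat.gcd_self_sub_right hv.2.le, Nat.gcd_comm]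
          rw [two_mul]
          nth_rewrite 2 [e2]
          rw [← sum_add_distrib, mul_sum]
          refine sum_congr rfl fun v _ => ?_
          ring
      _ ≤ ∑ r ∈ Ioc 0 R, (κ * (1 / (r : ℝ))) * (2 * (((r * q).divisors.card : ℝ) * H)) := by
          refine sum_le_sum fun r hr => ?_
          rw [mem_Ioc] at hr
          have hr0 := hr.1
          have hrq : 0 < r * q := by positivity
          gcongr
          refine (gcd_sum (r * q) hrq).trans ?_
          gcongr
          rw [hH]
          gcongr
          exact hr.2
      _ = 2 * κ * H * ∑ r ∈ Ioc 0 R, (1 / (r : ℝ)) * ((r * q).divisors.card : ℝ) := by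
          rw [mul_sum]
          refine sum_congr rfl fun r _ => ?_
          ring
      _ ≤ 2 * κ * H * (q * H ^ 2) := by
          gcongr
          exact div_sum R q hq
      _ = _ := by ring
  have h2 : 1 + Real.log (((R * q) ^ 2 : ℕ) : ℝ) ≤ 2 * H := by
    push_cast
    rw [Real.log_pow]
    push_cast at hH hl ⊢
    linarith
  have h3 : 0 ≤ Real.log (((R * q) ^ 2 : ℕ) : ℝ) := Real.log_natCast_nonneg _
  calc _ ≤ H * ((((b - a : ℕ) : ℝ) * H + 2 * (((R * q) ^ 2 : ℕ) : ℝ) * (2 * H)) * (2 * κ * q * H ^ 3)) := by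
        gcongr
        exact le_mul_of_one_le_right (by positivity) hH1
    _ = _ := by ring

end

section

open Finset

theorem ec_sub_nat (n i : ℕ) : ec ((n : ℝ) - i) = 1 := by
  rw [sub_eq_add_neg, ec_add, ec_neg, ec_nat, ec_nat]; simp

theorem range_eq_insert (m : ℕ) (hm : 0 < m) : range m = insert 0 (Ioo 0 m) := by
  ext x; simp; omega

theorem ec_orth (m : ℕ) (hm : 0 < m) (n i : ℕ) (hn : n < m) (hi : i < m) :
    ∑ v ∈ range m, ec ((v : ℝ) / m * ((n : ℝ) - i)) = if n = i then (m : ℂ) else 0 := by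
  have hm' : (m : ℝ) ≠ 0 := by positivity
  have e : ∀ v : ℕ, ec ((v : ℝ) / m * ((n : ℝ) - i)) = ec (((n : ℝ) - i) / m) ^ v := by
    intro v; rw [← ec_nat_mul]; congr 1; ring
  simp_rw [e]
  split_ifs with h
  · subst h
    have : ec (((n : ℝ) - n) / m) = 1 := by simp [ec]
    simp only [this, one_pow]; simp
  · have hne : ec (((n : ℝ) - i) / m) ≠ 1 := by
      intro h1
      have key : ∀ x : ℝ, 0 < x → x < 1 → ec x ≠ 1 := by
        intro x h0 h2 h3
        have := (ec_low x h0 h2).2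
        rw [h3] at this; simp at this
      rcases lt_or_gt_of_ne h with hlt | hgt
      · have hlt' : (n : ℝ) < i := by exact_mod_cast hlt
        have hi' : (i : ℝ) < m := by exact_mod_cast hi
        refine key (((i : ℝ) - n) / m) (by apply div_pos <;> [linarith; positivity]) ?_ ?_
        · rw [div_lt_one (by positivity)]
          have : (0 : ℝ) ≤ n := by positivity
          linarith
        · rw [show ((i : ℝ) - n) / m = -(((n : ℝ) - i) / m) by ring, ec_neg, h1]; simp
      · have hlt' : (i : ℝ) < n := by exact_mod_cast hgt
        have hi' : (n : ℝ) < m := by exact_mod_cast hn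
        refine key (((n : ℝ) - i) / m) (by apply div_pos <;> [linarith; positivity]) ?_ h1
        · rw [div_lt_one (by positivity)]
          have : (0 : ℝ) ≤ i := by positivity
          linarith
    rw [geom_sum_eq hne, ← ec_nat_mul, div_mul_cancel₀ _ hm', ec_sub_nat]
    simp

theorem fourier_exp (m : ℕ) (hm : 0 < m) (F : ℕ → ℝ) (hper : ∀ n, F (n + m) = F n)
    (hmean : ∑ i ∈ range m, F i = 0) (J : ℝ) (hJ : ∑ i ∈ range m, |F (i + 1) - F i| ≤ J) :
    ∃ φ : ℕ → ℂ, (∀ n : ℕ, (F n : ℂ) = ∑ v ∈ Ioo 0 m, φ v * ec ((v : ℝ) / m * n)) ∧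
      ∀ v : ℕ, ‖φ v‖ * ‖ec ((v : ℝ) / m) - 1‖ ≤ J / m := by
  have hm' : (m : ℝ) ≠ 0 := by positivity
  have hmC : (m : ℂ) ≠ 0 := by exact_mod_cast hm.ne'
  let φ : ℕ → ℂ := fun v => (1 / (m : ℂ)) * ∑ i ∈ range m, (F i : ℂ) * ec (-((v : ℝ) / m * i))
  refine ⟨φ, ?_, ?_⟩
  · have hφ0 : φ 0 = 0 := by
      simp only [φ]
      have : ∑ i ∈ range m, (F i : ℂ) * ec (-(((0 : ℕ) : ℝ) / m * i)) = ((∑ i ∈ range m, F i : ℝ) : ℂ) := by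
        push_cast
        refine sum_congr rfl fun i _ => ?_
        simp [ec]
      rw [this, hmean]; simp
    have base : ∀ n < m, (F n : ℂ) = ∑ v ∈ Ioo 0 m, φ v * ec ((v : ℝ) / m * n) := by
      intro n hn
      have e1 : ∑ v ∈ Ioo 0 m, φ v * ec ((v : ℝ) / m * n) = ∑ v ∈ range m, φ v * ec ((v : ℝ) / m * n) := by
        rw [range_eq_insert m hm, sum_insert (by simp), hφ0]; simp
      rw [e1]
      have e2 : ∀ v ∈ range m, φ v * ec ((v : ℝ) / m * n) =
          ∑ i ∈ range m, (1 / (m : ℂ)) * (F i * ec ((v : ℝ) / m * ((n : ℝ) - i))) := by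
        intro v _
        simp only [φ]
        rw [mul_assoc, sum_mul, mul_sum]
        refine sum_congr rfl fun i _ => ?_
        rw [mul_assoc (F i : ℂ), ← ec_add]
        congr 3; ring
      rw [sum_congr rfl e2, sum_comm]
      have e3 : ∀ i ∈ range m, ∑ v ∈ range m, (1 / (m : ℂ)) * (F i * ec ((v : ℝ) / m * ((n : ℝ) - i))) =
          if n = i then (F i : ℂ) else 0 := by
        intro i hi
        rw [← mul_sum, ← mul_sum, ec_orth m hm n i hn (mem_range.1 hi)]
        split_ifs
        · field_simp
        · simp
      rw [sum_congr rfl e3, sum_ite_eq, if_pos (mem_range.2 hn)]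
    intro n
    have hF : F n = F (n % m) := by
      have : Function.Periodic F m := hper
      exact (this.map_mod_nat n).symm
    rw [hF, base _ (Nat.mod_lt n hm)]
    refine sum_congr rfl fun v _ => ?_
    congr 1
    have hn : (n : ℝ) = m * ((n / m : ℕ) : ℝ) + ((n % m : ℕ) : ℝ) := by exact_mod_cast (Nat.div_add_mod n m).symm
    rw [hn, mul_add, ec_add]
    have : (v : ℝ) / m * (m * ((n / m : ℕ) : ℝ)) = ((v * (n / m) : ℕ) : ℝ) := by
      push_cast; field_simp
    rw [this, ec_nat]; simp
  · intro v
    set θ : ℝ := (v : ℝ) / m with hθ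
    let G : ℕ → ℂ := fun i => F i * ec (-(θ * ((i : ℝ) - 1)))
    have hG : G m = G 0 := by
      simp only [G]
      have h1 := hper 0
      rw [zero_add] at h1
      rw [h1]
      congr 1
      rw [show -(θ * ((m : ℝ) - 1)) = -(θ * m) + -(θ * (((0 : ℕ) : ℝ) - 1)) by push_cast; ring, ec_add,
        show θ * m = ((v : ℕ) : ℝ) by rw [hθ]; field_simp, ec_neg, ec_nat]
      simp
    have hshift : ∑ i ∈ range m, G (i + 1) = ∑ i ∈ range m, G i := by
      have h1 := sum_range_succ G m
      have h2 := sum_range_succ' G m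
      rw [hG] at h1
      rw [h1] at h2
      exact (add_right_cancel h2).symm
    have hkey : φ v * (ec θ - 1) = (1 / (m : ℂ)) * ∑ i ∈ range m, ((F (i + 1) - F i : ℝ) : ℂ) * ec (-(θ * i)) := by
      simp only [φ]
      rw [mul_assoc]
      congr 1
      rw [mul_sub, mul_one, sum_mul]
      have : ∑ i ∈ range m, (F i : ℂ) * ec (-(θ * i)) * ec θ = ∑ i ∈ range m, G i := by
        refine sum_congr rfl fun i _ => ?_
        simp only [G]
        rw [mul_assoc, ← ec_add]; congr 2; ring
      rw [this, ← hshift, ← sum_sub_distrib]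
      refine sum_congr rfl fun i _ => ?_
      simp only [G]
      push_cast
      rw [show (i : ℝ) + 1 - 1 = i by ring]
      ring
    rw [← norm_mul, hkey, norm_mul, norm_div, norm_one, Complex.norm_natCast, one_div, inv_mul_eq_div]
    gcongr
    refine (norm_sum_le _ _).trans (le_trans (le_of_eq ?_) hJ)
    refine sum_congr rfl fun i _ => ?_
    rw [norm_mul, ec_norm, mul_one, Complex.norm_real, Real.norm_eq_abs]

/-- A family of mean zero periodic functions. -/
structure Fam (R q : ℕ) (J : ℝ) where
  F : ℕ → ℕ → ℝ
  per : ∀ r, 0 < r → ∀ n, F r (n + r * q) = F r n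
  mean : ∀ r, 0 < r → ∑ i ∈ range (r * q), F r i = 0
  jump : ∀ r, 0 < r → ∑ i ∈ range (r * q), |F r (i + 1) - F r i| ≤ J

theorem ec_pow_sub (x : ℝ) (h : ℕ) : ‖ec (x * h) - 1‖ ≤ h * ‖ec x - 1‖ := by
  rw [ec_nat_mul]
  induction h with
  | zero => simp
  | succ h ih =>
    rw [pow_succ, show ec x ^ h * ec x - 1 = ec x ^ h * (ec x - 1) + (ec x ^ h - 1) by ring]
    refine (norm_add_le _ _).trans ?_
    rw [norm_mul, norm_pow, ec_norm, one_pow, one_mul]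
    push_cast
    linarith

theorem low_fam (m v : ℕ) (h0 : 0 < v) (h1 : v < m) :
    1 / ‖ec ((v : ℝ) / m) - 1‖ ≤ m * (1 / v + 1 / ((m - v : ℕ) : ℝ)) / 4 ∧ 0 < ‖ec ((v : ℝ) / m) - 1‖ := by
  have hm : (0 : ℝ) < m := by exact_mod_cast h0.trans h1
  have hv : (0 : ℝ) < v := by exact_mod_cast h0
  have hvm : (v : ℝ) < m := by exact_mod_cast h1
  have := ec_low ((v : ℝ) / m) (by positivity) (by rw [div_lt_one hm]; exact hvm)
  refine ⟨this.1.trans (le_of_eq ?_), this.2⟩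
  rw [Nat.cast_sub h1.le]
  have : (m : ℝ) - v ≠ 0 := by linarith
  have h3 : 1 - (v : ℝ) / m = (m - v) / m := by field_simp
  rw [h3]
  field_simp

theorem Fam.gen {R q : ℕ} {J : ℝ} (Φ : Fam R q J) (hR : 0 < R) (hq : 0 < q) (hJ : 0 ≤ J)
    (t : ℕ → ℕ) (σ : ℕ → ℝ) (hσ : ∀ r, |σ r| ≤ 1) (a b : ℕ) :
    (∀ h : ℕ, ∑ n ∈ Ico a b, (∑ r ∈ Ioc 0 R, if t r ≤ n then σ r * (Φ.F r (n + h) - Φ.F r n) else 0) ^ 2 ≤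
      2 * (h * J ^ 2) * q * (((b - a : ℕ) : ℝ) + 4 * (((R * q) ^ 2 : ℕ) : ℝ)) * (1 + Real.log ((R * q : ℕ) : ℝ)) ^ 5) ∧
    ∑ n ∈ Ico a b, (∑ r ∈ Ioc 0 R, if t r ≤ n then σ r * Φ.F r n else 0) ^ 2 ≤
      2 * (R * J ^ 2) * q * (((b - a : ℕ) : ℝ) + 4 * (((R * q) ^ 2 : ℕ) : ℝ)) * (1 + Real.log ((R * q : ℕ) : ℝ)) ^ 5 := by
  have hex : ∀ r, ∃ φ : ℕ → ℂ, 0 < r → (∀ n : ℕ, (Φ.F r n : ℂ) = ∑ v ∈ Ioo 0 (r * q), φ v * ec ((v : ℝ) / (r * q : ℕ) * n)) ∧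
      ∀ v : ℕ, ‖φ v‖ * ‖ec ((v : ℝ) / (r * q : ℕ)) - 1‖ ≤ J / (r * q : ℕ) := by
    intro r
    by_cases hr : 0 < r
    · obtain ⟨φ, h⟩   := fourier_exp (r * q) (by positivity) (Φ.F r) (Φ.per r hr) (Φ.mean r hr) J (Φ.jump r hr)
      exact ⟨φ, fun _ => h⟩
    · exact ⟨0, fun h => absurd h hr⟩
  choose φ hφ using hex
  have core : ∀ (g : ℝ → ℂ) (f : ℕ → ℕ → ℝ) (κ : ℝ), 0 ≤ κ →
      (∀ r ∈ Ioc 0 R, ∀ n : ℕ, (f r n : ℂ) = ∑ v ∈ Ioo 0 (r * q), φ r v * g ((v : ℝ) / (r * q : ℕ)) * ec ((v : ℝ) / (r * q : ℕ) * n)) →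
      (∀ p ∈ fam R q, ‖φ p.1 p.2 * g ((p.2 : ℝ) / (p.1 * q : ℕ))‖ ^ 2 ≤ κ * (1 / (p.1 : ℝ)) * (1 / p.2 + 1 / ((p.1 * q - p.2 : ℕ) : ℝ))) →
      ∑ n ∈ Ico a b, (∑ r ∈ Ioc 0 R, if t r ≤ n then σ r * f r n else 0) ^ 2 ≤
      2 * κ * q * (((b - a : ℕ) : ℝ) + 4 * (((R * q) ^ 2 : ℕ) : ℝ)) * (1 + Real.log ((R * q : ℕ) : ℝ)) ^ 5 := by
    intro g f κ hκ hf hc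
    have := fam_bound R q hR hq (fun p => σ p.1 * (φ p.1 p.2 * g ((p.2 : ℝ) / (p.1 * q : ℕ)))) (fun p => t p.1) a b κ hκ ?_
    · refine le_trans (le_of_eq ?_) this
      refine sum_congr rfl fun n _ => ?_
      rw [sum_fam]
      rw [← sq_abs (∑ r ∈ Ioc 0 R, if t r ≤ n then σ r * f r n else 0), ← Real.norm_eq_abs, ← Complex.norm_real]
      congr 2
      push_cast
      refine sum_congr rfl fun r hr => ?_
      split_ifs
      · rw [Complex.ofReal_mul, hf r hr n, mul_sum]
        refine sum_congr rfl fun v _ => ?_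
        push_cast
        ring
      · simp
    · intro p hp
      refine le_trans ?_ (hc p hp)
      rw [norm_mul]
      rw [Complex.norm_real, Real.norm_eq_abs]
      gcongr
      exact mul_le_of_le_one_left (norm_nonneg _) (hσ _)
  have hq1 : (1 : ℝ) ≤ q := by exact_mod_cast hq
  constructor
  · intro h
    apply core (fun x => ec (x * h) - 1) _ (h * J ^ 2) (by positivity)
    · intro r hr n
      have hr := (mem_Ioc.1 hr).1
      push_cast
      rw [(hφ r hr).1, (hφ r hr).1, ← sum_sub_distrib]
      refine sum_congr rfl fun v _ => ?_
      push_cast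
      rw [mul_add, ec_add]; ring
    · intro p hp
      rw [mem_fam] at hp
      obtain ⟨h1, h2, h3, h4⟩ := hp
      obtain ⟨l1, l2⟩ := low_fam (p.1 * q) p.2 h3 h4
      have hb := (hφ p.1 h1).2 p.2
      set x := ‖ec ((p.2 : ℝ) / (p.1 * q : ℕ)) - 1‖ with hx
      set y := ‖φ p.1 p.2‖ with hy
      have hy0 : 0 ≤ y := norm_nonneg _
      have g1 := ec_pow_sub ((p.2 : ℝ) / (p.1 * q : ℕ)) h
      have g2 : ‖ec ((p.2 : ℝ) / (p.1 * q : ℕ) * h) - 1‖ ≤ 2 := by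
        refine (norm_sub_le _ _).trans ?_
        simp [ec_norm]; norm_num
      rw [norm_mul, mul_pow]
      set z := ‖ec ((p.2 : ℝ) / (p.1 * q : ℕ) * h) - 1‖ with hz
      have hz0 : 0 ≤ z := norm_nonneg _
      have hr : (0 : ℝ) < p.1 := by exact_mod_cast h1
      have hm : (0 : ℝ) < (p.1 * q : ℕ) := by exact_mod_cast Nat.mul_pos h1 hq
      have hyx : y ≤ J / (p.1 * q : ℕ) * (1 / x) := by
        rw [mul_one_div, le_div_iff₀ l2]; exact hb
      have hT : (0 : ℝ) ≤ 1 / p.2 + 1 / ((p.1 * q - p.2 : ℕ) : ℝ) := by positivity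
      calc y ^ 2 * z ^ 2 ≤ y ^ 2 * (2 * (h * x)) := by
            gcongr
            rw [sq]; gcongr
        _ = 2 * h * (y * x) * y := by ring
        _ ≤ 2 * h * (J / (p.1 * q : ℕ)) * (J / (p.1 * q : ℕ) * ((p.1 * q : ℕ) * (1 / p.2 + 1 / ((p.1 * q - p.2 : ℕ) : ℝ)) / 4)) := by
            have : y ≤ (J / (p.1 * q : ℕ) * ((p.1 * q : ℕ) * (1 / p.2 + 1 / ((p.1 * q - p.2 : ℕ) : ℝ)) / 4)) :=
              hyx.trans (mul_le_mul_of_nonneg_left l1 (by positivity))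
            gcongr
        _ = (h * J ^ 2 / 2 * (1 / q)) * (1 / p.1) * (1 / p.2 + 1 / ((p.1 * q - p.2 : ℕ) : ℝ)) := by
            push_cast
            field_simp
            ring
        _ ≤ _ := by
            have : 1 / (q : ℝ) ≤ 1 := by rw [div_le_one (by linarith)]; exact hq1
            have h5 : 0 ≤ h * J ^ 2 := by positivity
            have h6 : 0 ≤ 1 / (q : ℝ) := by positivity
            have h7 : h * J ^ 2 / 2 * (1 / (q : ℝ)) ≤ h * J ^ 2 := by nlinarith
            exact mul_le_mul_of_nonneg_right (mul_le_mul_of_nonneg_right h7 (by positivity)) hT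
  · apply core (fun x => 1) _ (R * J ^ 2) (by positivity)
    · intro r hr n
      have hr := (mem_Ioc.1 hr).1
      simp_rw [mul_one]
      exact (hφ r hr).1 n
    · intro p hp
      rw [mem_fam] at hp
      obtain ⟨h1, h2, h3, h4⟩ := hp
      obtain ⟨l1, l2⟩ := low_fam (p.1 * q) p.2 h3 h4
      have hb := (hφ p.1 h1).2 p.2
      rw [mul_one]
      set x := ‖ec ((p.2 : ℝ) / (p.1 * q : ℕ)) - 1‖ with hx
      set y := ‖φ p.1 p.2‖ with hy
      have hy0 : 0 ≤ y := norm_nonneg _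
      have hr : (0 : ℝ) < p.1 := by exact_mod_cast h1
      have hm : (0 : ℝ) < (p.1 * q : ℕ) := by exact_mod_cast Nat.mul_pos h1 hq
      have hyx : y ≤ J / (p.1 * q : ℕ) * (1 / x) := by
        rw [mul_one_div, le_div_iff₀ l2]; exact hb
      set T : ℝ := 1 / p.2 + 1 / ((p.1 * q - p.2 : ℕ) : ℝ) with hTdef
      have hT : (0 : ℝ) ≤ T := by positivity
      have hT2 : T ≤ 2 := by
        have a1 : 1 / (p.2 : ℝ) ≤ 1 := by
          rw [div_le_one (by exact_mod_cast h3)]; exact_mod_cast h3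
        have h5 : 0 < p.1 * q - p.2 := by omega
        have a2 : 1 / ((p.1 * q - p.2 : ℕ) : ℝ) ≤ 1 := by
          rw [div_le_one (by exact_mod_cast h5)]; exact_mod_cast h5
        linarith
      have hRr : (p.1 : ℝ) ≤ R := by exact_mod_cast h2
      have hy2 : y ≤ J * T / 4 := by
        refine (hyx.trans (mul_le_mul_of_nonneg_left l1 (by positivity))).trans (le_of_eq ?_)
        field_simp
      calc y ^ 2 ≤ (J * T / 4) ^ 2 := by gcongr
        _ = J ^ 2 * (T * T) / 16 := by ring
        _ ≤ J ^ 2 * (T * 2) / 16 := by gcongr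
        _ ≤ J ^ 2 * T := by nlinarith [mul_nonneg (sq_nonneg J) hT]
        _ = p.1 * J ^ 2 * (1 / p.1) * T := by field_simp
        _ ≤ _ := by gcongr

end

section

/-- `1 + log x`. -/
noncomputable def lg (x : ℝ) : ℝ := 1 + Real.log x

theorem lg_mono {x y : ℝ} (hx : 0 < x) (h : x ≤ y) : lg x ≤ lg y := by
  unfold lg; gcongr

theorem one_le_lg {x : ℝ} (hx : 1 ≤ x) : 1 ≤ lg x := by
  unfold lg; linarith [Real.log_nonneg hx]

theorem lg_mul {x y : ℝ} (hx : 1 ≤ x) (hy : 1 ≤ y) : lg (x * y) ≤ lg x * lg y := by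
  unfold lg
  rw [Real.log_mul (by linarith) (by linarith)]
  nlinarith [Real.log_nonneg hx, Real.log_nonneg hy, mul_nonneg (Real.log_nonneg hx) (Real.log_nonneg hy)]

namespace QD

open Finset

variable (Q : QD)

theorem sum_per_mul {f : ℕ → ℝ} {r : ℕ} (hper : ∀ n, f (n + r) = f n) (q : ℕ) :
    ∑ i ∈ range (r * q), f i = q * ∑ i ∈ range r, f i := by
  induction q with
  | zero => simp
  | succ q ih =>
    rw [Nat.mul_succ, sum_range_add, ih]
    have : ∀ i, f (r * q + i) = f i := by
      intro i
      have h : Function.Periodic f r := hper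
      have := h.nat_mul q i
      rw [add_comm, mul_comm]; simpa using this
    simp_rw [this]
    push_cast; ring

theorem sum_ite_dvd (r : ℕ) (hr : 0 < r) (c : ℝ) : ∑ i ∈ range r, (if r ∣ i + 1 then c else 0) = c := by
  obtain ⟨k, rfl⟩ : ∃ k, r = k + 1 := ⟨r - 1, by omega⟩
  rw [sum_range_succ, if_pos dvd_rfl, sum_eq_zero, zero_add]
  intro i hi
  rw [mem_range] at hi
  rw [if_neg]
  intro h
  have := Nat.le_of_dvd (by omega) h
  omega

theorem w_jump (r n : ℕ) (hr : 0 < r) : |w r (n + 1) - w r n| ≤ 1 / r + if r ∣ n + 1 then 2 else 0 := by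
  have hr' : (0 : ℝ) < r := by exact_mod_cast hr
  by_cases h : r ∣ n + 1
  · rw [if_pos h]
    have h1 := w_bd r (n + 1) hr
    have h2 := w_bd r n hr
    have h3 := abs_sub (w r (n + 1)) (w r n)
    have : (0 : ℝ) < 1 / r := by positivity
    linarith
  · rw [if_neg h]
    have : (n + 1) % r = n % r + 1 := by
      have h1 : n % r + 1 ≠ r := by
        intro h2
        apply h
        have := Nat.div_add_mod n r
        rw [← this, add_assoc, h2]
        exact dvd_add (dvd_mul_right _ _) dvd_rfl
      have h2 := Nat.mod_lt n hr
      rw [Nat.add_mod]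
      rcases Nat.lt_or_ge 1 r with h3 | h3
      · rw [Nat.mod_eq_of_lt h3, Nat.mod_eq_of_lt (by omega)]
      · omega
    unfold w
    rw [this]
    push_cast
    rw [show ((r : ℝ) - 1) / (2 * r) - ((n % r : ℕ) + 1) / r - (((r : ℝ) - 1) / (2 * r) - ((n % r : ℕ) : ℝ) / r) = -(1 / r) by ring,
      abs_neg, abs_of_pos (by positivity)]
    linarith

theorem s_jump (r n : ℕ) (hr : 0 < r) : |Q.s ((n + 1) / r) - Q.s (n / r)| ≤ if r ∣ n + 1 then 4 * (Q.q : ℝ) else 0 := by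
  by_cases h : r ∣ n + 1
  · rw [if_pos h]
    have h1 := Q.s_bd ((n + 1) / r)
    have h2 := Q.s_bd (n / r)
    have h3 := abs_sub (Q.s ((n + 1) / r)) (Q.s (n / r))
    linarith
  · rw [if_neg h, Nat.succ_div, if_neg h]; simp

theorem Jpos : (0 : ℝ) ≤ 4 * (Q.q : ℝ) ^ 2 := by positivity

/-- sawtooth family -/
noncomputable def F1 (R : ℕ) : Fam R Q.q (4 * (Q.q : ℝ) ^ 2) where
  F := w
  per := fun r hr n => by
    have h : Function.Periodic (w r) r := w_per r
    have := h.nat_mul Q.q n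
    rw [mul_comm r]; simpa using this
  mean := fun r hr => by rw [sum_per_mul (w_per r), w_mean r hr, mul_zero]
  jump := fun r hr => by
    have hr' : (r : ℝ) ≠ 0 := by positivity
    refine (sum_le_sum fun i _ => w_jump r i hr).trans ?_
    rw [sum_per_mul (f := fun i => 1 / (r : ℝ) + if r ∣ i + 1 then 2 else 0)]
    · rw [sum_add_distrib, sum_ite_dvd r hr]
      simp only [sum_const, card_range, nsmul_eq_mul]
      rw [mul_one_div_cancel hr']
      nlinarith [Q.q_one]
    · intro n
      rw [show n + r + 1 = (n + 1) + r by ring]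
      simp

/-- second family -/
noncomputable def F2 (R : ℕ) : Fam R Q.q (4 * (Q.q : ℝ) ^ 2) where
  F := fun r n => Q.s (n / r)
  per := fun r hr n => Q.sdiv_per r n hr
  mean := fun r hr => Q.sdiv_mean r hr
  jump := fun r hr => by
    refine (sum_le_sum fun i _ => Q.s_jump r i hr).trans ?_
    rw [sum_per_mul (f := fun i => if r ∣ i + 1 then 4 * (Q.q : ℝ) else 0)]
    · rw [sum_ite_dvd r hr]
      exact le_of_eq (by ring)
    · intro n
      rw [show n + r + 1 = (n + 1) + r by ring]
      simp

theorem sq_split {x u v E : ℝ} (h : (x - (u + v)) ^ 2 ≤ E ^ 2) : x ^ 2 ≤ 3 * u ^ 2 + 3 * v ^ 2 + 3 * E ^ 2 := by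
  nlinarith [sq_nonneg (u - v), sq_nonneg (u - (x - (u + v))), sq_nonneg (v - (x - (u + v)))]

theorem K0_nonneg : 0 ≤ Q.K0 := by
  have := Q.c_nonneg
  unfold K0; positivity

theorem size_bd (N M B : ℕ) (hB : 0 < B) (hBN : B * B ≤ N) (hM : M ≤ 2 * N) :
    (((M - N : ℕ) : ℝ) + 4 * (((8 * B * Q.q) ^ 2 : ℕ) : ℝ)) * (1 + Real.log ((8 * B * Q.q : ℕ) : ℝ)) ^ 5 ≤
     (257 * (Q.q : ℝ) ^ 2 * (lg (8 * Q.q)) ^ 5) * N * lg N ^ 5 := by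
  have hq := Q.q_one
  have hN : 1 ≤ N := by nlinarith
  have hN' : (1 : ℝ) ≤ N := by exact_mod_cast hN
  have h1 : ((M - N : ℕ) : ℝ) ≤ N := by exact_mod_cast (show M - N ≤ N by omega)
  have h2 : (B : ℝ) * B ≤ N := by exact_mod_cast hBN
  have h3 : ((M - N : ℕ) : ℝ) + 4 * (((8 * B * Q.q) ^ 2 : ℕ) : ℝ) ≤ 257 * (Q.q : ℝ) ^ 2 * N := by
    push_cast
    have : (Q.q : ℝ) ^ 2 * (B * B) ≤ (Q.q : ℝ) ^ 2 * N := by gcongr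
    have : (N : ℝ) ≤ (Q.q : ℝ) ^ 2 * N := by
      apply le_mul_of_one_le_left <;> nlinarith
    nlinarith
  have hBN' : B ≤ N := by nlinarith
  have h4 : 1 + Real.log ((8 * B * Q.q : ℕ) : ℝ) ≤ lg (8 * Q.q) * lg N := by
    refine le_trans ?_ (lg_mul (by linarith) hN')
    have h0 : 0 < 8 * B * Q.q := Nat.mul_pos (by omega) Q.hq
    have : (B : ℝ) ≤ N := by exact_mod_cast hBN'
    refine lg_mono (by exact_mod_cast h0) ?_
    push_cast
    nlinarith
  have h5 : 0 ≤ 1 + Real.log ((8 * B * Q.q : ℕ) : ℝ) := by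
    have := Real.log_natCast_nonneg (8 * B * Q.q)
    linarith
  calc _ ≤ (257 * (Q.q : ℝ) ^ 2 * N) * (lg (8 * Q.q) * lg N) ^ 5 := by gcongr
    _ = _ := by ring

theorem ms_block : ∃ C : ℝ, 0 ≤ C ∧ ∀ N M : ℕ, 1 ≤ N → M ≤ 2 * N →
    ∑ n ∈ Ico N M, Q.Dl n ^ 2 ≤ C * N * Real.sqrt N * lg N ^ 5 := by
  set J := 4 * (Q.q : ℝ) ^ 2 with hJ
  set W := (257 * (Q.q : ℝ) ^ 2 * (lg (8 * Q.q)) ^ 5) with hW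
  have hq := Q.q_one
  have hW0 : 0 ≤ W := by
    have := one_le_lg (show (1 : ℝ) ≤ 8 * Q.q by linarith)
    positivity
  refine ⟨96 * J ^ 2 * Q.q * W + 3 * Q.K0 ^ 2, by positivity, ?_⟩
  intro N M hN hM
  set B := Nat.sqrt N with hBdef
  have hB : 0 < B := Nat.sqrt_pos.2 hN
  have hBN : B * B ≤ N := Nat.sqrt_le N
  have hNB : N < (B + 1) * (B + 1) := Nat.lt_succ_sqrt N
  have hN4 : N ≤ 4 * B ^ 2 := by nlinarith
  have hN' : (1 : ℝ) ≤ N := by exact_mod_cast hN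
  have hlg := one_le_lg hN'
  have hBs : (B : ℝ) ≤ Real.sqrt N := Real.le_sqrt_of_sq_le (by rw [sq]; exact_mod_cast hBN)
  have hs1 : 1 ≤ Real.sqrt N := Real.one_le_sqrt.2 hN'
  have g1 := ((Q.F1 (8 * B)).gen (by positivity) Q.hq Q.Jpos (fun _ => 0) (fun r => if r ≤ B then Q.χ r else 0)
    (fun r => by split_ifs; exacts [Q.bd r, by simp]) N M).2
  have g2 := ((Q.F2 (8 * B)).gen (by positivity) Q.hq Q.Jpos (fun r => r * B) (fun r => 1)
    (fun r => by simp) N M).2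
  have hsz := Q.size_bd N M B hB hBN hM
  set X := (((M - N : ℕ) : ℝ) + 4 * (((8 * B * Q.q) ^ 2 : ℕ) : ℝ)) * (1 + Real.log ((8 * B * Q.q : ℕ) : ℝ)) ^ 5 with hX
  have hX' : 2 * (((8 * B : ℕ) : ℝ) * J ^ 2) * Q.q * (((M - N : ℕ) : ℝ) + 4 * (((8 * B * Q.q) ^ 2 : ℕ) : ℝ)) * (1 + Real.log ((8 * B * Q.q : ℕ) : ℝ)) ^ 5
      ≤ 16 * J ^ 2 * Q.q * W * (N * Real.sqrt N * lg N ^ 5) := by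
    calc _ = 16 * B * J ^ 2 * Q.q * X := by rw [hX]; push_cast; ring
      _ ≤ 16 * Real.sqrt N * J ^ 2 * Q.q * (W * N * lg N ^ 5) := by gcongr
      _ = _ := by ring
  replace g1 := g1.trans hX'
  replace g2 := g2.trans hX'
  have hpt : ∀ n ∈ Ico N M, Q.Dl n ^ 2 ≤
     3 * (∑ r ∈ Ioc 0 (8 * B), if 0 ≤ n then (if r ≤ B then Q.χ r else 0) * (Q.F1 (8 * B)).F r n else 0) ^ 2
     + 3 * (∑ r ∈ Ioc 0 (8 * B), if r * B ≤ n then 1 * (Q.F2 (8 * B)).F r n else 0) ^ 2 + 3 * Q.K0 ^ 2 := by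
    intro n hn
    rw [mem_Ico] at hn
    have hd := Q.dec n B hB (by nlinarith) (by nlinarith)
    have e1 : ∑ b ∈ Ioc 0 B, Q.χ b * w b n =
        ∑ r ∈ Ioc 0 (8 * B), if 0 ≤ n then (if r ≤ B then Q.χ r else 0) * (Q.F1 (8 * B)).F r n else 0 := by
      simp only [Nat.zero_le, if_true, ite_mul, zero_mul]
      rw [← sum_filter]
      refine sum_congr ?_ fun _ _ => rfl
      ext r; simp only [mem_Ioc, mem_filter]; omega
    have e2 : ∑ k ∈ Ioc 0 (n / B), Q.s (n / k) =
        ∑ r ∈ Ioc 0 (8 * B), if r * B ≤ n then 1 * (Q.F2 (8 * B)).F r n else 0 := by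
      rw [← sum_filter]
      refine sum_congr ?_ fun _ _ => (one_mul _).symm
      ext r; simp only [mem_Ioc, mem_filter, Nat.le_div_iff_mul_le hB]
      constructor
      · rintro ⟨h1, h2⟩; exact ⟨⟨h1, by nlinarith⟩, h2⟩
      · rintro ⟨⟨h1, _⟩, h2⟩; exact ⟨h1, h2⟩
    rw [e1, e2] at hd
    generalize (∑ r ∈ Ioc 0 (8 * B), if 0 ≤ n then (if r ≤ B then Q.χ r else 0) * (Q.F1 (8 * B)).F r n else 0) = u at *
    generalize (∑ r ∈ Ioc 0 (8 * B), if r * B ≤ n then 1 * (Q.F2 (8 * B)).F r n else 0) = v at *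
    exact sq_split (sq_le_sq' (abs_le.1 hd).1 (abs_le.1 hd).2)
  refine (sum_le_sum hpt).trans ?_
  rw [sum_add_distrib, sum_add_distrib, ← mul_sum, ← mul_sum, sum_const, Nat.card_Ico, nsmul_eq_mul]
  have h1 : ((M - N : ℕ) : ℝ) ≤ N := by exact_mod_cast (show M - N ≤ N by omega)
  have h6 : ((M - N : ℕ) : ℝ) * (3 * Q.K0 ^ 2) ≤ 3 * Q.K0 ^ 2 * (N * Real.sqrt N * lg N ^ 5) := by
    rw [mul_comm]
    gcongr
    calc ((M - N : ℕ) : ℝ) ≤ N * 1 * 1 ^ 5 := by linarith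
      _ ≤ _ := by gcongr
  linarith

theorem var_block : ∃ C : ℝ, 0 ≤ C ∧ ∀ N M h : ℕ, 1 ≤ N → M ≤ 2 * N → 1 ≤ h → h ≤ Nat.sqrt N →
    ∑ n ∈ Ico N M, (Q.Dl (n + h) - Q.Dl n) ^ 2 ≤ C * N * h * lg N ^ 5 := by
  set J := 4 * (Q.q : ℝ) ^ 2 with hJ
  set W := (257 * (Q.q : ℝ) ^ 2 * (lg (8 * Q.q)) ^ 5) with hW
  have hq := Q.q_one
  have hW0 : 0 ≤ W := by
    have := one_le_lg (show (1 : ℝ) ≤ 8 * Q.q by linarith)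
    positivity
  set E := 2 * Q.K0 + 2 * Q.q with hE
  have hK := Q.K0_nonneg
  refine ⟨12 * J ^ 2 * Q.q * W + 3 * E ^ 2, by positivity, ?_⟩
  intro N M h hN hM hh hhB
  set B := Nat.sqrt N with hBdef
  have hB : 0 < B := Nat.sqrt_pos.2 hN
  have hBN : B * B ≤ N := Nat.sqrt_le N
  have hNB : N < (B + 1) * (B + 1) := Nat.lt_succ_sqrt N
  have hN4 : N ≤ 4 * B ^ 2 := by nlinarith
  have hN' : (1 : ℝ) ≤ N := by exact_mod_cast hN
  have hh' : (1 : ℝ) ≤ h := by exact_mod_cast hh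
  have hlg := one_le_lg hN'
  have g1 := ((Q.F1 (8 * B)).gen (by positivity) Q.hq Q.Jpos (fun _ => 0) (fun r => if r ≤ B then Q.χ r else 0)
    (fun r => by split_ifs; exacts [Q.bd r, by simp]) N M).1 h
  have g2 := ((Q.F2 (8 * B)).gen (by positivity) Q.hq Q.Jpos (fun r => r * B) (fun r => 1)
    (fun r => by simp) N M).1 h
  have hsz := Q.size_bd N M B hB hBN hM
  set X := (((M - N : ℕ) : ℝ) + 4 * (((8 * B * Q.q) ^ 2 : ℕ) : ℝ)) * (1 + Real.log ((8 * B * Q.q : ℕ) : ℝ)) ^ 5 with hX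
  have hX' : 2 * (h * J ^ 2) * Q.q * (((M - N : ℕ) : ℝ) + 4 * (((8 * B * Q.q) ^ 2 : ℕ) : ℝ)) * (1 + Real.log ((8 * B * Q.q : ℕ) : ℝ)) ^ 5
      ≤ 2 * J ^ 2 * Q.q * W * (N * h * lg N ^ 5) := by
    calc _ = 2 * h * J ^ 2 * Q.q * X := by rw [hX]; push_cast; ring
      _ ≤ 2 * h * J ^ 2 * Q.q * (W * N * lg N ^ 5) := by gcongr
      _ = _ := by ring
  replace g1 := g1.trans hX'
  replace g2 := g2.trans hX'
  have hpt : ∀ n ∈ Ico N M, (Q.Dl (n + h) - Q.Dl n) ^ 2 ≤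
     3 * (∑ r ∈ Ioc 0 (8 * B), if 0 ≤ n then (if r ≤ B then Q.χ r else 0) * ((Q.F1 (8 * B)).F r (n + h) - (Q.F1 (8 * B)).F r n) else 0) ^ 2
     + 3 * (∑ r ∈ Ioc 0 (8 * B), if r * B ≤ n then 1 * ((Q.F2 (8 * B)).F r (n + h) - (Q.F2 (8 * B)).F r n) else 0) ^ 2 + 3 * E ^ 2 := by
    intro n hn
    rw [mem_Ico] at hn
    have hd := Q.dec n B hB (by nlinarith) (by nlinarith)
    have hd2 := Q.dec (n + h) B hB (by nlinarith) (by nlinarith)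
    have e1 : ∑ b ∈ Ioc 0 B, Q.χ b * w b (n + h) - ∑ b ∈ Ioc 0 B, Q.χ b * w b n =
        ∑ r ∈ Ioc 0 (8 * B), if 0 ≤ n then (if r ≤ B then Q.χ r else 0) * ((Q.F1 (8 * B)).F r (n + h) - (Q.F1 (8 * B)).F r n) else 0 := by
      simp only [Nat.zero_le, if_true, ite_mul, zero_mul]
      rw [← sum_filter, ← sum_sub_distrib]
      refine sum_congr ?_ fun _ _ => (mul_sub _ _ _).symm
      ext r; simp only [mem_Ioc, mem_filter]; omega
    have hle : n / B ≤ (n + h) / B := Nat.div_le_div_right (by omega)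
    have hle2 : (n + h) / B ≤ n / B + 1 := by
      calc (n + h) / B ≤ (n + B) / B := Nat.div_le_div_right (by omega)
        _ = _ := Nat.add_div_right n hB
    have e2 : ∑ k ∈ Ioc 0 (n / B), Q.s ((n + h) / k) - ∑ k ∈ Ioc 0 (n / B), Q.s (n / k) =
        ∑ r ∈ Ioc 0 (8 * B), if r * B ≤ n then 1 * ((Q.F2 (8 * B)).F r (n + h) - (Q.F2 (8 * B)).F r n) else 0 := by
      rw [← sum_filter, ← sum_sub_distrib]
      refine sum_congr ?_ fun _ _ => (one_mul _).symm
      ext r; simp only [mem_Ioc, mem_filter, Nat.le_div_iff_mul_le hB]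
      constructor
      · rintro ⟨h1, h2⟩; exact ⟨⟨h1, by nlinarith⟩, h2⟩
      · rintro ⟨⟨h1, _⟩, h2⟩; exact ⟨h1, h2⟩
    rw [← Finset.sum_Ioc_consecutive _ (Nat.zero_le (n / B)) hle] at hd2
    have e3 : |∑ k ∈ Ioc (n / B) ((n + h) / B), Q.s ((n + h) / k)| ≤ 2 * Q.q := by
      refine (abs_sum_le_sum_abs _ _).trans ((sum_le_sum fun i _ => Q.s_bd _).trans ?_)
      rw [sum_const, Nat.card_Ioc, nsmul_eq_mul]
      have : (((n + h) / B - n / B : ℕ) : ℝ) ≤ 1 := by exact_mod_cast (show (n + h) / B - n / B ≤ 1 by omega)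
      nlinarith
    generalize (∑ r ∈ Ioc 0 (8 * B), if 0 ≤ n then (if r ≤ B then Q.χ r else 0) * ((Q.F1 (8 * B)).F r (n + h) - (Q.F1 (8 * B)).F r n) else 0) = u at *
    generalize (∑ r ∈ Ioc 0 (8 * B), if r * B ≤ n then 1 * ((Q.F2 (8 * B)).F r (n + h) - (Q.F2 (8 * B)).F r n) else 0) = v at *
    have h4 : (Q.Dl (n + h) - Q.Dl n - (u + v)) ^ 2 ≤ E ^ 2 := by
      rw [abs_le] at hd hd2 e3
      apply sq_le_sq' <;> linarith
    exact sq_split h4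
  refine (sum_le_sum hpt).trans ?_
  rw [sum_add_distrib, sum_add_distrib, ← mul_sum, ← mul_sum, sum_const, Nat.card_Ico, nsmul_eq_mul]
  have h1 : ((M - N : ℕ) : ℝ) ≤ N := by exact_mod_cast (show M - N ≤ N by omega)
  have h6 : ((M - N : ℕ) : ℝ) * (3 * E ^ 2) ≤ 3 * E ^ 2 * (N * h * lg N ^ 5) := by
    rw [mul_comm]
    gcongr
    calc ((M - N : ℕ) : ℝ) ≤ N * 1 * 1 ^ 5 := by linarith
      _ ≤ _ := by gcongr
  linarith

theorem dyadic_sum (f : ℕ → ℝ) (K : ℝ) (hK : 0 ≤ K) (T : ℕ)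
    (hf : ∀ N M : ℕ, 1 ≤ N → M ≤ 2 * N → M ≤ T → N ≤ M → ∑ n ∈ Ico N M, f n ≤ K * N) (M : ℕ) (hM : 1 ≤ M) (hMT : M ≤ T) :
    ∑ n ∈ Ico 1 M, f n ≤ 4 * K * (M - 1) := by
  induction M using Nat.strong_induction_on with
  | _ M ih =>
    by_cases h2 : M = 1
    · subst h2; simp
    have hM2 : 2 ≤ M := by omega
    set N := (M + 1) / 2 with hN
    have h3 := ih N (by omega) (by omega) (by omega)
    have h4 := hf N M (by omega) (by omega) hMT (by omega)
    rw [← Finset.sum_Ico_consecutive _ (show 1 ≤ N by omega) (show N ≤ M by omega)]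
    refine (add_le_add h3 h4).trans ?_
    have h5 : (2 : ℝ) * N ≤ M + 1 := by exact_mod_cast (show 2 * N ≤ M + 1 by omega)
    have h6 : (2 : ℝ) ≤ M := by exact_mod_cast hM2
    nlinarith

theorem Dl_sq (n : ℕ) : Q.Dl n ^ 2 ≤ Q.c ^ 2 * n := by
  rcases Nat.eq_zero_or_pos n with h | h
  · subst h; simp [Dl, A]
  · have h1 := Q.land n h
    have h2 := sq_le_sq' (abs_le.1 h1).1 (abs_le.1 h1).2
    rw [mul_pow, Real.sq_sqrt (by positivity)] at h2
    exact h2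

theorem variance : ∃ C : ℝ, 0 ≤ C ∧ ∀ T h : ℕ, 1 ≤ T → 1 ≤ h →
    ∑ n ∈ Ico 1 T, (Q.Dl (n + h) - Q.Dl n) ^ 2 ≤ C * T * h * lg T ^ 5 := by
  obtain ⟨C1, hC1, ms⟩ := Q.ms_block
  obtain ⟨C2, hC2, var⟩ := Q.var_block
  set K0 := C2 + (2 * C1 + 2 * (C1 * 2 * 2 * lg 2 ^ 5)) + 10 * Q.c ^ 2 with hK0
  have hl2 := one_le_lg (show (1 : ℝ) ≤ 2 by norm_num)
  have hK0p : 0 ≤ K0 := by positivity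
  refine ⟨4 * K0, by positivity, ?_⟩
  intro T h hT hh
  have hT' : (1 : ℝ) ≤ T := by exact_mod_cast hT
  have hh' : (1 : ℝ) ≤ h := by exact_mod_cast hh
  have hlT := one_le_lg hT'
  have key := dyadic_sum (fun n => (Q.Dl (n + h) - Q.Dl n) ^ 2) (K0 * h * lg T ^ 5) (by positivity) T ?_ T hT le_rfl
  · refine key.trans ?_
    have : 0 ≤ K0 * h * lg T ^ 5 := by positivity
    nlinarith
  intro N M hN hM hMT hNM
  have hN' : (1 : ℝ) ≤ N := by exact_mod_cast hN
  have hlN := one_le_lg hN'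
  have hlNT : lg N ≤ lg T := lg_mono (by linarith) (by exact_mod_cast hNM.trans hMT)
  have fin : ∀ c : ℝ, 0 ≤ c → c ≤ K0 → c * N * h * lg N ^ 5 ≤ K0 * h * lg T ^ 5 * N := by
    intro c hc0 hc
    calc c * N * h * lg N ^ 5 ≤ K0 * N * h * lg T ^ 5 := by gcongr
      _ = _ := by ring
  by_cases c1 : h ≤ Nat.sqrt N
  · refine (var N M h hN hM hh c1).trans (fin _ hC2 ?_)
    have : 0 ≤ (2 * C1 + 2 * (C1 * 2 * 2 * lg 2 ^ 5)) + 10 * Q.c ^ 2 := by positivity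
    linarith
  push Not at c1
  have hsp : ∑ n ∈ Ico N M, (Q.Dl (n + h) - Q.Dl n) ^ 2 ≤ 2 * ∑ n ∈ Ico N M, Q.Dl (n + h) ^ 2 + 2 * ∑ n ∈ Ico N M, Q.Dl n ^ 2 := by
    rw [mul_sum, mul_sum, ← sum_add_distrib]
    refine sum_le_sum fun n _ => ?_
    nlinarith [sq_nonneg (Q.Dl (n + h) + Q.Dl n)]
  by_cases c2 : h ≤ N
  · have hNh : N ≤ h ^ 2 := by
      have := Nat.sqrt_lt'.1 c1
      omega
    have hs : Real.sqrt N ≤ h := by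
      rw [Real.sqrt_le_left (by positivity)]; exact_mod_cast hNh
    have hs2 : Real.sqrt ((N + h : ℕ) : ℝ) ≤ 2 * h := by
      rw [Real.sqrt_le_left (by positivity)]
      have : N + h ≤ 4 * h ^ 2 := by nlinarith
      push_cast
      have : (N + h : ℝ) ≤ 4 * h ^ 2 := by exact_mod_cast this
      nlinarith
    have m1 := ms N M hN hM
    have m2 := ms (N + h) (M + h) (by omega) (by omega)
    rw [← Finset.sum_Ico_add' (fun n => Q.Dl n ^ 2) N M h] at m2
    have hlNh : lg ((N + h : ℕ) : ℝ) ≤ lg 2 * lg N := by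
      refine le_trans (lg_mono (by positivity) ?_) (lg_mul (by norm_num) hN')
      exact_mod_cast (show N + h ≤ 2 * N by omega)
    have hlNh0 := one_le_lg (show (1 : ℝ) ≤ ((N + h : ℕ) : ℝ) by exact_mod_cast (show 1 ≤ N + h by omega))
    have m1' : ∑ n ∈ Ico N M, Q.Dl n ^ 2 ≤ C1 * N * h * lg N ^ 5 := m1.trans (by gcongr)
    have m2' : ∑ n ∈ Ico N M, Q.Dl (n + h) ^ 2 ≤ (C1 * 2 * 2 * lg 2 ^ 5) * N * h * lg N ^ 5 := by
      refine m2.trans ?_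
      calc _ ≤ C1 * (2 * N) * (2 * h) * (lg 2 * lg N) ^ 5 := by
            gcongr
            exact_mod_cast (show N + h ≤ 2 * N by omega)
        _ = _ := by ring
    refine le_trans ?_ (fin (2 * C1 + 2 * (C1 * 2 * 2 * lg 2 ^ 5)) (by positivity) ?_)
    · linarith
    · have : 0 ≤ C2 + 10 * Q.c ^ 2 := by positivity
      linarith
  · push Not at c2
    refine le_trans ?_ (fin (10 * Q.c ^ 2) (by positivity) ?_)
    · calc _ ≤ ∑ n ∈ Ico N M, 10 * Q.c ^ 2 * h * 1 := by
            refine sum_le_sum fun n hn => ?_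
            rw [mem_Ico] at hn
            have a1 := Q.Dl_sq n
            have a2 := Q.Dl_sq (n + h)
            have hc2 : 0 ≤ Q.c ^ 2 := by positivity
            have a3 : Q.c ^ 2 * ((n + h : ℕ) : ℝ) ≤ Q.c ^ 2 * (3 * h) := by
              gcongr; exact_mod_cast (show n + h ≤ 3 * h by omega)
            have a4 : Q.c ^ 2 * (n : ℝ) ≤ Q.c ^ 2 * (2 * h) := by
              gcongr; exact_mod_cast (show n ≤ 2 * h by omega)
            nlinarith [sq_nonneg (Q.Dl (n + h) + Q.Dl n)]
        _ ≤ _ := by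
            rw [sum_const, Nat.card_Ico, nsmul_eq_mul]
            have h1 : ((M - N : ℕ) : ℝ) ≤ N := by exact_mod_cast (show M - N ≤ N by omega)
            calc ((M - N : ℕ) : ℝ) * (10 * Q.c ^ 2 * h * 1) ≤ N * (10 * Q.c ^ 2 * h * 1 ^ 5) := by
                  rw [one_pow]; gcongr
              _ ≤ N * (10 * Q.c ^ 2 * h * lg N ^ 5) := by gcongr
              _ = _ := by ring
    · have : 0 ≤ C2 + (2 * C1 + 2 * (C1 * 2 * 2 * lg 2 ^ 5)) := by positivity
      linarith

end QD

end

section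

open MeasureTheory Set

/-- Measurable and locally bounded real functions. -/
structure LB {α : Type*} [TopologicalSpace α] [MeasurableSpace α] (f : α → ℝ) : Prop where
  meas : Measurable f
  bdd : ∀ K : Set α, IsCompact K → ∃ C, ∀ x ∈ K, |f x| ≤ C

namespace LB

variable {α β : Type*} [TopologicalSpace α] [MeasurableSpace α] [BorelSpace α]
  [TopologicalSpace β] [MeasurableSpace β] [BorelSpace β] {f g : α → ℝ}

theorem cont (hf : Continuous f) : LB f :=
  ⟨hf.measurable, fun K hK => by
    obtain ⟨C, hC⟩ := hK.exists_bound_of_continuousOn hf.continuousOn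
    exact ⟨C, fun x hx => by simpa using hC x hx⟩⟩

theorem add (hf : LB f) (hg : LB g) : LB (fun x => f x + g x) :=
  ⟨hf.meas.add hg.meas, fun K hK => by
    obtain ⟨C, hC⟩ := hf.bdd K hK
    obtain ⟨D, hD⟩ := hg.bdd K hK
    exact ⟨C + D, fun x hx => (abs_add_le _ _).trans (add_le_add (hC x hx) (hD x hx))⟩⟩

theorem mul (hf : LB f) (hg : LB g) : LB (fun x => f x * g x) :=
  ⟨hf.meas.mul hg.meas, fun K hK => by
    obtain ⟨C, hC⟩ := hf.bdd K hK
    obtain ⟨D, hD⟩ := hg.bdd K hK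
    refine ⟨C * D, fun x hx => ?_⟩
    rw [abs_mul]
    exact mul_le_mul (hC x hx) (hD x hx) (abs_nonneg _) ((abs_nonneg _).trans (hC x hx))⟩

theorem const (c : ℝ) : LB (fun _ : α => c) := cont continuous_const

theorem sub (hf : LB f) (hg : LB g) : LB (fun x => f x - g x) := by
  have := hf.add ((const (-1)).mul hg)
  convert this using 2
  ring

theorem sq (hf : LB f) : LB (fun x => f x ^ 2) := by
  have := hf.mul hf
  convert this using 2
  ring

theorem comp {φ : β → α} (hf : LB f) (hφ : Continuous φ) : LB (fun x => f (φ x)) :=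
  ⟨hf.meas.comp hφ.measurable, fun K hK => by
    obtain ⟨C, hC⟩ := hf.bdd _ (hK.image hφ)
    exact ⟨C, fun x hx => hC _ (mem_image_of_mem _ hx)⟩⟩

theorem ii {f : ℝ → ℝ} (hf : LB f) (a b : ℝ) : IntervalIntegrable f volume a b := by
  rw [intervalIntegrable_iff]
  obtain ⟨C, hC⟩ := hf.bdd _ (isCompact_uIcc (a := a) (b := b))
  refine Measure.integrableOn_of_bounded (M := C) (by simp [uIoc]) hf.meas.aestronglyMeasurable ?_
  refine (ae_restrict_iff' measurableSet_uIoc).2 (Filter.Eventually.of_forall fun x hx => ?_)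
  exact hC x (uIoc_subset_uIcc hx)

theorem iprod {F : ℝ × ℝ → ℝ} (hf : LB F) (a b c d : ℝ) :
    IntegrableOn F (uIoc a b ×ˢ uIoc c d) := by
  obtain ⟨C, hC⟩ := hf.bdd _ ((isCompact_uIcc (a := a) (b := b)).prod (isCompact_uIcc (a := c) (b := d)))
  refine Measure.integrableOn_of_bounded (M := C) ?_ hf.meas.aestronglyMeasurable ?_
  · rw [Measure.volume_eq_prod, Measure.prod_prod]
    simp [uIoc, ENNReal.mul_eq_top]
  refine (ae_restrict_iff' (measurableSet_uIoc.prod measurableSet_uIoc)).2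
    (Filter.Eventually.of_forall fun x hx => ?_)
  exact hC x ⟨uIoc_subset_uIcc hx.1, uIoc_subset_uIcc hx.2⟩

theorem swap {F : ℝ → ℝ → ℝ} (hf : LB (fun p : ℝ × ℝ => F p.1 p.2)) (a b c d : ℝ) :
    ∫ x in a..b, ∫ y in c..d, F x y = ∫ y in c..d, ∫ x in a..b, F x y :=
  intervalIntegral_intervalIntegral_swap (hf.iprod a b c d)

theorem int {F : ℝ → ℝ → ℝ} (hf : LB (fun p : ℝ × ℝ => F p.1 p.2)) (c d : ℝ) :
    LB (fun x => ∫ y in c..d, F x y) := by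
  constructor
  · have : ∀ c d : ℝ, Measurable (fun x => ∫ y in Ioc c d, F x y) := fun c d =>
      (StronglyMeasurable.integral_prod_right (ν := volume.restrict (Ioc c d))
        hf.meas.stronglyMeasurable).measurable
    exact (this c d).sub (this d c)
  · intro K hK
    obtain ⟨C, hC⟩ := hf.bdd _ (hK.prod (isCompact_uIcc (a := c) (b := d)))
    refine ⟨C * |d - c|, fun x hx => ?_⟩
    have h3 : ∀ y ∈ uIoc c d, ‖F x y‖ ≤ C := fun y hy =>
      hC (x, y) ⟨hx, uIoc_subset_uIcc hy⟩
    exact intervalIntegral.norm_integral_le_of_norm_le_const h3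

end LB

theorem int_le_const {f : ℝ → ℝ} (hf : LB f) {a b K : ℝ} (hab : a ≤ b)
    (h : ∀ x ∈ Ioo a b, f x ≤ K) : ∫ x in a..b, f x ≤ K * (b - a) := by
  have := intervalIntegral.integral_mono_on_of_le_Ioo hab (hf.ii a b)
    (intervalIntegrable_const (c := K) (μ := volume)) h
  simpa [mul_comm] using this

theorem int_le {f g : ℝ → ℝ} (hf : LB f) (hg : LB g) {a b : ℝ} (hab : a ≤ b)
    (h : ∀ x ∈ Ioo a b, f x ≤ g x) : ∫ x in a..b, f x ≤ ∫ x in a..b, g x :=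
  intervalIntegral.integral_mono_on_of_le_Ioo hab (hf.ii a b) (hg.ii a b) h

theorem int_sub {f : ℝ → ℝ} (hf : LB f) (h0 : ∀ x, 0 ≤ f x) {a b c d : ℝ} (hca : c ≤ a)
    (hab : a ≤ b) (hbd : b ≤ d) : ∫ x in a..b, f x ≤ ∫ x in c..d, f x :=
  intervalIntegral.integral_mono_interval hca hab hbd (Filter.Eventually.of_forall h0) (hf.ii c d)

theorem abs_int_le {f : ℝ → ℝ} (hf : LB f) {a b K : ℝ} (hab : a ≤ b)
    (h : ∀ x ∈ Ioo a b, |f x| ≤ K) : |∫ x in a..b, f x| ≤ K * (b - a) := by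
  rw [abs_le]
  constructor
  · have h2 : LB (fun x => -1 * f x) := (LB.const (-1)).mul hf
    have := int_le_const h2 hab (K := K) fun x hx => by linarith [(abs_le.1 (h x hx)).1]
    rw [intervalIntegral.integral_const_mul] at this
    linarith
  · exact int_le_const hf hab fun x hx => (abs_le.1 (h x hx)).2

namespace QD

variable (Q : QD)

/-- Continuous error term. -/
noncomputable def E (x : ℝ) : ℝ := Q.A ⌊x⌋₊ - Q.ρ * x

/-- Constant bounding the error term. -/
noncomputable def KE : ℝ := Q.c + |Q.ρ|

theorem KE_nonneg : 0 ≤ Q.KE := add_nonneg Q.c_nonneg (abs_nonneg _)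

theorem E_bound' (x : ℝ) (hx : 0 ≤ x) : |Q.E x| ≤ Q.KE * Real.sqrt x + |Q.ρ| := by
  have h1 : Q.E x = Q.Dl ⌊x⌋₊ - Q.ρ * (x - ⌊x⌋₊) := by unfold E Dl; ring
  have h2 : |Q.Dl ⌊x⌋₊| ≤ Q.c * Real.sqrt x := by
    apply abs_le_of_sq_le_sq _ (mul_nonneg Q.c_nonneg (Real.sqrt_nonneg _))
    rw [mul_pow, Real.sq_sqrt hx]
    exact (Q.Dl_sq _).trans (mul_le_mul_of_nonneg_left (Nat.floor_le hx) (sq_nonneg _))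
  have h3 : |Q.ρ * (x - ⌊x⌋₊)| ≤ |Q.ρ| := by
    rw [abs_mul, abs_of_nonneg (sub_nonneg.2 (Nat.floor_le hx))]
    exact mul_le_of_le_one_right (abs_nonneg _) (by linarith [Nat.lt_floor_add_one x])
  rw [h1]
  refine (abs_sub _ _).trans (add_le_add (h2.trans ?_) h3)
  exact mul_le_mul_of_nonneg_right (by unfold KE; linarith [abs_nonneg Q.ρ]) (Real.sqrt_nonneg _)

theorem E_bound (x : ℝ) (hx : 1 ≤ x) : |Q.E x| ≤ 2 * Q.KE * Real.sqrt x := by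
  refine (Q.E_bound' x (by linarith)).trans ?_
  have : 1 ≤ Real.sqrt x := Real.one_le_sqrt.2 hx
  have h2 : |Q.ρ| ≤ Q.KE := by unfold KE; linarith [Q.c_nonneg]
  nlinarith [Q.KE_nonneg]

theorem E_lb : LB Q.E := by
  constructor
  · unfold E
    have h1 : Measurable (fun n : ℕ => Q.A n) := measurable_from_nat
    exact (h1.comp (Nat.measurable_floor (R := ℝ))).sub (measurable_const.mul measurable_id)
  · intro K hK
    obtain ⟨R, hR⟩ := hK.exists_bound_of_continuousOn (f := fun x : ℝ => x) continuousOn_id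
    refine ⟨Q.KE * Real.sqrt R + |Q.ρ| + |Q.ρ| * R, fun x hx => ?_⟩
    have hxR : |x| ≤ R := hR x hx
    have hR0 := (abs_nonneg _).trans hxR
    have hn : 0 ≤ |Q.ρ| * R := by positivity
    have hn2 : 0 ≤ Q.KE * Real.sqrt R := mul_nonneg Q.KE_nonneg (Real.sqrt_nonneg _)
    rcases le_total 0 x with h | h
    · have := Q.E_bound' x h
      have h2 : Q.KE * Real.sqrt x ≤ Q.KE * Real.sqrt R :=
        mul_le_mul_of_nonneg_left (Real.sqrt_le_sqrt ((le_abs_self _).trans hxR)) Q.KE_nonneg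
      linarith
    · have : Q.E x = - (Q.ρ * x) := by
        unfold E
        rw [Nat.floor_of_nonpos h]
        simp [A]
      rw [this, abs_neg, abs_mul]
      have := mul_le_mul_of_nonneg_left hxR (abs_nonneg Q.ρ)
      linarith [abs_nonneg Q.ρ]

theorem var_range : ∃ C : ℝ, 0 ≤ C ∧ ∀ T h : ℕ, 1 ≤ T → 1 ≤ h →
    ∑ n ∈ Finset.range T, (Q.Dl (n + h) - Q.Dl n) ^ 2 ≤ C * T * h * lg T ^ 5 := by
  obtain ⟨C, hC, hv⟩ := Q.variance
  refine ⟨C + Q.c ^ 2, by positivity, fun T h hT hh => ?_⟩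
  have h1 := hv T h hT hh
  rw [Finset.range_eq_Ico, Finset.sum_eq_sum_Ico_succ_bot (by omega)]
  have h2 := Q.Dl_sq h
  have h3 : Q.Dl 0 = 0 := by simp [Dl, A]
  have h5 : (1:ℝ) ≤ lg T ^ 5 := one_le_pow₀ (one_le_lg (by exact_mod_cast hT))
  have h6 : (1:ℝ) ≤ T := by exact_mod_cast hT
  have h7 : Q.c ^ 2 * h ≤ Q.c ^ 2 * T * h * lg T ^ 5 := by
    calc Q.c ^ 2 * h = Q.c ^ 2 * 1 * h * 1 := by ring
      _ ≤ _ := by gcongr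
  simp only [h3, zero_add, sub_zero]
  nlinarith

theorem E_floor (x : ℝ) (m : ℕ) (h : (m:ℝ) ≤ x) (h' : x < m + 1) :
    Q.E x = Q.Dl m - Q.ρ * (x - m) := by
  have : ⌊x⌋₊ = m := by rw [Nat.floor_eq_iff (le_trans (Nat.cast_nonneg _) h)]; exact ⟨h, h'⟩
  unfold E Dl; rw [this]; ring

theorem E_diff (u w : ℝ) (n h : ℕ) (h1 : (n:ℝ) ≤ u) (h2 : u < n + 1)
    (h3 : ((n + h : ℕ) : ℝ) ≤ u + w) (h4 : u + w < ((n + h : ℕ) : ℝ) + 1) :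
    (Q.E (u + w) - Q.E u) ^ 2 ≤ 2 * (Q.Dl (n + h) - Q.Dl n) ^ 2 + 2 * Q.ρ ^ 2 := by
  rw [Q.E_floor u n h1 h2, Q.E_floor _ _ h3 h4]
  push_cast at *
  have h5 : (w - h) ^ 2 ≤ 1 := by
    rw [sq_le_one_iff_abs_le_one, abs_le]; constructor <;> linarith
  have h6 : Q.ρ ^ 2 * (w - h) ^ 2 ≤ Q.ρ ^ 2 := mul_le_of_le_one_right (sq_nonneg _) h5
  nlinarith [sq_nonneg ((Q.Dl (n + h) - Q.Dl n) + Q.ρ * (w - h))]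

theorem unit_big (w : ℝ) (hw : 1 ≤ w) (n : ℕ) :
    ∫ u in (n:ℝ)..((n + 1 : ℕ) : ℝ), (Q.E (u + w) - Q.E u) ^ 2 ≤
      2 * (Q.Dl (n + ⌊w⌋₊) - Q.Dl n) ^ 2 + 2 * (Q.Dl (n + (⌊w⌋₊ + 1)) - Q.Dl n) ^ 2
        + 2 * Q.ρ ^ 2 := by
  have hlb : LB (fun u => (Q.E (u + w) - Q.E u) ^ 2) :=
    ((Q.E_lb.comp (continuous_id.add continuous_const)).sub Q.E_lb).sq
  refine (int_le_const hlb (by push_cast; linarith) (K := 2 * (Q.Dl (n + ⌊w⌋₊) - Q.Dl n) ^ 2 +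
    2 * (Q.Dl (n + (⌊w⌋₊ + 1)) - Q.Dl n) ^ 2 + 2 * Q.ρ ^ 2) fun u hu => ?_).trans (le_of_eq ?_)
  · push_cast at hu
    have hf := Nat.floor_le (by linarith : 0 ≤ w)
    have hf2 := Nat.lt_floor_add_one w
    rcases lt_or_ge (u + w) (((n + ⌊w⌋₊ : ℕ) : ℝ) + 1) with h | h
    · have := Q.E_diff u w n ⌊w⌋₊ hu.1.le hu.2 (by push_cast; linarith [hu.1]) h
      nlinarith [sq_nonneg (Q.Dl (n + (⌊w⌋₊ + 1)) - Q.Dl n)]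
    · have := Q.E_diff u w n (⌊w⌋₊ + 1) hu.1.le hu.2 (by push_cast at *; linarith [hu.1])
        (by push_cast at *; linarith [hu.2])
      nlinarith [sq_nonneg (Q.Dl (n + ⌊w⌋₊) - Q.Dl n)]
  · push_cast; ring

theorem unit_small (w : ℝ) (hw0 : 0 < w) (hw : w < 1) (n : ℕ) :
    ∫ u in (n:ℝ)..((n + 1 : ℕ) : ℝ), (Q.E (u + w) - Q.E u) ^ 2 ≤
      w * (2 * (Q.Dl (n + 1) - Q.Dl n) ^ 2 + 3 * Q.ρ ^ 2) := by
  have hlb : LB (fun u => (Q.E (u + w) - Q.E u) ^ 2) :=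
    ((Q.E_lb.comp (continuous_id.add continuous_const)).sub Q.E_lb).sq
  rw [← intervalIntegral.integral_add_adjacent_intervals (hlb.ii n (n + 1 - w)) (hlb.ii _ _)]
  have h1 : ∫ u in (n:ℝ)..(n + 1 - w), (Q.E (u + w) - Q.E u) ^ 2 ≤ Q.ρ ^ 2 * w * 1 := by
    refine (int_le_const hlb (by linarith) (K := Q.ρ ^ 2 * w) fun u hu => ?_).trans ?_
    · rw [Q.E_floor u n hu.1.le (by linarith [hu.2]), Q.E_floor (u + w) n (by linarith [hu.1])
        (by linarith [hu.2])]
      have : Q.ρ ^ 2 * (w * w) ≤ Q.ρ ^ 2 * w :=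
        mul_le_mul_of_nonneg_left (by nlinarith) (sq_nonneg _)
      nlinarith
    · exact mul_le_mul_of_nonneg_left (by linarith) (by positivity)
  have h2 : ∫ u in ((n:ℝ) + 1 - w)..((n + 1 : ℕ) : ℝ), (Q.E (u + w) - Q.E u) ^ 2 ≤
      (2 * (Q.Dl (n + 1) - Q.Dl n) ^ 2 + 2 * Q.ρ ^ 2) * w := by
    refine (int_le_const hlb (by push_cast; linarith)
      (K := 2 * (Q.Dl (n + 1) - Q.Dl n) ^ 2 + 2 * Q.ρ ^ 2) fun u hu => ?_).trans (le_of_eq ?_)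
    · push_cast at hu
      exact Q.E_diff u w n 1 (by linarith [hu.1]) hu.2 (by push_cast; linarith [hu.1])
        (by push_cast; linarith [hu.2])
    · push_cast; ring
  nlinarith

theorem CV : ∃ C : ℝ, 0 ≤ C ∧ ∀ U w : ℝ, 1 ≤ U → 0 < w →
    ∫ u in (0:ℝ)..U, (Q.E (u + w) - Q.E u) ^ 2 ≤ C * U * w * lg U ^ 5 := by
  obtain ⟨C, hC, hv⟩ := Q.var_range
  refine ⟨64 * (6 * C + 3 * Q.ρ ^ 2), by positivity, fun U w hU hw => ?_⟩
  have hlb : LB (fun u => (Q.E (u + w) - Q.E u) ^ 2) :=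
    ((Q.E_lb.comp (continuous_id.add continuous_const)).sub Q.E_lb).sq
  set T := ⌈U⌉₊ with hT
  have hT1 : U ≤ T := Nat.le_ceil U
  have hT0 : (1:ℝ) ≤ T := hU.trans hT1
  have hT0' : 1 ≤ T := by exact_mod_cast hT0
  have hT2 : (T:ℝ) ≤ 2 * U := by linarith [Nat.ceil_lt_add_one (by linarith : 0 ≤ U)]
  have hL : lg T ^ 5 ≤ 32 * lg U ^ 5 := by
    have h2 : lg T ≤ 2 * lg U := by
      refine (lg_mono (by linarith) hT2).trans ((lg_mul (by norm_num) hU).trans ?_)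
      have : lg 2 ≤ 2 := by unfold lg; linarith [Real.log_two_lt_d9]
      exact mul_le_mul_of_nonneg_right this (by linarith [one_le_lg hU])
    calc lg T ^ 5 ≤ (2 * lg U) ^ 5 := pow_le_pow_left₀ (by linarith [one_le_lg hT0]) h2 5
      _ = _ := by ring
  have hLT : (1:ℝ) ≤ lg T ^ 5 := one_le_pow₀ (one_le_lg hT0)
  have key : ∫ u in (0:ℝ)..U, (Q.E (u + w) - Q.E u) ^ 2 ≤
      (6 * C + 3 * Q.ρ ^ 2) * T * w * lg T ^ 5 := by
    refine (int_sub hlb (fun _ => sq_nonneg _) le_rfl (by linarith) hT1).trans ?_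
    have hs := intervalIntegral.sum_integral_adjacent_intervals (a := fun n : ℕ => (n:ℝ)) (n := T)
      (μ := volume) (f := fun u => (Q.E (u + w) - Q.E u) ^ 2) fun k _ => hlb.ii _ _
    rw [Nat.cast_zero] at hs
    rw [← hs]
    rcases le_or_gt 1 w with h | h
    · refine (Finset.sum_le_sum fun n _ => Q.unit_big w h n).trans ?_
      rw [Finset.sum_add_distrib, Finset.sum_add_distrib, ← Finset.mul_sum, ← Finset.mul_sum]
      have hf : 1 ≤ ⌊w⌋₊ := Nat.one_le_floor_iff _ |>.2 h
      have h1 := hv T ⌊w⌋₊ hT0' hf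
      have h2 := hv T (⌊w⌋₊ + 1) hT0' (by omega)
      have hfw := Nat.floor_le hw.le
      have h3 : C * T * (⌊w⌋₊ : ℝ) * lg T ^ 5 ≤ C * T * w * lg T ^ 5 := by gcongr
      have h4 : C * T * ((⌊w⌋₊ + 1 : ℕ) : ℝ) * lg T ^ 5 ≤ C * T * (2 * w) * lg T ^ 5 := by
        gcongr; push_cast; linarith
      have h5 : ∑ n ∈ Finset.range T, 2 * Q.ρ ^ 2 ≤ 2 * Q.ρ ^ 2 * T * w * lg T ^ 5 := by
        rw [Finset.sum_const, Finset.card_range, nsmul_eq_mul]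
        calc (T:ℝ) * (2 * Q.ρ ^ 2) = 2 * Q.ρ ^ 2 * T * 1 * 1 := by ring
          _ ≤ _ := by gcongr
      have h6 : 0 ≤ Q.ρ ^ 2 * T * w * lg T ^ 5 := by positivity
      linarith
    · refine (Finset.sum_le_sum fun n _ => Q.unit_small w hw h n).trans ?_
      rw [← Finset.mul_sum, Finset.sum_add_distrib, ← Finset.mul_sum]
      have h1 := hv T 1 hT0' le_rfl
      have h5 : ∑ n ∈ Finset.range T, 3 * Q.ρ ^ 2 ≤ 3 * Q.ρ ^ 2 * T * lg T ^ 5 := by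
        rw [Finset.sum_const, Finset.card_range, nsmul_eq_mul]
        calc (T:ℝ) * (3 * Q.ρ ^ 2) = 3 * Q.ρ ^ 2 * T * 1 := by ring
          _ ≤ _ := by gcongr
      have h6 : 0 ≤ C * T * lg T ^ 5 := by positivity
      push_cast at h1
      calc _ ≤ w * (2 * (C * T * 1 * lg T ^ 5) + 3 * Q.ρ ^ 2 * T * lg T ^ 5) := by gcongr
        _ ≤ w * (6 * (C * T * lg T ^ 5) + 3 * Q.ρ ^ 2 * T * lg T ^ 5) :=
          mul_le_mul_of_nonneg_left (by linarith) hw.le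
        _ = _ := by ring
  refine key.trans ?_
  calc _ ≤ (6 * C + 3 * Q.ρ ^ 2) * (2 * U) * w * (32 * lg U ^ 5) := by gcongr
    _ = _ := by ring

end QD

end

section

open MeasureTheory Set

theorem lg_two_mul {U x : ℝ} (hU : 1 ≤ U) (hx : 1 ≤ x) (h : x ≤ 2 * U) : lg x ≤ 2 * lg U := by
  refine (lg_mono (by linarith) h).trans ((lg_mul (by norm_num) hU).trans ?_)
  have : lg 2 ≤ 2 := by unfold lg; linarith [Real.log_two_lt_d9]
  exact mul_le_mul_of_nonneg_right this (by linarith [one_le_lg hU])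

namespace QD

variable (Q : QD)

theorem SV_point (u W r : ℝ) (hu : 0 ≤ u) (hW : 0 ≤ W) (hr : 1 ≤ r) (h : u * (r - 1) ≤ W) :
    W * (Q.E (u * r) - Q.E u) ^ 2 ≤ 2 * (∫ w in (0:ℝ)..(2 * W), (Q.E (u + w) - Q.E u) ^ 2) +
      2 * ∫ w in (0:ℝ)..(2 * W), (Q.E (u * r + w) - Q.E (u * r)) ^ 2 := by
  have l1 : LB (fun w => (Q.E (u + w) - Q.E u) ^ 2) :=
    ((Q.E_lb.comp (continuous_const.add continuous_id)).sub (LB.const _)).sq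
  have l2 : LB (fun w => (Q.E (u + w) - Q.E (u * r)) ^ 2) :=
    ((Q.E_lb.comp (continuous_const.add continuous_id)).sub (LB.const _)).sq
  have l3 : LB (fun w => (Q.E w - Q.E (u * r)) ^ 2) := (Q.E_lb.sub (LB.const _)).sq
  have h0 : W * (Q.E (u * r) - Q.E u) ^ 2 =
      ∫ w in W..(2 * W), (Q.E (u * r) - Q.E u) ^ 2 := by
    rw [intervalIntegral.integral_const, smul_eq_mul]; ring
  have h1 : ∫ w in W..(2 * W), (Q.E (u * r) - Q.E u) ^ 2 ≤
      ∫ w in W..(2 * W), (2 * (Q.E (u + w) - Q.E u) ^ 2 + 2 * (Q.E (u + w) - Q.E (u * r)) ^ 2) := by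
    refine int_le (LB.const _) (((LB.const 2).mul l1).add ((LB.const 2).mul l2)) (by linarith)
      fun w _ => ?_
    nlinarith [sq_nonneg (Q.E (u + w) - Q.E u + (Q.E (u + w) - Q.E (u * r)))]
  rw [intervalIntegral.integral_add (((LB.const 2).mul l1).ii _ _) (((LB.const 2).mul l2).ii _ _),
    intervalIntegral.integral_const_mul, intervalIntegral.integral_const_mul] at h1
  have h2 := int_sub l1 (fun _ => sq_nonneg _) hW (by linarith : W ≤ 2 * W) le_rfl
  have h3 : ∫ w in W..(2 * W), (Q.E (u + w) - Q.E (u * r)) ^ 2 ≤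
      ∫ w in (0:ℝ)..(2 * W), (Q.E (u * r + w) - Q.E (u * r)) ^ 2 := by
    rw [intervalIntegral.integral_comp_add_left (fun y => (Q.E y - Q.E (u * r)) ^ 2),
      intervalIntegral.integral_comp_add_left (fun y => (Q.E y - Q.E (u * r)) ^ 2)]
    exact int_sub l3 (fun _ => sq_nonneg _) (by linarith) (by linarith) (by nlinarith)
  linarith

theorem SV : ∃ C : ℝ, 0 ≤ C ∧ ∀ U k : ℝ, 1 ≤ U → 0 < k → k ≤ 1 / 2 →
    ∫ u in (0:ℝ)..U, (Q.E (u * Real.exp k) - Q.E u) ^ 2 ≤ C * U ^ 2 * k * lg U ^ 5 := by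
  obtain ⟨C, hC, cv⟩ := Q.CV
  refine ⟨1040 * C, by positivity, fun U k hU hk hk2 => ?_⟩
  set r := Real.exp k with hr
  set W := 2 * k * U with hW
  have hWpos : 0 < W := by positivity
  have hr1 : 1 ≤ r := Real.one_le_exp hk.le
  have hrk : r - 1 ≤ 2 * k := by
    have := Real.abs_exp_sub_one_le (x := k) (by rw [abs_of_pos hk]; linarith)
    rw [abs_of_pos hk] at this
    exact (le_abs_self _).trans this
  have hr2 : r ≤ 2 := by linarith
  have hL0 := one_le_lg hU
  have lF : LB (fun p : ℝ × ℝ => (Q.E (p.1 + p.2) - Q.E p.1) ^ 2) :=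
    ((Q.E_lb.comp (continuous_fst.add continuous_snd)).sub (Q.E_lb.comp continuous_fst)).sq
  have lG : LB (fun p : ℝ × ℝ => (Q.E (p.1 * r + p.2) - Q.E (p.1 * r)) ^ 2) :=
    ((Q.E_lb.comp ((continuous_fst.mul continuous_const).add continuous_snd)).sub
      (Q.E_lb.comp (continuous_fst.mul continuous_const))).sq
  have lF' : LB (fun p : ℝ × ℝ => (Q.E (p.2 + p.1) - Q.E p.2) ^ 2) :=
    ((Q.E_lb.comp (continuous_snd.add continuous_fst)).sub (Q.E_lb.comp continuous_snd)).sq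
  have lG' : LB (fun p : ℝ × ℝ => (Q.E (p.2 * r + p.1) - Q.E (p.2 * r)) ^ 2) :=
    ((Q.E_lb.comp ((continuous_snd.mul continuous_const).add continuous_fst)).sub
      (Q.E_lb.comp (continuous_snd.mul continuous_const))).sq
  have iF := LB.int (F := fun u w => (Q.E (u + w) - Q.E u) ^ 2) lF 0 (2 * W)
  have iG := LB.int (F := fun u w => (Q.E (u * r + w) - Q.E (u * r)) ^ 2) lG 0 (2 * W)
  have iF' := LB.int (F := fun w u => (Q.E (u + w) - Q.E u) ^ 2) lF' 0 U
  have iG' := LB.int (F := fun w u => (Q.E (u * r + w) - Q.E (u * r)) ^ 2) lG' 0 U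
  have lφ : LB (fun u => (Q.E (u * r) - Q.E u) ^ 2) :=
    ((Q.E_lb.comp (continuous_id.mul continuous_const)).sub Q.E_lb).sq
  have h1 : W * ∫ u in (0:ℝ)..U, (Q.E (u * r) - Q.E u) ^ 2 ≤
      2 * (∫ u in (0:ℝ)..U, ∫ w in (0:ℝ)..(2 * W), (Q.E (u + w) - Q.E u) ^ 2) +
      2 * ∫ u in (0:ℝ)..U, ∫ w in (0:ℝ)..(2 * W), (Q.E (u * r + w) - Q.E (u * r)) ^ 2 := by
    rw [← intervalIntegral.integral_const_mul, ← intervalIntegral.integral_const_mul,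
      ← intervalIntegral.integral_const_mul,
      ← intervalIntegral.integral_add (((LB.const 2).mul iF).ii _ _) (((LB.const 2).mul iG).ii _ _)]
    refine int_le ((LB.const _).mul lφ) (((LB.const 2).mul iF).add ((LB.const 2).mul iG))
      (by linarith) fun u hu => ?_
    refine Q.SV_point u W r hu.1.le hWpos.le hr1 ?_
    have h1 : u * (r - 1) ≤ U * (2 * k) := mul_le_mul hu.2.le hrk (by linarith) (by linarith)
    rw [hW]; linarith
  rw [LB.swap (F := fun u w => (Q.E (u + w) - Q.E u) ^ 2) lF,
    LB.swap (F := fun u w => (Q.E (u * r + w) - Q.E (u * r)) ^ 2) lG] at h1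
  have h2 : ∫ w in (0:ℝ)..(2 * W), ∫ u in (0:ℝ)..U, (Q.E (u + w) - Q.E u) ^ 2 ≤
      C * U * (2 * W) * lg U ^ 5 * (2 * W - 0) := by
    refine int_le_const iF' (by linarith) fun w hw => (cv U w hU hw.1).trans ?_
    have := hw.2.le
    gcongr
  have h3 : ∫ w in (0:ℝ)..(2 * W), ∫ u in (0:ℝ)..U, (Q.E (u * r + w) - Q.E (u * r)) ^ 2 ≤
      C * (2 * U) * (2 * W) * (2 * lg U) ^ 5 * (2 * W - 0) := by
    refine int_le_const iG' (by linarith) fun w hw => ?_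
    rw [intervalIntegral.integral_comp_mul_right (fun u => (Q.E (u + w) - Q.E u) ^ 2) (by linarith)]
    have hUr : 1 ≤ U * r := by nlinarith
    have hUr2 : U * r ≤ 2 * U := by nlinarith
    have h4 := cv (U * r) w hUr hw.1
    have h5 := lg_two_mul hU hUr hUr2
    have h6 := one_le_lg hUr
    rw [zero_mul, smul_eq_mul]
    have h7 : C * (U * r) * w * lg (U * r) ^ 5 ≤ C * (2 * U) * (2 * W) * (2 * lg U) ^ 5 := by
      have := hw.2.le
      have := hw.1
      gcongr
    have h8 : r⁻¹ ≤ 1 := inv_le_one_of_one_le₀ hr1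
    have h9 : 0 ≤ C * (2 * U) * (2 * W) * (2 * lg U) ^ 5 := by positivity
    calc _ ≤ r⁻¹ * (C * (2 * U) * (2 * W) * (2 * lg U) ^ 5) := by gcongr; exact h4.trans h7
      _ ≤ 1 * (C * (2 * U) * (2 * W) * (2 * lg U) ^ 5) := by gcongr
      _ = _ := one_mul _
  have h4 : W * ∫ u in (0:ℝ)..U, (Q.E (u * r) - Q.E u) ^ 2 ≤
      W * (1040 * C * U ^ 2 * k * lg U ^ 5) := by
    refine h1.trans ((add_le_add (mul_le_mul_of_nonneg_left h2 (by norm_num))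
      (mul_le_mul_of_nonneg_left h3 (by norm_num))).trans (le_of_eq ?_))
    rw [hW]; ring
  exact le_of_mul_le_mul_left h4 hWpos

theorem LV : ∃ C : ℝ, 0 ≤ C ∧ ∀ α k : ℝ, 0 ≤ α → 0 < k → k ≤ 1 / 2 →
    ∫ x in α..(α + 2), (Q.E (Real.exp (x + k)) - Q.E (Real.exp x)) ^ 2 ≤
      C * Real.exp α * k * (1 + α) ^ 5 := by
  obtain ⟨C, hC, sv⟩ := Q.SV
  refine ⟨243 * Real.exp 4 * C, by positivity, fun α k hα hk hk2 => ?_⟩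
  have lφ : LB (fun u => (Q.E (u * Real.exp k) - Q.E u) ^ 2) :=
    ((Q.E_lb.comp (continuous_id.mul continuous_const)).sub Q.E_lb).sq
  have l1 : LB (fun x => (Q.E (Real.exp (x + k)) - Q.E (Real.exp x)) ^ 2) :=
    ((Q.E_lb.comp (Real.continuous_exp.comp (continuous_id.add continuous_const))).sub
      (Q.E_lb.comp Real.continuous_exp)).sq
  have hs := intervalIntegral.integral_comp_mul_deriv_of_deriv_nonneg (a := α) (b := α + 2)
    (f := Real.exp) (f' := Real.exp) (g := fun u => (Q.E (u * Real.exp k) - Q.E u) ^ 2)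
    Real.continuous_exp.continuousOn (fun x _ => Real.hasDerivAt_exp x)
    (fun x _ => (Real.exp_pos x).le)
  have h1 : Real.exp α * ∫ x in α..(α + 2), (Q.E (Real.exp (x + k)) - Q.E (Real.exp x)) ^ 2 ≤
      ∫ u in Real.exp α..Real.exp (α + 2), (Q.E (u * Real.exp k) - Q.E u) ^ 2 := by
    rw [← hs, ← intervalIntegral.integral_const_mul]
    refine int_le ((LB.const _).mul l1) ((lφ.comp Real.continuous_exp).mul
      (LB.cont Real.continuous_exp)) (by linarith) fun x hx => ?_
    rw [Real.exp_add, mul_comm]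
    exact mul_le_mul_of_nonneg_left (Real.exp_le_exp.2 hx.1.le) (sq_nonneg _)
  have h2 := int_sub lφ (fun _ => sq_nonneg _) (Real.exp_pos α).le
    (Real.exp_le_exp.2 (by linarith : α ≤ α + 2)) le_rfl
  have h3 := sv (Real.exp (α + 2)) k (Real.one_le_exp (by linarith)) hk hk2
  have h4 : lg (Real.exp (α + 2)) ^ 5 ≤ (3 * (1 + α)) ^ 5 := by
    unfold lg; rw [Real.log_exp]
    exact pow_le_pow_left₀ (by linarith) (by linarith) 5
  have h5 : C * Real.exp (α + 2) ^ 2 * k * lg (Real.exp (α + 2)) ^ 5 ≤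
      Real.exp α * (243 * Real.exp 4 * C * Real.exp α * k * (1 + α) ^ 5) := by
    calc _ ≤ C * Real.exp (α + 2) ^ 2 * k * (3 * (1 + α)) ^ 5 := by gcongr
      _ = _ := by
        have : Real.exp (α + 2) ^ 2 = Real.exp α * Real.exp α * Real.exp 4 := by
          rw [sq, ← Real.exp_add, ← Real.exp_add, ← Real.exp_add]; ring_nf
        rw [this]; ring
  exact le_of_mul_le_mul_left (h1.trans (h2.trans (h3.trans h5))) (Real.exp_pos α)

end QD

end

section

open MeasureTheory Set

namespace QD

variable (Q : QD)

theorem int_E_nat (m : ℕ) : ∫ t in (0:ℝ)..m, Q.E t = ∑ n ∈ Finset.range m, (Q.Dl n - Q.ρ / 2) := by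
  have hs := intervalIntegral.sum_integral_adjacent_intervals (a := fun n : ℕ => (n:ℝ)) (n := m)
      (μ := volume) (f := fun u => Q.E u) fun k _ => Q.E_lb.ii _ _
  rw [Nat.cast_zero] at hs
  rw [← hs]
  refine Finset.sum_congr rfl fun n _ => ?_
  have h1 : ∫ u in (n:ℝ)..((n + 1 : ℕ) : ℝ), Q.E u =
      ∫ u in (n:ℝ)..((n + 1 : ℕ) : ℝ), (Q.Dl n - Q.ρ * (u - n)) := by
    rw [intervalIntegral.integral_of_le (by push_cast; linarith),
      intervalIntegral.integral_of_le (by push_cast; linarith),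
      integral_Ioc_eq_integral_Ioo, integral_Ioc_eq_integral_Ioo]
    refine setIntegral_congr_fun measurableSet_Ioo fun u hu => ?_
    push_cast at hu
    exact Q.E_floor u n hu.1.le hu.2
  rw [h1]
  rw [intervalIntegral.integral_sub intervalIntegrable_const (Continuous.intervalIntegrable (by fun_prop) _ _),
    intervalIntegral.integral_const_mul, intervalIntegral.integral_sub
      (Continuous.intervalIntegrable (by fun_prop) _ _) intervalIntegrable_const]
  simp
  ring

theorem int_E : ∃ C : ℝ, 0 ≤ C ∧ ∀ t : ℝ, 0 ≤ t → |∫ x in (0:ℝ)..t, Q.E x| ≤ C * (t + 1) := by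
  obtain ⟨C, hC, hs⟩ := Q.sum_Dl
  refine ⟨C + 2 * |Q.ρ| + Q.KE, by have := Q.KE_nonneg; positivity, fun t ht => ?_⟩
  set m := ⌊t⌋₊ with hm
  have hmt := Nat.floor_le ht
  have hmt2 := Nat.lt_floor_add_one t
  rw [← intervalIntegral.integral_add_adjacent_intervals (Q.E_lb.ii 0 m) (Q.E_lb.ii _ _), Q.int_E_nat]
  have h1 : |∑ n ∈ Finset.range m, (Q.Dl n - Q.ρ / 2)| ≤ (C + |Q.ρ|) * t := by
    rw [Finset.sum_sub_distrib, Finset.sum_const, Finset.card_range, nsmul_eq_mul]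
    have h3 : Q.Dl 0 = 0 := by simp [Dl, A]
    have h4 : |∑ n ∈ Finset.range m, Q.Dl n| ≤ C * t := by
      rcases Nat.eq_zero_or_pos m with h0 | h0
      · rw [h0]; simp; positivity
      · rw [Finset.range_eq_Ico, Finset.sum_eq_sum_Ico_succ_bot h0, h3, zero_add]
        exact (hs m h0).trans (mul_le_mul_of_nonneg_left (by linarith) hC)
    have h5 : |(m:ℝ) * (Q.ρ / 2)| ≤ |Q.ρ| * t := by
      rw [abs_mul, abs_div, abs_two, abs_of_nonneg (Nat.cast_nonneg m)]
      nlinarith [abs_nonneg Q.ρ]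
    exact (abs_sub _ _).trans (by linarith)
  have h2 : |∫ x in (m:ℝ)..t, Q.E x| ≤ (Q.KE * (t + 1) + |Q.ρ|) * (t - m) := by
    refine abs_int_le Q.E_lb hmt fun x hx => ?_
    have hx0 : 0 ≤ x := le_trans (Nat.cast_nonneg m) hx.1.le
    refine (Q.E_bound' x hx0).trans ?_
    have : Real.sqrt x ≤ t + 1 := by
      rw [Real.sqrt_le_left (by linarith)]; nlinarith [hx.2]
    have := mul_le_mul_of_nonneg_left this Q.KE_nonneg
    linarith
  have h3 : (Q.KE * (t + 1) + |Q.ρ|) * (t - m) ≤ (Q.KE * (t + 1) + |Q.ρ|) * 1 :=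
    mul_le_mul_of_nonneg_left (by linarith) (by have := Q.KE_nonneg; positivity)
  have h4 := abs_nonneg Q.ρ
  refine (abs_add_le _ _).trans ?_
  nlinarith [mul_nonneg h4 ht]

theorem E_rc (x : ℝ) (hx : 0 ≤ x) : ContinuousWithinAt Q.E (Ioi x) x := by
  have h1 := Nat.floor_le hx
  have h2 := Nat.lt_floor_add_one x
  have hc : ContinuousWithinAt (fun y => Q.Dl ⌊x⌋₊ - Q.ρ * (y - (⌊x⌋₊ : ℝ))) (Ioi x) x :=
    Continuous.continuousWithinAt (by fun_prop)
  refine hc.congr_of_eventuallyEq ?_ (Q.E_floor x _ h1 h2)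
  have : ∀ᶠ y in nhdsWithin x (Ioi x), y < (⌊x⌋₊ : ℝ) + 1 :=
    nhdsWithin_le_nhds (Iio_mem_nhds h2)
  filter_upwards [this, self_mem_nhdsWithin] with y hy hy2
  exact Q.E_floor y _ (h1.trans (le_of_lt hy2)) hy

theorem int_E_exp : ∃ C : ℝ, 0 ≤ C ∧ ∀ α β : ℝ, 0 ≤ α → α ≤ β →
    |∫ y in α..β, Real.exp (-y) * Q.E (Real.exp y)| ≤ C * Real.exp (-α) := by
  obtain ⟨C, hC, hI⟩ := Q.int_E
  refine ⟨12 * C, by positivity, fun α β hα hαβ => ?_⟩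
  have lE : LB (fun y => Q.E (Real.exp y)) := Q.E_lb.comp Real.continuous_exp
  have lJ' : LB (fun y => Real.exp y * Q.E (Real.exp y)) := (LB.cont Real.continuous_exp).mul lE
  set J : ℝ → ℝ := fun y => ∫ s in α..y, Real.exp s * Q.E (Real.exp s) with hJ
  have hJb : ∀ y, α ≤ y → |J y| ≤ 4 * C * Real.exp y := by
    intro y hy
    have hs := intervalIntegral.integral_comp_mul_deriv_of_deriv_nonneg (a := α) (b := y)
      (f := Real.exp) (f' := Real.exp) (g := Q.E)
      Real.continuous_exp.continuousOn (fun x _ => Real.hasDerivAt_exp x)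
      (fun x _ => (Real.exp_pos x).le)
    have h1 : J y = ∫ u in Real.exp α..Real.exp y, Q.E u := by
      rw [← hs, hJ]
      refine intervalIntegral.integral_congr fun x _ => ?_
      simp [mul_comm]
    have h2 := intervalIntegral.integral_add_adjacent_intervals (Q.E_lb.ii 0 (Real.exp α))
      (Q.E_lb.ii (Real.exp α) (Real.exp y))
    have h3 := hI _ (Real.exp_pos α).le
    have h4 := hI _ (Real.exp_pos y).le
    have h5 : Real.exp α ≤ Real.exp y := Real.exp_le_exp.2 hy
    have h6 : 1 ≤ Real.exp α := Real.one_le_exp hα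
    have h7 : C * (Real.exp α + 1) ≤ C * (2 * Real.exp y) := mul_le_mul_of_nonneg_left (by linarith) hC
    have h8 : C * (Real.exp y + 1) ≤ C * (2 * Real.exp y) := mul_le_mul_of_nonneg_left (by linarith) hC
    rw [h1]
    rw [abs_le] at *
    constructor <;> linarith
  have hJc : Continuous J := intervalIntegral.continuous_primitive (fun a b => lJ'.ii a b) α
  have hJd : ∀ y, HasDerivWithinAt J (Real.exp y * Q.E (Real.exp y)) (Ioi y) y := by
    intro y
    refine HasDerivWithinAt.mono (t := Ici y) ?_ Ioi_subset_Ici_self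
    refine intervalIntegral.integral_hasDerivWithinAt_right (t := Ioi y) (lJ'.ii α y)
      lJ'.meas.stronglyMeasurable.stronglyMeasurableAtFilter ?_
    refine (Real.continuous_exp.continuousWithinAt).mul ?_
    exact (Q.E_rc (Real.exp y) (Real.exp_pos y).le).comp Real.continuous_exp.continuousWithinAt
      fun z hz => Real.exp_lt_exp.2 hz
  have hv : ∀ y, HasDerivAt (fun y => Real.exp (-2 * y)) (-2 * Real.exp (-2 * y)) y := by
    intro y
    have := ((hasDerivAt_id y).const_mul (-2)).exp
    simpa [mul_comm] using this
  have lv : LB (fun y => -2 * Real.exp (-2 * y)) := LB.cont (by fun_prop)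
  have ibp := intervalIntegral.integral_mul_deriv_eq_deriv_mul_of_hasDeriv_right
    (a := α) (b := β) hJc.continuousOn (Continuous.continuousOn (f := fun y => Real.exp (-2 * y)) (by fun_prop))
    (fun y _ => hJd y) (fun y _ => (hv y).hasDerivWithinAt) (lJ'.ii _ _) (lv.ii _ _)
  have h0 : J α = 0 := by simp [hJ]
  have e1 : ∫ y in α..β, Real.exp y * Q.E (Real.exp y) * Real.exp (-2 * y) =
      ∫ y in α..β, Real.exp (-y) * Q.E (Real.exp y) := by
    refine intervalIntegral.integral_congr fun y _ => ?_
    have : Real.exp (-y) = Real.exp y * Real.exp (-2 * y) := by rw [← Real.exp_add]; ring_nf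
    change _ = Real.exp (-y) * Q.E (Real.exp y)
    rw [this]; ring
  rw [h0, e1] at ibp
  have hb1 : |J β * Real.exp (-2 * β)| ≤ 4 * C * Real.exp (-α) := by
    rw [abs_mul, abs_of_pos (Real.exp_pos _)]
    calc _ ≤ 4 * C * Real.exp β * Real.exp (-2 * β) := by gcongr; exact hJb β hαβ
      _ = 4 * C * Real.exp (-β) := by
        have : Real.exp (-β) = Real.exp β * Real.exp (-2 * β) := by rw [← Real.exp_add]; ring_nf
        rw [this]; ring
      _ ≤ _ := by gcongr
  have hb2 : |∫ y in α..β, J y * (-2 * Real.exp (-2 * y))| ≤ 8 * C * Real.exp (-α) := by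
    have lJv : LB (fun y => J y * (-2 * Real.exp (-2 * y))) := (LB.cont hJc).mul lv
    have hIntv : ∫ y in α..β, 8 * C * Real.exp (-y) = 8 * C * (Real.exp (-α) - Real.exp (-β)) := by
      rw [intervalIntegral.integral_const_mul, intervalIntegral.integral_comp_neg (fun y => Real.exp y),
        integral_exp]
    have hp : ∀ y ∈ Ioo α β, |J y * (-2 * Real.exp (-2 * y))| ≤ 8 * C * Real.exp (-y) := by
      intro y hy
      rw [abs_mul, abs_mul, abs_of_pos (Real.exp_pos _), abs_neg, abs_two]
      have : Real.exp (-y) = Real.exp y * Real.exp (-2 * y) := by rw [← Real.exp_add]; ring_nf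
      rw [this]
      have := hJb y hy.1.le
      calc _ ≤ 4 * C * Real.exp y * (2 * Real.exp (-2 * y)) := by gcongr
        _ = _ := by ring
    have le : LB (fun y => 8 * C * Real.exp (-y)) := LB.cont (by fun_prop)
    have hE := Real.exp_pos (-β)
    have hC8 : 0 ≤ 8 * C * Real.exp (-β) := by positivity
    rw [abs_le]
    constructor
    · have := int_le ((LB.const (-1)).mul le) lJv hαβ fun y hy => by
        linarith [(abs_le.1 (hp y hy)).1]
      rw [intervalIntegral.integral_const_mul, hIntv] at this
      linarith
    · have := int_le lJv le hαβ fun y hy => (abs_le.1 (hp y hy)).2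
      rw [hIntv] at this
      linarith
  rw [abs_le] at *
  constructor <;> linarith

end QD

end

section

open MeasureTheory Set

/-- The exponential clamped to `[D, Z]`. -/
noncomputable def kap (D Z x : ℝ) : ℝ := max D (min Z (Real.exp x))

theorem kap_cont (D Z : ℝ) : Continuous (kap D Z) := by
  unfold kap; fun_prop

theorem kap_lo {D Z x : ℝ} (hD : 0 < D) (hx : x ≤ Real.log D) : kap D Z x = D := by
  have : Real.exp x ≤ D := by rw [← Real.exp_log hD]; exact Real.exp_le_exp.2 hx
  exact max_eq_left ((min_le_right _ _).trans this)

theorem kap_hi {D Z x : ℝ} (hD : 0 < D) (hDZ : D ≤ Z) (hx : Real.log Z ≤ x) : kap D Z x = Z := by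
  have : Z ≤ Real.exp x := by
    rw [← Real.exp_log (hD.trans_le hDZ)]; exact Real.exp_le_exp.2 hx
  unfold kap
  rw [min_eq_left this, max_eq_right hDZ]

theorem kap_mid {D Z x : ℝ} (hD : 0 < D) (hDZ : D ≤ Z) (h1 : Real.log D ≤ x)
    (h2 : x ≤ Real.log Z) : kap D Z x = Real.exp x := by
  have h3 : D ≤ Real.exp x := by rw [← Real.exp_log hD]; exact Real.exp_le_exp.2 h1
  have h4 : Real.exp x ≤ Z := by
    rw [← Real.exp_log (hD.trans_le hDZ)]; exact Real.exp_le_exp.2 h2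
  unfold kap
  rw [min_eq_right h4, max_eq_right h3]

theorem kap_ge (D Z x : ℝ) : D ≤ kap D Z x := le_max_left _ _

theorem kap_le {D Z : ℝ} (hDZ : D ≤ Z) (x : ℝ) : kap D Z x ≤ Z := max_le hDZ (min_le_left _ _)

theorem LB.integrable {f : ℝ → ℝ} (hf : LB f) {a b : ℝ} (h : Function.support f ⊆ Ioc a b) :
    Integrable f := (integrableOn_iff_integrable_of_support_subset h).1 (hf.ii a b).1

namespace QD

variable (Q : QD)

/-- First factor. -/
noncomputable def Mf (D Z h x : ℝ) : ℝ := Q.E (kap D Z (x + h)) - Q.E (kap D Z x)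

/-- Second factor. -/
noncomputable def Gf (N x : ℝ) : ℝ := Q.E (N * Real.exp (-x))

/-- The pairing. -/
noncomputable def P (N D Z h : ℝ) : ℝ := ∫ x, Q.Mf D Z h x * Q.Gf N x

theorem Mf_lb (D Z h : ℝ) : LB (Q.Mf D Z h) :=
  (Q.E_lb.comp ((kap_cont D Z).comp (continuous_id.add continuous_const))).sub
    (Q.E_lb.comp (kap_cont D Z))

theorem Gf_lb (N : ℝ) : LB (Q.Gf N) := Q.E_lb.comp (by fun_prop)

theorem Mf_supp {D Z h : ℝ} (hD : 0 < D) (hDZ : D ≤ Z) (hh : 0 ≤ h) {f : ℝ → ℝ} :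
    Function.support (fun x => Q.Mf D Z h x * f x) ⊆ Ioc (Real.log D - h) (Real.log Z) := by
  intro x hx
  rw [Function.mem_support] at hx
  have h0 : Q.Mf D Z h x ≠ 0 := left_ne_zero_of_mul hx
  by_contra hc
  apply h0
  rw [mem_Ioc, not_and_or, not_lt, not_le] at hc
  unfold Mf
  rcases hc with hc | hc
  · rw [kap_lo hD (by linarith), kap_lo hD (by linarith), sub_self]
  · rw [kap_hi hD hDZ (by linarith), kap_hi hD hDZ hc.le, sub_self]

theorem P_eq {N D Z h : ℝ} (hD : 0 < D) (hDZ : D ≤ Z) (hh : 0 ≤ h) :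
    Q.P N D Z h = ∫ x in (Real.log D - h)..(Real.log Z), Q.Mf D Z h x * Q.Gf N x :=
  (intervalIntegral.integral_eq_integral_of_support_subset (Q.Mf_supp hD hDZ hh)).symm

theorem P_rec {N D Z k : ℝ} (hD : 0 < D) (hDZ : D ≤ Z) (hk : 0 ≤ k) :
    Q.P N D Z (2 * k) - 2 * Q.P N D Z k =
      ∫ x in (Real.log D - k)..(Real.log Z), Q.Mf D Z k x * (Q.Gf N (x - k) - Q.Gf N x) := by
  have lG := Q.Gf_lb N
  have lG' : LB (fun x => Q.Gf N (x - k)) := lG.comp (continuous_id.sub continuous_const)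
  have lM := Q.Mf_lb D Z k
  have i1 := (lM.mul lG).integrable (Q.Mf_supp hD hDZ hk)
  have i2 := (lM.mul lG').integrable (Q.Mf_supp hD hDZ hk)
  have e2 : ∫ x, Q.Mf D Z k (x + k) * Q.Gf N x = ∫ x, Q.Mf D Z k x * Q.Gf N (x - k) := by
    have := integral_add_right_eq_self (μ := volume) (fun x => Q.Mf D Z k x * Q.Gf N (x - k)) k
    rw [← this]
    refine integral_congr_ae (Filter.Eventually.of_forall fun x => ?_)
    simp
  have i3 : Integrable (fun x => Q.Mf D Z k (x + k) * Q.Gf N x) := by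
    have := i2.comp_add_right k
    simpa using this
  have e1 : Q.P N D Z (2 * k) = (∫ x, Q.Mf D Z k (x + k) * Q.Gf N x) + Q.P N D Z k := by
    unfold P
    rw [← integral_add i3 i1]
    refine integral_congr_ae (Filter.Eventually.of_forall fun x => ?_)
    simp only [Mf]
    rw [show x + k + k = x + 2 * k by ring]
    ring
  rw [e1, e2, intervalIntegral.integral_eq_integral_of_support_subset (Q.Mf_supp hD hDZ hk)]
  have : ∫ x, Q.Mf D Z k x * (Q.Gf N (x - k) - Q.Gf N x) =
      (∫ x, Q.Mf D Z k x * Q.Gf N (x - k)) - ∫ x, Q.Mf D Z k x * Q.Gf N x := by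
    rw [← integral_sub i2 i1]
    refine integral_congr_ae (Filter.Eventually.of_forall fun x => ?_)
    simp only; ring
  rw [this]
  unfold P
  ring

theorem E_kap_bound {D Z : ℝ} (hD : 1 ≤ D) (hDZ : D ≤ Z) (x : ℝ) :
    |Q.E (kap D Z x)| ≤ 2 * Q.KE * Real.sqrt Z := by
  refine (Q.E_bound _ (hD.trans (kap_ge D Z x))).trans ?_
  exact mul_le_mul_of_nonneg_left (Real.sqrt_le_sqrt (kap_le hDZ x))
    (by linarith [Q.KE_nonneg])

theorem Mf_bound {D Z : ℝ} (hD : 1 ≤ D) (hDZ : D ≤ Z) (k x : ℝ) :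
    |Q.Mf D Z k x| ≤ 4 * Q.KE * Real.sqrt Z := by
  unfold Mf
  refine (abs_sub _ _).trans ?_
  linarith [Q.E_kap_bound hD hDZ x, Q.E_kap_bound hD hDZ (x + k)]

theorem Mf_sq_bound {D Z : ℝ} (hD : 1 ≤ D) (hDZ : D ≤ Z) (k x : ℝ) :
    Q.Mf D Z k x ^ 2 ≤ 16 * Q.KE ^ 2 * Z := by
  have h := Q.Mf_bound hD hDZ k x
  have h2 := sq_le_sq' (abs_le.1 h).1 (abs_le.1 h).2
  rw [mul_pow, Real.sq_sqrt (by linarith)] at h2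
  linarith

theorem M2 : ∃ C : ℝ, 0 ≤ C ∧ ∀ D Z k : ℝ, 1 ≤ D → D ≤ Z → Z ≤ 2 * D → 0 < k → k ≤ 1 / 2 →
    ∫ x in (Real.log D - k)..(Real.log Z), Q.Mf D Z k x ^ 2 ≤ C * D * k * lg D ^ 5 := by
  obtain ⟨C, hC, lv⟩ := Q.LV
  refine ⟨C + 64 * Q.KE ^ 2, by positivity, fun D Z k hD hDZ hZ hk hk2 => ?_⟩
  have lM := (Q.Mf_lb D Z k).sq
  have hD0 : 0 < D := by linarith
  have hlog : Real.log D ≤ Real.log Z := Real.log_le_log hD0 hDZ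
  have hlog2 : Real.log Z ≤ Real.log D + 1 := by
    have := Real.log_le_log (by linarith) hZ
    rw [Real.log_mul (by norm_num) hD0.ne'] at this
    linarith [Real.log_two_lt_d9]
  have hlogD := Real.log_nonneg hD
  set m := max (Real.log D) (Real.log Z - k) with hm
  have hm1 : Real.log D ≤ m := le_max_left _ _
  have hm2 : m ≤ Real.log Z := max_le hlog (by linarith)
  have hm3 : Real.log Z - k ≤ m := le_max_right _ _
  rw [← intervalIntegral.integral_add_adjacent_intervals (lM.ii _ (Real.log D)) (lM.ii _ _),
    ← intervalIntegral.integral_add_adjacent_intervals (lM.ii (Real.log D) m) (lM.ii m _)]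
  have h1 : ∫ x in (Real.log D - k)..(Real.log D), Q.Mf D Z k x ^ 2 ≤ 16 * Q.KE ^ 2 * Z * k := by
    refine (int_le_const lM (by linarith) fun x _ => Q.Mf_sq_bound hD hDZ k x).trans (le_of_eq ?_)
    ring
  have h3 : ∫ x in m..(Real.log Z), Q.Mf D Z k x ^ 2 ≤ 16 * Q.KE ^ 2 * Z * k := by
    refine (int_le_const lM hm2 fun x _ => Q.Mf_sq_bound hD hDZ k x).trans ?_
    exact mul_le_mul_of_nonneg_left (by linarith) (mul_nonneg (by positivity) (by linarith))
  have l1 : LB (fun x => (Q.E (Real.exp (x + k)) - Q.E (Real.exp x)) ^ 2) :=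
    ((Q.E_lb.comp (Real.continuous_exp.comp (continuous_id.add continuous_const))).sub
      (Q.E_lb.comp Real.continuous_exp)).sq
  have h2 : ∫ x in (Real.log D)..m, Q.Mf D Z k x ^ 2 ≤ C * D * k * lg D ^ 5 := by
    have := lv (Real.log D) k hlogD hk hk2
    rw [Real.exp_log hD0] at this
    refine le_trans ?_ this
    refine le_trans (int_le lM l1 hm1 fun x hx => ?_)
      (int_sub l1 (fun _ => sq_nonneg _) le_rfl hm1 (by linarith))
    have hx2 : x < Real.log Z - k := by
      rcases lt_max_iff.1 hx.2 with h | h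
      · linarith [hx.1]
      · exact h
    unfold Mf
    rw [kap_mid hD0 hDZ (by linarith [hx.1]) (by linarith),
      kap_mid hD0 hDZ (by linarith [hx.1]) (by linarith)]
  have h5 : (1:ℝ) ≤ lg D ^ 5 := one_le_pow₀ (one_le_lg hD)
  have h6 : 16 * Q.KE ^ 2 * Z * k ≤ 32 * Q.KE ^ 2 * D * k * lg D ^ 5 := by
    calc _ ≤ 16 * Q.KE ^ 2 * (2 * D) * k * 1 := by rw [mul_one]; gcongr
      _ ≤ 16 * Q.KE ^ 2 * (2 * D) * k * lg D ^ 5 := by gcongr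
      _ = _ := by ring
  linarith

theorem G2 : ∃ C : ℝ, 0 ≤ C ∧ ∀ N D Z k : ℝ, 1 ≤ D → D ≤ Z → Z ≤ 2 * D → Z ≤ N → 0 < k → k ≤ 1 / 2 →
    ∫ x in (Real.log D - k)..(Real.log Z), (Q.Gf N (x - k) - Q.Gf N x) ^ 2 ≤
      C * (N / D) * k * lg N ^ 5 := by
  obtain ⟨C, hC, lv⟩ := Q.LV
  refine ⟨C, hC, fun N D Z k hD hDZ hZ hN hk hk2 => ?_⟩
  have hD0 : 0 < D := by linarith
  have hZ0 : 0 < Z := by linarith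
  have hN0 : 0 < N := by linarith
  have hlog2 : Real.log Z ≤ Real.log D + 1 := by
    have := Real.log_le_log (by linarith) hZ
    rw [Real.log_mul (by norm_num) hD0.ne'] at this
    linarith [Real.log_two_lt_d9]
  have hlog : Real.log D ≤ Real.log Z := Real.log_le_log hD0 hDZ
  have hlogN : Real.log Z ≤ Real.log N := Real.log_le_log hZ0 hN
  have l1 : LB (fun x => (Q.E (Real.exp (x + k)) - Q.E (Real.exp x)) ^ 2) :=
    ((Q.E_lb.comp (Real.continuous_exp.comp (continuous_id.add continuous_const))).sub
      (Q.E_lb.comp Real.continuous_exp)).sq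
  have e : ∫ x in (Real.log D - k)..(Real.log Z), (Q.Gf N (x - k) - Q.Gf N x) ^ 2 =
      ∫ x in (Real.log D - k)..(Real.log Z), (fun y => (Q.E (Real.exp (y + k)) -
        Q.E (Real.exp y)) ^ 2) (Real.log N - x) := by
    refine intervalIntegral.integral_congr fun x _ => ?_
    simp only [Gf]
    have h : ∀ z : ℝ, N * Real.exp (-z) = Real.exp (Real.log N - z) := fun z => by
      rw [sub_eq_add_neg, Real.exp_add, Real.exp_log hN0]
    rw [h, h]
    congr 5; ring
  rw [e, intervalIntegral.integral_comp_sub_left (fun y => (Q.E (Real.exp (y + k)) -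
        Q.E (Real.exp y)) ^ 2)]
  have h1 := lv (Real.log N - Real.log Z) k (by linarith) hk hk2
  refine (int_sub l1 (fun _ => sq_nonneg _) le_rfl (by linarith)
    (by linarith : Real.log N - (Real.log D - k) ≤ Real.log N - Real.log Z + 2)).trans (h1.trans ?_)
  rw [Real.exp_sub, Real.exp_log hN0, Real.exp_log hZ0]
  have h2 : N / Z ≤ N / D := div_le_div_of_nonneg_left hN0.le hD0 hDZ
  have h3 : 1 + (Real.log N - Real.log Z) ≤ lg N := by
    unfold lg; linarith [Real.log_nonneg (by linarith : 1 ≤ Z)]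
  have h4 : 0 ≤ 1 + (Real.log N - Real.log Z) := by linarith
  gcongr

/-- Normalised pairing. -/
noncomputable def Tn (N D Z h : ℝ) : ℝ := Q.P N D Z h / h

theorem T_step : ∃ C : ℝ, 0 ≤ C ∧ ∀ N D Z k : ℝ, 1 ≤ D → D ≤ Z → Z ≤ 2 * D → Z ≤ N → 0 < k →
    k ≤ 1 / 2 → |Q.Tn N D Z (2 * k) - Q.Tn N D Z k| ≤ C * Real.sqrt N * lg N ^ 5 := by
  obtain ⟨C1, hC1, m2⟩ := Q.M2
  obtain ⟨C2, hC2, g2⟩ := Q.G2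
  refine ⟨C1 + C2, by positivity, fun N D Z k hD hDZ hZ hN hk hk2 => ?_⟩
  have hD0 : 0 < D := by linarith
  have hN0 : 0 < N := by linarith
  have hsN : 0 < Real.sqrt N := Real.sqrt_pos.2 hN0
  have hlog : Real.log D ≤ Real.log Z := Real.log_le_log hD0 hDZ
  have e : Q.Tn N D Z (2 * k) - Q.Tn N D Z k =
      (Q.P N D Z (2 * k) - 2 * Q.P N D Z k) / (2 * k) := by
    unfold Tn; field_simp
  rw [e, Q.P_rec hD0 hDZ hk.le, abs_div, abs_of_pos (by positivity : 0 < 2 * k),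
    div_le_iff₀ (by positivity)]
  set lam := Real.sqrt N / D with hlam
  have hlam0 : 0 < lam := by positivity
  have lM := Q.Mf_lb D Z k
  have lG : LB (fun x => Q.Gf N (x - k) - Q.Gf N x) :=
    ((Q.Gf_lb N).comp (continuous_id.sub continuous_const)).sub (Q.Gf_lb N)
  have lR : LB (fun x => lam / 2 * Q.Mf D Z k x ^ 2 + 1 / (2 * lam) *
      (Q.Gf N (x - k) - Q.Gf N x) ^ 2) :=
    ((LB.const _).mul lM.sq).add ((LB.const _).mul lG.sq)
  have hp : ∀ x, |Q.Mf D Z k x * (Q.Gf N (x - k) - Q.Gf N x)| ≤ lam / 2 * Q.Mf D Z k x ^ 2 +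
      1 / (2 * lam) * (Q.Gf N (x - k) - Q.Gf N x) ^ 2 := by
    intro x
    set a := Q.Mf D Z k x
    set b := Q.Gf N (x - k) - Q.Gf N x
    have h1 : lam / 2 * a ^ 2 + 1 / (2 * lam) * b ^ 2 - a * b = (lam * a - b) ^ 2 / (2 * lam) := by
      field_simp; ring
    have h2 : lam / 2 * a ^ 2 + 1 / (2 * lam) * b ^ 2 + a * b = (lam * a + b) ^ 2 / (2 * lam) := by
      field_simp; ring
    have h3 : 0 ≤ (lam * a - b) ^ 2 / (2 * lam) := by positivity
    have h4 : 0 ≤ (lam * a + b) ^ 2 / (2 * lam) := by positivity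
    rw [abs_le]; constructor <;> linarith
  have hIntv : ∫ x in (Real.log D - k)..(Real.log Z), (lam / 2 * Q.Mf D Z k x ^ 2 + 1 / (2 * lam) *
      (Q.Gf N (x - k) - Q.Gf N x) ^ 2) ≤ (C1 + C2) * Real.sqrt N * lg N ^ 5 * (2 * k) := by
    rw [intervalIntegral.integral_add (((LB.const _).mul lM.sq).ii _ _)
      (((LB.const _).mul lG.sq).ii _ _), intervalIntegral.integral_const_mul,
      intervalIntegral.integral_const_mul]
    have h1 := m2 D Z k hD hDZ hZ hk hk2
    have h2 := g2 N D Z k hD hDZ hZ hN hk hk2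
    have hl1 := one_le_lg hD
    have hl2 : lg D ≤ lg N := lg_mono hD0 (by linarith)
    have h3 : lam / 2 * ∫ x in (Real.log D - k)..(Real.log Z), Q.Mf D Z k x ^ 2 ≤
        C1 * Real.sqrt N * lg N ^ 5 * k := by
      calc _ ≤ lam / 2 * (C1 * D * k * lg N ^ 5) := by
            refine mul_le_mul_of_nonneg_left (h1.trans ?_) (by positivity)
            gcongr
        _ = (C1 * Real.sqrt N * lg N ^ 5 * k) / 2 := by rw [hlam]; field_simp
        _ ≤ _ := half_le_self (by have := hl1.trans hl2; positivity)
    have h4 : 1 / (2 * lam) * ∫ x in (Real.log D - k)..(Real.log Z),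
        (Q.Gf N (x - k) - Q.Gf N x) ^ 2 ≤ C2 * Real.sqrt N * lg N ^ 5 * k := by
      calc _ ≤ 1 / (2 * lam) * (C2 * (N / D) * k * lg N ^ 5) := by gcongr
        _ = (C2 * Real.sqrt N * lg N ^ 5 * k) / 2 := by
            rw [hlam]
            nth_rw 2 [← Real.mul_self_sqrt hN0.le]
            field_simp
        _ ≤ _ := half_le_self (by have := hl1.trans hl2; positivity)
    have : 0 ≤ (C1 + C2) * Real.sqrt N * lg N ^ 5 * k := by have := hl1.trans hl2; positivity
    linarith
  refine le_trans ?_ hIntv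
  have lMG := lM.mul lG
  have hab : Real.log D - k ≤ Real.log Z := by linarith
  rw [abs_le]
  constructor
  · have := int_le ((LB.const (-1)).mul lR) lMG hab fun x _ => by
      linarith [(abs_le.1 (hp x)).1]
    rw [intervalIntegral.integral_const_mul] at this
    linarith
  · exact int_le lMG lR hab fun x _ => (abs_le.1 (hp x)).2

theorem Gf_bound {N D Z h x : ℝ} (hD : 1 ≤ D) (hDZ : D ≤ Z) (hN : Z ≤ N) (hh : h ≤ 1)
    (h1 : Real.log D - h ≤ x) (h2 : x ≤ Real.log Z) : |Q.Gf N x| ≤ 4 * Q.KE * Real.sqrt (N / D) := by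
  have hD0 : 0 < D := by linarith
  have hZ0 : 0 < Z := by linarith
  have hN0 : 0 < N := by linarith
  have hx1 : 1 ≤ N * Real.exp (-x) := by
    have : Real.exp x ≤ N := by
      refine le_trans ?_ hN
      rw [← Real.exp_log hZ0]; exact Real.exp_le_exp.2 h2
    rw [Real.exp_neg, ← div_eq_mul_inv, le_div_iff₀ (Real.exp_pos _)]
    linarith
  have hx2 : N * Real.exp (-x) ≤ 4 * (N / D) := by
    have h3 : Real.exp (-x) ≤ 4 / D := by
      calc Real.exp (-x) ≤ Real.exp (1 + -Real.log D) := Real.exp_le_exp.2 (by linarith)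
        _ = Real.exp 1 * D⁻¹ := by rw [Real.exp_add, Real.exp_neg, Real.exp_log hD0]
        _ ≤ 4 * D⁻¹ := by
          have := Real.exp_one_lt_d9
          gcongr; linarith
        _ = _ := by rw [div_eq_mul_inv]
    calc _ ≤ N * (4 / D) := by gcongr
      _ = _ := by ring
  refine (Q.E_bound _ hx1).trans ?_
  have : Real.sqrt (N * Real.exp (-x)) ≤ 2 * Real.sqrt (N / D) := by
    refine (Real.sqrt_le_sqrt hx2).trans (le_of_eq ?_)
    rw [Real.sqrt_mul (by norm_num), show (4:ℝ) = 2 ^ 2 by norm_num, Real.sqrt_sq (by norm_num)]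
  have h5 := mul_le_mul_of_nonneg_left this Q.KE_nonneg
  linarith

theorem T_base : ∃ C : ℝ, 0 ≤ C ∧ ∀ N D Z : ℝ, 1 ≤ D → D ≤ Z → Z ≤ 2 * D → Z ≤ N →
    |Q.Tn N D Z 1| ≤ C * Real.sqrt N := by
  refine ⟨64 * Q.KE ^ 2, by positivity, fun N D Z hD hDZ hZ hN => ?_⟩
  have hD0 : 0 < D := by linarith
  have hN0 : 0 < N := by linarith
  have hlog2 : Real.log Z ≤ Real.log D + 1 := by
    have := Real.log_le_log (by linarith) hZ
    rw [Real.log_mul (by norm_num) hD0.ne'] at this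
    linarith [Real.log_two_lt_d9]
  have hlog : Real.log D ≤ Real.log Z := Real.log_le_log hD0 hDZ
  unfold Tn
  rw [div_one, Q.P_eq hD0 hDZ zero_le_one]
  refine (abs_int_le ((Q.Mf_lb D Z 1).mul (Q.Gf_lb N)) (by linarith)
    (K := 32 * Q.KE ^ 2 * Real.sqrt N) fun x hx => ?_).trans ?_
  · rw [abs_mul]
    have h1 := Q.Mf_bound hD hDZ 1 x
    have h2 := Q.Gf_bound hD hDZ hN le_rfl hx.1.le hx.2.le
    have h3 : Real.sqrt Z * Real.sqrt (N / D) ≤ 2 * Real.sqrt N := by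
      rw [← Real.sqrt_mul (by linarith)]
      calc Real.sqrt (Z * (N / D)) ≤ Real.sqrt (2 ^ 2 * N) := by
            apply Real.sqrt_le_sqrt
            rw [mul_div_assoc', div_le_iff₀ hD0]
            nlinarith
        _ = 2 * Real.sqrt N := by rw [Real.sqrt_mul (by norm_num), Real.sqrt_sq (by norm_num)]
    calc _ ≤ (4 * Q.KE * Real.sqrt Z) * (4 * Q.KE * Real.sqrt (N / D)) :=
          mul_le_mul h1 h2 (abs_nonneg _) (by have := Q.KE_nonneg; positivity)
      _ = 16 * Q.KE ^ 2 * (Real.sqrt Z * Real.sqrt (N / D)) := by ring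
      _ ≤ 16 * Q.KE ^ 2 * (2 * Real.sqrt N) := by gcongr
      _ = _ := by ring
  · have : 0 ≤ 32 * Q.KE ^ 2 * Real.sqrt N := by positivity
    nlinarith

theorem T_fine : ∃ C : ℝ, 0 ≤ C ∧ ∀ N D Z : ℝ, ∀ J : ℕ, 1 ≤ D → D ≤ Z → Z ≤ 2 * D → Z ≤ N →
    |Q.Tn N D Z ((1 / 2) ^ J)| ≤ C * Real.sqrt N * lg N ^ 5 * (J + 1) := by
  obtain ⟨C1, hC1, st⟩ := Q.T_step
  obtain ⟨C2, hC2, ba⟩ := Q.T_base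
  refine ⟨C1 + C2, by positivity, fun N D Z J hD hDZ hZ hN => ?_⟩
  have hl := one_le_lg (by linarith : 1 ≤ N)
  have hl5 : 1 ≤ lg N ^ 5 := one_le_pow₀ hl
  induction J with
  | zero =>
    have := ba N D Z hD hDZ hZ hN
    rw [pow_zero]
    refine this.trans ?_
    calc C2 * Real.sqrt N = (0 + C2) * Real.sqrt N * 1 * (0 + 1) := by ring
      _ ≤ _ := by push_cast; gcongr
  | succ J ih =>
    have h1 := st N D Z ((1 / 2) ^ (J + 1)) hD hDZ hZ hN (by positivity) (by
      rw [pow_succ]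
      have : ((1:ℝ) / 2) ^ J ≤ 1 := pow_le_one₀ (by norm_num) (by norm_num)
      linarith)
    rw [show (2:ℝ) * (1 / 2) ^ (J + 1) = (1 / 2) ^ J by rw [pow_succ]; ring] at h1
    have h2 : C1 * Real.sqrt N * lg N ^ 5 ≤ (C1 + C2) * Real.sqrt N * lg N ^ 5 := by
      gcongr; linarith
    push_cast
    rw [abs_le] at *
    constructor <;> linarith

end QD

end

section

open MeasureTheory Set

theorem kap_lip (D Z x y : ℝ) : |kap D Z x - kap D Z y| ≤ |Real.exp x - Real.exp y| := by
  unfold kap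
  rw [max_comm D, max_comm D, min_comm Z, min_comm Z]
  exact (abs_max_sub_max_le_abs _ _ _).trans (abs_inf_sub_inf_le_abs _ _ _)

theorem exp_diff {h : ℝ} (h0 : 0 ≤ h) (h1 : h ≤ 1) (x : ℝ) :
    |Real.exp (x + h) - Real.exp x| ≤ 2 * h * Real.exp x := by
  have := Real.abs_exp_sub_one_le (x := h) (by rw [abs_of_nonneg h0]; linarith)
  rw [abs_of_nonneg h0] at this
  rw [Real.exp_add, show Real.exp x * Real.exp h - Real.exp x = (Real.exp h - 1) * Real.exp x by ring,
    abs_mul, abs_of_pos (Real.exp_pos x)]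
  exact mul_le_mul_of_nonneg_right this (Real.exp_pos x).le

namespace QD

variable (Q : QD)

theorem A_kap (D Z : ℕ) (hD : 1 ≤ D) (hDZ : D ≤ Z) (y : ℝ) :
    Q.A ⌊kap D Z y⌋₊ = Q.A D + ∑ n ∈ Finset.Ioc D Z, if Real.log n ≤ y then Q.a n else 0 := by
  have hDZ' : (D:ℝ) ≤ Z := by exact_mod_cast hDZ
  have h1 : D ≤ ⌊kap D Z y⌋₊ := Nat.le_floor (kap_ge _ _ _)
  have h0 : 0 ≤ kap D Z y := (Nat.cast_nonneg D).trans (kap_ge _ _ _)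
  unfold A
  rw [← Finset.sum_Ioc_consecutive _ (Nat.zero_le D) h1, ← Finset.sum_filter]
  congr 1
  refine Finset.sum_congr ?_ fun _ _ => rfl
  ext n
  rw [Finset.mem_filter, Finset.mem_Ioc, Finset.mem_Ioc, Nat.le_floor_iff h0]
  constructor
  · rintro ⟨h2, h3⟩
    have hn0 : (0:ℝ) < n := by exact_mod_cast (by omega : 0 < n)
    have h4 : n ≤ Z := by exact_mod_cast h3.trans (kap_le hDZ' y)
    refine ⟨⟨h2, h4⟩, ?_⟩
    rw [Real.log_le_iff_le_exp hn0]
    unfold kap at h3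
    rcases le_max_iff.1 h3 with h | h
    · have : n ≤ D := by exact_mod_cast h
      omega
    · exact h.trans (min_le_right _ _)
  · rintro ⟨⟨h2, h4⟩, h5⟩
    have hn0 : (0:ℝ) < n := by exact_mod_cast (by omega : 0 < n)
    rw [Real.log_le_iff_le_exp hn0] at h5
    refine ⟨h2, le_max_of_le_right (le_min (by exact_mod_cast h4) h5)⟩

theorem Mf_decomp (N : ℝ) (D Z : ℕ) (hD : 1 ≤ D) (hDZ : D ≤ Z) (h x : ℝ) (hh : 0 ≤ h) :
    Q.Mf D Z h x * Q.Gf N x =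
      (∑ n ∈ Finset.Ioc D Z, Q.a n * (Ico (Real.log n - h) (Real.log n)).indicator (Q.Gf N) x) -
        Q.ρ * ((kap D Z (x + h) - kap D Z x) * Q.Gf N x) := by
  have e : ∑ n ∈ Finset.Ioc D Z, Q.a n * (Ico (Real.log n - h) (Real.log n)).indicator (Q.Gf N) x =
      ((∑ n ∈ Finset.Ioc D Z, if Real.log n ≤ x + h then Q.a n else 0) -
        ∑ n ∈ Finset.Ioc D Z, if Real.log n ≤ x then Q.a n else 0) * Q.Gf N x := by
    rw [← Finset.sum_sub_distrib, Finset.sum_mul]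
    refine Finset.sum_congr rfl fun n _ => ?_
    by_cases h1 : Real.log n ≤ x
    · have h2 : Real.log n ≤ x + h := by linarith
      have h3 : x ∉ Ico (Real.log n - h) (Real.log n) := fun h => by linarith [h.2]
      rw [indicator_of_notMem h3]; simp [h1, h2]
    · by_cases h2 : Real.log n ≤ x + h
      · have h3 : x ∈ Ico (Real.log n - h) (Real.log n) := ⟨by linarith, lt_of_not_ge h1⟩
        rw [indicator_of_mem h3]; simp [h1, h2]
      · have h3 : x ∉ Ico (Real.log n - h) (Real.log n) := fun h => h2 (by linarith [h.1])
        rw [indicator_of_notMem h3]; simp [h1, h2]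
  rw [e]
  unfold Mf E
  rw [Q.A_kap D Z hD hDZ, Q.A_kap D Z hD hDZ]
  ring

theorem P_decomp (N : ℝ) (D Z : ℕ) (hD : 1 ≤ D) (hDZ : D ≤ Z) (h : ℝ) (hh : 0 ≤ h) :
    Q.P N D Z h = (∑ n ∈ Finset.Ioc D Z, Q.a n * ∫ x in (Real.log n - h)..(Real.log n), Q.Gf N x) -
      Q.ρ * ∫ x in (Real.log D - h)..(Real.log Z), (kap D Z (x + h) - kap D Z x) * Q.Gf N x := by
  have hD0 : (0:ℝ) < D := by exact_mod_cast hD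
  have hDZ' : (D:ℝ) ≤ Z := by exact_mod_cast hDZ
  have lG := Q.Gf_lb N
  have lk : LB (fun x => (kap D Z (x + h) - kap D Z x) * Q.Gf N x) :=
    (LB.cont (((kap_cont D Z).comp (continuous_id.add continuous_const)).sub (kap_cont D Z))).mul lG
  have sk : Function.support (fun x => (kap D Z (x + h) - kap D Z x) * Q.Gf N x) ⊆
      Ioc (Real.log D - h) (Real.log Z) := by
    intro x hx
    rw [Function.mem_support] at hx
    have h0 := left_ne_zero_of_mul hx
    by_contra hc
    apply h0
    rw [mem_Ioc, not_and_or, not_lt, not_le] at hc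
    rcases hc with hc | hc
    · rw [kap_lo hD0 (by linarith), kap_lo hD0 (by linarith), sub_self]
    · rw [kap_hi hD0 hDZ' (by linarith), kap_hi hD0 hDZ' hc.le, sub_self]
  have hi : ∀ n : ℕ, Integrable ((Ico (Real.log n - h) (Real.log n)).indicator (Q.Gf N)) := by
    intro n
    rw [integrable_indicator_iff measurableSet_Ico, integrableOn_Ico_iff_integrableOn_Ioo,
      ← integrableOn_Ioc_iff_integrableOn_Ioo]
    exact (lG.ii _ _).1
  have hIntv : ∀ n : ℕ, ∫ x, (Ico (Real.log n - h) (Real.log n)).indicator (Q.Gf N) x =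
      ∫ x in (Real.log n - h)..(Real.log n), Q.Gf N x := by
    intro n
    rw [integral_indicator measurableSet_Ico, intervalIntegral.integral_of_le (by linarith),
      integral_Ioc_eq_integral_Ioo, integral_Ico_eq_integral_Ioo]
  rw [intervalIntegral.integral_eq_integral_of_support_subset sk]
  have e : Q.P N D Z h = ∫ x, ((∑ n ∈ Finset.Ioc D Z,
      Q.a n * (Ico (Real.log n - h) (Real.log n)).indicator (Q.Gf N) x) -
        Q.ρ * ((kap D Z (x + h) - kap D Z x) * Q.Gf N x)) := by
    unfold P
    exact integral_congr_ae (Filter.Eventually.of_forall fun x => Q.Mf_decomp N D Z hD hDZ h x hh)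
  rw [e, integral_sub (integrable_finsetSum _ fun n _ => (hi n).const_mul _)
    ((lk.integrable sk).const_mul _), integral_finsetSum _ fun n _ => (hi n).const_mul _,
    integral_const_mul]
  congr 1
  refine Finset.sum_congr rfl fun n _ => ?_
  rw [integral_const_mul, hIntv]

theorem G_loc (N n : ℕ) (hn : 1 ≤ n) (hnN : n ≤ N) (h : ℝ) (hh : 0 < h) (hh2 : h ≤ 1 / (8 * N)) :
    |(∫ x in (Real.log n - h)..(Real.log n), Q.Gf N x) - h * Q.E ((N:ℝ) / n)| ≤ |Q.ρ| * h := by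
  have hn0 : (0:ℝ) < n := by exact_mod_cast hn
  have hN1 : (1:ℝ) ≤ N := by exact_mod_cast hn.trans hnN
  have hN0 : (0:ℝ) < N := by linarith
  have hhN : h * N ≤ 1 / 8 := by
    rw [le_div_iff₀ (by positivity)] at hh2; linarith
  have hh1 : h ≤ 1 := by nlinarith
  have e : (∫ x in (Real.log n - h)..(Real.log n), Q.Gf N x) - h * Q.E ((N:ℝ) / n) =
      ∫ x in (Real.log n - h)..(Real.log n), (Q.Gf N x - Q.E ((N:ℝ) / n)) := by
    rw [intervalIntegral.integral_sub ((Q.Gf_lb N).ii _ _) intervalIntegrable_const]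
    rw [intervalIntegral.integral_const, smul_eq_mul]; ring
  rw [e]
  refine (abs_int_le ((Q.Gf_lb N).sub (LB.const _)) (by linarith) (K := |Q.ρ|) fun x hx => ?_).trans
    (le_of_eq (by ring))
  set m := N / n with hm
  have hdm := Nat.div_add_mod N n
  have hmod := Nat.mod_lt N hn
  have hm1 : (m:ℝ) ≤ (N:ℝ) / n := Nat.cast_div_le
  have hm2 : ((N:ℝ) + 1) / n ≤ m + 1 := by
    rw [div_le_iff₀ hn0]
    have : N + 1 ≤ (m + 1) * n := by
      have : n * m + N % n = N := hdm
      nlinarith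
    exact_mod_cast this
  set t := (N:ℝ) * Real.exp (-x) with ht
  have ht1 : (N:ℝ) / n ≤ t := by
    rw [ht, Real.exp_neg, ← div_eq_mul_inv]
    refine div_le_div_of_nonneg_left hN0.le (Real.exp_pos x) ?_
    rw [← Real.exp_log hn0]; exact Real.exp_le_exp.2 hx.2.le
  have ht2 : t ≤ (N:ℝ) / n + (1 / 4) / n := by
    have h1 : Real.exp (-x) ≤ (1 + 2 * h) / n := by
      have h2 : Real.exp (-x) ≤ Real.exp (h + -Real.log n) := Real.exp_le_exp.2 (by linarith [hx.1])
      rw [Real.exp_add, Real.exp_neg (Real.log n), Real.exp_log hn0, ← div_eq_mul_inv] at h2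
      refine h2.trans (div_le_div_of_nonneg_right ?_ hn0.le)
      have := Real.abs_exp_sub_one_le (x := h) (by rw [abs_of_pos hh]; linarith)
      rw [abs_of_pos hh] at this
      linarith [le_abs_self (Real.exp h - 1)]
    calc t ≤ N * ((1 + 2 * h) / n) := mul_le_mul_of_nonneg_left h1 hN0.le
      _ = N / n + (2 * (h * N)) / n := by ring
      _ ≤ _ := by gcongr; linarith
  have h3 : (N:ℝ) / n + (1 / 4) / n < m + 1 := by
    refine lt_of_lt_of_le ?_ hm2
    rw [← add_div]
    exact div_lt_div_of_pos_right (by linarith) hn0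
  have h4 : (N:ℝ) / n < m + 1 := by linarith [div_pos (by norm_num : (0:ℝ) < 1 / 4) hn0]
  change |Q.E t - _| ≤ _
  rw [Q.E_floor t m (hm1.trans ht1) (by linarith), Q.E_floor _ m hm1 h4]
  rw [show Q.Dl m - Q.ρ * (t - m) - (Q.Dl m - Q.ρ * ((N:ℝ) / n - m)) = -(Q.ρ * (t - (N:ℝ) / n)) by ring,
    abs_neg, abs_mul, abs_of_nonneg (by linarith : 0 ≤ t - (N:ℝ) / n)]
  refine mul_le_of_le_one_right (abs_nonneg _) ?_
  have h1n : (1:ℝ) ≤ n := by exact_mod_cast hn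
  have : (1 / 4 : ℝ) / n ≤ 1 := by rw [div_le_one hn0]; linarith
  linarith

theorem main_id : ∃ C : ℝ, 0 ≤ C ∧ ∀ N D Z : ℝ, 1 ≤ D → D ≤ Z → Z ≤ N →
    |∫ x in (Real.log D)..(Real.log Z), Real.exp x * Q.Gf N x| ≤ C * Z := by
  obtain ⟨C, hC, hE⟩ := Q.int_E_exp
  refine ⟨C, hC, fun N D Z hD hDZ hN => ?_⟩
  have hD0 : 0 < D := by linarith
  have hZ0 : 0 < Z := by linarith
  have hN0 : 0 < N := by linarith
  have hlog : Real.log D ≤ Real.log Z := Real.log_le_log hD0 hDZ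
  have hlogN : Real.log Z ≤ Real.log N := Real.log_le_log hZ0 hN
  have e : ∫ x in (Real.log D)..(Real.log Z), Real.exp x * Q.Gf N x =
      ∫ x in (Real.log D)..(Real.log Z), N * (fun y => Real.exp (-y) * Q.E (Real.exp y))
        (Real.log N - x) := by
    refine intervalIntegral.integral_congr fun x _ => ?_
    have h : N * Real.exp (-x) = Real.exp (Real.log N - x) := by
      rw [sub_eq_add_neg, Real.exp_add, Real.exp_log hN0]
    have h2 : Real.exp x = N * Real.exp (-(Real.log N - x)) := by
      rw [neg_sub, Real.exp_sub, Real.exp_log hN0]; field_simp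
    change Real.exp x * Q.E (N * Real.exp (-x)) = N * (Real.exp (-(Real.log N - x)) * Q.E (Real.exp (Real.log N - x)))
    rw [h, ← mul_assoc, ← h2]
  rw [e, intervalIntegral.integral_const_mul, intervalIntegral.integral_comp_sub_left
    (fun y => Real.exp (-y) * Q.E (Real.exp y)), abs_mul, abs_of_pos hN0]
  have := hE (Real.log N - Real.log Z) (Real.log N - Real.log D) (by linarith) (by linarith)
  rw [neg_sub, Real.exp_sub, Real.exp_log hN0, Real.exp_log hZ0] at this
  calc _ ≤ N * (C * (Z / N)) := mul_le_mul_of_nonneg_left this hN0.le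
    _ = C * Z := by field_simp

theorem id_part : ∃ C : ℝ, 0 ≤ C ∧ ∀ N D Z h : ℝ, 1 ≤ D → D ≤ Z → Z ≤ 2 * D → Z ≤ N → 0 < h →
    h ≤ 1 / (8 * N) →
    |∫ x in (Real.log D - h)..(Real.log Z), (kap D Z (x + h) - kap D Z x) * Q.Gf N x| ≤
      C * (Real.sqrt N + D) * h := by
  obtain ⟨C, hC, hE⟩ := Q.main_id
  refine ⟨2 * C + 24 * Q.KE, by have := Q.KE_nonneg; positivity,
    fun N D Z h hD hDZ hZ hN hh hh2 => ?_⟩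
  have hK := Q.KE_nonneg
  have hD0 : 0 < D := by linarith
  have hZ0 : 0 < Z := by linarith
  have hN0 : 0 < N := by linarith
  have hhN : h * N ≤ 1 / 8 := by
    rw [le_div_iff₀ (by positivity)] at hh2; linarith
  have hh1 : h ≤ 1 := by nlinarith
  have hhZ : h * Z ≤ 1 := by nlinarith
  have hlog : Real.log D ≤ Real.log Z := Real.log_le_log hD0 hDZ
  have hlog2 : Real.log Z ≤ Real.log D + 1 := by
    have := Real.log_le_log (by linarith) hZ
    rw [Real.log_mul (by norm_num) hD0.ne'] at this
    linarith [Real.log_two_lt_d9]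
  have lG := Q.Gf_lb N
  have ck : Continuous (fun x => kap D Z (x + h) - kap D Z x) :=
    ((kap_cont D Z).comp (continuous_id.add continuous_const)).sub (kap_cont D Z)
  have lk : LB (fun x => (kap D Z (x + h) - kap D Z x) * Q.Gf N x) := (LB.cont ck).mul lG
  have lr : LB (fun x => (kap D Z (x + h) - kap D Z x - h * Real.exp x) * Q.Gf N x) :=
    (LB.cont (ck.sub (by fun_prop))).mul lG
  have le : LB (fun x => Real.exp x * Q.Gf N x) := (LB.cont Real.continuous_exp).mul lG
  set S := Real.sqrt N with hS
  have hSG : Real.sqrt (N / D) ≤ S := Real.sqrt_le_sqrt (div_le_self hN0.le hD)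
  have hGb : ∀ x, Real.log D - h ≤ x → x ≤ Real.log Z → |Q.Gf N x| ≤ 4 * Q.KE * S := by
    intro x h1 h2
    refine (Q.Gf_bound hD hDZ hN hh1 h1 h2).trans ?_
    gcongr
  have hS0 : 0 ≤ S := Real.sqrt_nonneg _
  have hex : ∀ x, x ≤ Real.log Z → Real.exp x ≤ Z := by
    intro x hx
    rw [← Real.exp_log hZ0]; exact Real.exp_le_exp.2 hx
  have hkd : ∀ x, x ≤ Real.log Z → |kap D Z (x + h) - kap D Z x| ≤ 2 * h * Z := by
    intro x hx
    refine (kap_lip _ _ _ _).trans ((exp_diff hh.le hh1 x).trans ?_)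
    exact mul_le_mul_of_nonneg_left (hex x hx) (by positivity)
  set m := max (Real.log D) (Real.log Z - h) with hm
  have hm1 : Real.log D ≤ m := le_max_left _ _
  have hm2 : m ≤ Real.log Z := max_le hlog (by linarith)
  have hm3 : Real.log Z - h ≤ m := le_max_right _ _
  have e : ∫ x in (Real.log D)..(Real.log Z), (kap D Z (x + h) - kap D Z x) * Q.Gf N x =
      (∫ x in (Real.log D)..(Real.log Z), (kap D Z (x + h) - kap D Z x - h * Real.exp x) * Q.Gf N x) +
        h * ∫ x in (Real.log D)..(Real.log Z), Real.exp x * Q.Gf N x := by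
    rw [← intervalIntegral.integral_const_mul, ← intervalIntegral.integral_add (lr.ii _ _)
      (((LB.const h).mul le).ii _ _)]
    refine intervalIntegral.integral_congr fun x _ => ?_
    ring
  rw [← intervalIntegral.integral_add_adjacent_intervals (lk.ii _ (Real.log D)) (lk.ii _ _), e,
    ← intervalIntegral.integral_add_adjacent_intervals (lr.ii (Real.log D) m) (lr.ii m _)]
  have h1 : |∫ x in (Real.log D - h)..(Real.log D), (kap D Z (x + h) - kap D Z x) * Q.Gf N x| ≤
      8 * Q.KE * S * h := by
    refine (abs_int_le lk (by linarith) (K := 8 * Q.KE * S) fun x hx => ?_).trans (le_of_eq (by ring))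
    rw [abs_mul]
    calc _ ≤ (2 * h * Z) * (4 * Q.KE * S) :=
          mul_le_mul (hkd x (by linarith [hx.2])) (hGb x hx.1.le (by linarith [hx.2])) (abs_nonneg _)
            (by positivity)
      _ = 8 * Q.KE * S * (h * Z) := by ring
      _ ≤ 8 * Q.KE * S * 1 := by gcongr
      _ = _ := mul_one _
  have h2 : |∫ x in (Real.log D)..m, (kap D Z (x + h) - kap D Z x - h * Real.exp x) * Q.Gf N x| ≤
      4 * Q.KE * S * h := by
    refine (abs_int_le lr hm1 (K := 4 * Q.KE * S * h) fun x hx => ?_).trans ?_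
    · have hx2 : x < Real.log Z - h := by
        rcases lt_max_iff.1 hx.2 with h | h
        · linarith [hx.1]
        · exact h
      rw [kap_mid hD0 hDZ (by linarith [hx.1]) (by linarith),
        kap_mid hD0 hDZ (by linarith [hx.1]) (by linarith), abs_mul]
      have hb : |Real.exp (x + h) - Real.exp x - h * Real.exp x| ≤ h := by
        rw [Real.exp_add, show Real.exp x * Real.exp h - Real.exp x - h * Real.exp x =
          (Real.exp h - 1 - h) * Real.exp x by ring, abs_mul, abs_of_pos (Real.exp_pos x)]
        have := Real.abs_exp_sub_one_sub_id_le (x := h) (by rw [abs_of_pos hh]; exact hh1)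
        calc _ ≤ h ^ 2 * Z := mul_le_mul this (hex x (by linarith)) (Real.exp_pos x).le (by positivity)
          _ = h * (h * Z) := by ring
          _ ≤ h * 1 := by gcongr
          _ = h := mul_one h
      calc _ ≤ h * (4 * Q.KE * S) :=
            mul_le_mul hb (hGb x (by linarith [hx.1]) (by linarith)) (abs_nonneg _) hh.le
        _ = _ := by ring
    · exact mul_le_of_le_one_right (by positivity) (by linarith)
  have h3 : |∫ x in m..(Real.log Z), (kap D Z (x + h) - kap D Z x - h * Real.exp x) * Q.Gf N x| ≤
      12 * Q.KE * S * h := by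
    refine (abs_int_le lr hm2 (K := 12 * Q.KE * S) fun x hx => ?_).trans ?_
    · rw [abs_mul]
      have hb : |kap D Z (x + h) - kap D Z x - h * Real.exp x| ≤ 3 * (h * Z) := by
        refine (abs_sub _ _).trans ?_
        rw [abs_mul, abs_of_pos hh, abs_of_pos (Real.exp_pos x)]
        have := hkd x hx.2.le
        have := mul_le_mul_of_nonneg_left (hex x hx.2.le) hh.le
        linarith
      calc _ ≤ (3 * (h * Z)) * (4 * Q.KE * S) :=
            mul_le_mul hb (hGb x (by linarith [hx.1]) hx.2.le) (abs_nonneg _) (by positivity)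
        _ ≤ (3 * 1) * (4 * Q.KE * S) := by gcongr
        _ = _ := by ring
    · exact mul_le_mul_of_nonneg_left (by linarith) (by positivity)
  have h4 : |h * ∫ x in (Real.log D)..(Real.log Z), Real.exp x * Q.Gf N x| ≤ 2 * C * D * h := by
    rw [abs_mul, abs_of_pos hh]
    calc _ ≤ h * (C * (2 * D)) := mul_le_mul_of_nonneg_left ((hE N D Z hD hDZ hN).trans (by gcongr)) hh.le
      _ = _ := by ring
  have h5 : 0 ≤ C * S * h := by positivity
  have h6 : 0 ≤ Q.KE * D * h := by positivity
  rw [abs_le] at *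
  constructor <;> linarith

theorem block : ∃ C : ℝ, 0 ≤ C ∧ ∀ N D Z : ℕ, 1 ≤ D → D ≤ Z → Z ≤ 2 * D → Z ≤ N →
    |∑ n ∈ Finset.Ioc D Z, Q.a n * Q.E ((N:ℝ) / n)| ≤ C * (Real.sqrt N * lg N ^ 6 + D) := by
  obtain ⟨C1, hC1, tf⟩ := Q.T_fine
  obtain ⟨C2, hC2, ip⟩ := Q.id_part
  refine ⟨7 * C1 + |Q.ρ| * C2 + 2 * |Q.ρ| * (|Q.ρ| + Q.c), by have := Q.c_nonneg; positivity,
    fun N D Z hD hDZ hZ hN => ?_⟩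
  have hN1 : 1 ≤ N := by omega
  have hN1' : (1:ℝ) ≤ N := by exact_mod_cast hN1
  have hD' : (1:ℝ) ≤ D := by exact_mod_cast hD
  have hDZ' : (D:ℝ) ≤ Z := by exact_mod_cast hDZ
  have hZ' : (Z:ℝ) ≤ 2 * D := by exact_mod_cast hZ
  have hN' : (Z:ℝ) ≤ N := by exact_mod_cast hN
  have hl := one_le_lg hN1'
  set J := Nat.log 2 N + 4 with hJ
  set h : ℝ := (1 / 2) ^ J with hh
  have h0 : 0 < h := by positivity
  have h8 : h ≤ 1 / (8 * N) := by
    have h1 : 8 * N ≤ 2 ^ J := by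
      have := Nat.lt_pow_succ_log_self (b := 2) (by norm_num) N
      rw [hJ, show Nat.log 2 N + 4 = (Nat.log 2 N).succ + 3 by omega, pow_add]
      omega
    rw [hh, one_div_pow]
    exact one_div_le_one_div_of_le (by positivity) (by exact_mod_cast h1)
  have hJl : (J:ℝ) + 1 ≤ 7 * lg N := by
    have h1 : 2 ^ (Nat.log 2 N) ≤ N := Nat.pow_log_le_self 2 (by omega)
    have h2 : ((2:ℝ)) ^ (Nat.log 2 N) ≤ N := by exact_mod_cast h1
    have h3 := Real.log_le_log (by positivity) h2
    rw [Real.log_pow] at h3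
    have h4 : (0:ℝ) ≤ (Nat.log 2 N : ℝ) := Nat.cast_nonneg _
    have h5 := Real.log_two_gt_d9
    have h6 : (Nat.log 2 N : ℝ) ≤ 2 * Real.log N := by nlinarith
    rw [hJ]; push_cast; unfold lg
    have := Real.log_nonneg hN1'
    linarith
  have hT := tf N D Z J hD' hDZ' hZ' hN'
  have hI := ip N D Z h hD' hDZ' hZ' hN' h0 h8
  have hP := Q.P_decomp N D Z hD hDZ h h0.le
  set I := ∫ x in (Real.log D - h)..(Real.log Z), (kap D Z (x + h) - kap D Z x) * Q.Gf N x with hIdef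
  have hT2 : |Q.P N D Z h| ≤ C1 * Real.sqrt N * lg N ^ 5 * (J + 1) * h := by
    unfold Tn at hT
    rw [abs_div, abs_of_pos h0, div_le_iff₀ h0] at hT
    exact hT
  set S := ∑ n ∈ Finset.Ioc D Z, Q.a n * Q.E ((N:ℝ) / n) with hS
  have hA : ∑ n ∈ Finset.Ioc D Z, Q.a n ≤ 2 * (|Q.ρ| + Q.c) * D := by
    have h1 : ∑ n ∈ Finset.Ioc D Z, Q.a n ≤ Q.A Z := by
      unfold A
      exact Finset.sum_le_sum_of_subset_of_nonneg (Finset.Ioc_subset_Ioc_left (Nat.zero_le _))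
        fun n _ _ => Q.a_nonneg n
    have h2 := Q.land Z (hD.trans hDZ)
    have h3 : Real.sqrt Z ≤ Z := by
      rw [Real.sqrt_le_left (by linarith)]; nlinarith
    have h4 := (abs_le.1 h2).2
    have h5 := mul_le_mul_of_nonneg_left h3 Q.c_nonneg
    have h6 := mul_le_mul_of_nonneg_right (le_abs_self Q.ρ) (by linarith : (0:ℝ) ≤ Z)
    have h7 := mul_le_mul_of_nonneg_left hZ' (add_nonneg (abs_nonneg Q.ρ) Q.c_nonneg)
    have h8 : Q.A Z = ∑ m ∈ Finset.Ioc 0 Z, Q.a m := rfl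
    linarith
  have hd : |(∑ n ∈ Finset.Ioc D Z, Q.a n * ∫ x in (Real.log n - h)..(Real.log n), Q.Gf N x) - h * S| ≤
      |Q.ρ| * h * (2 * (|Q.ρ| + Q.c) * D) := by
    rw [hS, Finset.mul_sum, ← Finset.sum_sub_distrib]
    refine (Finset.abs_sum_le_sum_abs _ _).trans ?_
    refine le_trans (Finset.sum_le_sum (g := fun n => |Q.ρ| * h * Q.a n) fun n hn => ?_) ?_
    · rw [Finset.mem_Ioc] at hn
      have := Q.G_loc N n (by omega) (by omega) h h0 h8
      rw [show Q.a n * (∫ x in (Real.log n - h)..(Real.log n), Q.Gf N x) - h * (Q.a n * Q.E ((N:ℝ) / n))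
        = Q.a n * ((∫ x in (Real.log n - h)..(Real.log n), Q.Gf N x) - h * Q.E ((N:ℝ) / n)) by ring,
        abs_mul, abs_of_nonneg (Q.a_nonneg n), mul_comm]
      exact mul_le_mul_of_nonneg_right this (Q.a_nonneg n)
    · rw [← Finset.mul_sum]
      exact mul_le_mul_of_nonneg_left hA (by positivity)
  have hρI : |Q.ρ * I| ≤ |Q.ρ| * (C2 * (Real.sqrt N + D) * h) := by
    rw [abs_mul]; exact mul_le_mul_of_nonneg_left hI (abs_nonneg _)
  have hkey : |h * S| ≤ h * (C1 * Real.sqrt N * lg N ^ 5 * (J + 1) + |Q.ρ| * (C2 * (Real.sqrt N + D)) +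
      |Q.ρ| * (2 * (|Q.ρ| + Q.c) * D)) := by
    rw [abs_le] at *
    constructor <;> linarith
  rw [abs_mul, abs_of_pos h0] at hkey
  refine (le_of_mul_le_mul_left hkey h0).trans ?_
  have g1 : C1 * Real.sqrt N * lg N ^ 5 * (J + 1) ≤ 7 * C1 * (Real.sqrt N * lg N ^ 6) := by
    calc _ ≤ C1 * Real.sqrt N * lg N ^ 5 * (7 * lg N) := by gcongr
      _ = _ := by ring
  have g2 : Real.sqrt N ≤ Real.sqrt N * lg N ^ 6 :=
    le_mul_of_one_le_right (Real.sqrt_nonneg _) (one_le_pow₀ hl)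
  have g3 : |Q.ρ| * (C2 * (Real.sqrt N + D)) ≤ |Q.ρ| * C2 * (Real.sqrt N * lg N ^ 6 + D) := by
    rw [← mul_assoc]; gcongr
  have g4 : 0 ≤ 2 * |Q.ρ| * (|Q.ρ| + Q.c) * (Real.sqrt N * lg N ^ 6) := by
    have := Q.c_nonneg; positivity
  have g5 : 0 ≤ 7 * C1 * (D:ℝ) := by positivity
  linarith

end QD

end

section

namespace QD
open Finset
variable (Q : QD)

theorem abel_block (f : ℕ → ℝ) (D : ℕ) : ∀ k : ℕ,
    ∑ n ∈ Ioc D (D + k), (n : ℝ) * f n =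
      ((D + k : ℕ) : ℝ) * ∑ n ∈ Ioc D (D + k), f n -
        ∑ j ∈ range k, ∑ n ∈ Ioc D (D + j), f n := by
  intro k
  induction k with
  | zero => simp
  | succ k ih =>
    rw [← Nat.add_assoc, Finset.sum_Ioc_succ_top (by omega), Finset.sum_Ioc_succ_top (by omega),
      Finset.sum_range_succ, ih]
    push_cast
    ring

theorem block_weighted : ∃ C : ℝ, 0 ≤ C ∧ ∀ N D Z : ℕ, 1 ≤ D → D ≤ Z → Z ≤ 2 * D → Z ≤ N →
    |∑ n ∈ Ioc D Z, (n : ℝ) * (Q.a n * Q.E ((N:ℝ) / n))| ≤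
      C * (Z * Real.sqrt N * lg N ^ 6 + Z ^ 2) := by
  obtain ⟨C, hC, hb⟩ := Q.block
  refine ⟨2 * C, by positivity, fun N D Z hD hDZ hZ hN => ?_⟩
  have hL : 1 ≤ lg N := one_le_lg (by exact_mod_cast (by omega : 1 ≤ N))
  obtain ⟨k, rfl⟩ := Nat.exists_eq_add_of_le hDZ
  rw [abel_block (fun n => Q.a n * Q.E ((N:ℝ) / n))]
  set B := C * (Real.sqrt N * lg N ^ 6 + D) with hB
  have hB0 : 0 ≤ B := by positivity
  have h1 := hb N D (D + k) hD hDZ hZ hN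
  have h2 : |∑ j ∈ range k, ∑ n ∈ Ioc D (D + j), Q.a n * Q.E ((N:ℝ) / n)| ≤ k * B := by
    refine (abs_sum_le_sum_abs _ _).trans ?_
    refine (sum_le_card_nsmul _ _ B fun j hj => ?_).trans (by simp)
    rw [mem_range] at hj
    exact hb N D (D + j) hD (by omega) (by omega) (by omega)
  refine (abs_sub _ _).trans ?_
  rw [abs_mul, Nat.abs_cast]
  have h3 : (k : ℝ) ≤ ((D + k : ℕ) : ℝ) := by exact_mod_cast (by omega)
  have h4 : (D : ℝ) ≤ ((D + k : ℕ) : ℝ) := by exact_mod_cast (by omega)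
  set z := ((D + k : ℕ) : ℝ) with hz
  have hz0 : 0 ≤ z := by positivity
  calc _ ≤ z * B + z * B := add_le_add (mul_le_mul_of_nonneg_left h1 hz0)
          (h2.trans (mul_le_mul_of_nonneg_right h3 hB0))
    _ = 2 * C * (z * Real.sqrt N * lg N ^ 6 + z * D) := by rw [hB]; ring
    _ ≤ _ := by
      have : z * D ≤ z ^ 2 := by rw [sq]; exact mul_le_mul_of_nonneg_left h4 hz0
      gcongr

theorem R_bound : ∃ C : ℝ, 0 ≤ C ∧ ∀ N Z : ℕ, 1 ≤ Z → Z ≤ N →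
    |∑ n ∈ Ioc 0 Z, (n : ℝ) * (Q.a n * Q.E ((N:ℝ) / n))| ≤
      C * (Z * Real.sqrt N * lg N ^ 6 + Z ^ 2) := by
  obtain ⟨C, hC, hb⟩ := Q.block_weighted
  have hKE : 0 ≤ Q.KE := by unfold KE; have := Q.c_nonneg; positivity
  refine ⟨3 * C + |Q.a 1| * (2 * Q.KE), by positivity, fun N Z => ?_⟩
  set K := 3 * C + |Q.a 1| * (2 * Q.KE) with hK
  have hK0 : 0 ≤ K := by positivity
  induction Z using Nat.strong_induction_on with
  | _ Z ih =>
  intro hZ hN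
  have hN1 : 1 ≤ (N:ℝ) := by exact_mod_cast (by omega : 1 ≤ N)
  have hL : 1 ≤ lg N := one_le_lg hN1
  have hL6 : 1 ≤ lg N ^ 6 := one_le_pow₀ hL
  rcases Nat.lt_or_ge 1 Z with h | h
  · have hD : 1 ≤ (Z + 1) / 2 := by omega
    have h1 := ih ((Z + 1) / 2) (by omega) hD (by omega)
    have h2 := hb N ((Z + 1) / 2) Z hD (by omega) (by omega) hN
    have h3 : (((Z + 1) / 2 : ℕ) : ℝ) ≤ 2 / 3 * Z := by
      have : 3 * ((Z + 1) / 2) ≤ 2 * Z := by omega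
      have : (3:ℝ) * (((Z + 1) / 2 : ℕ) : ℝ) ≤ 2 * Z := by exact_mod_cast this
      linarith
    rw [← sum_Ioc_consecutive _ (Nat.zero_le ((Z + 1) / 2)) (by omega : (Z + 1) / 2 ≤ Z)]
    set d := (((Z + 1) / 2 : ℕ) : ℝ)
    have hd : 0 ≤ d := by positivity
    have h4 : d ^ 2 ≤ 2 / 3 * (Z:ℝ) ^ 2 := by
      have : d ^ 2 ≤ (2 / 3 * (Z:ℝ)) ^ 2 := by gcongr
      nlinarith [sq_nonneg (Z:ℝ)]
    refine (abs_add_le _ _).trans ((add_le_add h1 h2).trans ?_)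
    set S := Real.sqrt N * lg N ^ 6 with hS
    have hS0 : 0 ≤ S := by positivity
    have e1 : K * (d * Real.sqrt N * lg N ^ 6 + d ^ 2) ≤ K * (2 / 3 * (Z * S + Z ^ 2)) := by
      refine mul_le_mul_of_nonneg_left ?_ hK0
      have := mul_le_mul_of_nonneg_right h3 hS0
      rw [mul_assoc]; linarith
    have e2 : 3 * C ≤ K := by rw [hK]; have : 0 ≤ |Q.a 1| * (2 * Q.KE) := by positivity
                              linarith
    have hW : 0 ≤ Z * S + (Z:ℝ) ^ 2 := by positivity
    rw [mul_assoc (Z:ℝ), ← hS]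
    nlinarith [mul_le_mul_of_nonneg_right e2 hW]
  · obtain rfl : Z = 1 := by omega
    have := Q.E_bound _ hN1
    rw [show Ioc 0 1 = {1} from rfl]
    simp only [sum_singleton, Nat.cast_one, one_mul, div_one, abs_mul]
    have h5 : Real.sqrt N ≤ Real.sqrt N * lg N ^ 6 := le_mul_of_one_le_right (by positivity) hL6
    have h6 : 0 ≤ Real.sqrt N * lg N ^ 6 := by positivity
    calc _ ≤ |Q.a 1| * (2 * Q.KE * Real.sqrt N) := by gcongr
      _ = |Q.a 1| * (2 * Q.KE) * Real.sqrt N := by ring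
      _ ≤ K * (Real.sqrt N * lg N ^ 6 + 1 ^ 2) := by
        refine mul_le_mul (by linarith) (by linarith) (by positivity) hK0

end QD

end

section

namespace IdS
open NumberField Classical Finset UniqueFactorizationMonoid

variable {F : Type} [Field F] [NumberField F]

theorem fin_le (x : ℕ) : {I : Ideal (𝓞 F) | I ≠ 0 ∧ Ideal.absNorm I ≤ x}.Finite :=
  (Ideal.finite_setOfPred_absNorm_le x).subset fun _ h => h.2

/-- Nonzero ideals of norm at most `x`. -/
noncomputable def IS (F : Type) [Field F] [NumberField F] (x : ℕ) : Finset (Ideal (𝓞 F)) :=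
  (fin_le x).toFinset

theorem mem_IS {x : ℕ} {I : Ideal (𝓞 F)} : I ∈ IS F x ↔ I ≠ 0 ∧ Ideal.absNorm I ≤ x := by
  simp [IS]

theorem norm_pos {I : Ideal (𝓞 F)} (h : I ≠ 0) : 0 < Ideal.absNorm I := by
  rw [Nat.pos_iff_ne_zero, Ne, Ideal.absNorm_eq_zero_iff]
  exact h

/-- Number of ideals of norm `n`. -/
noncomputable def an (F : Type) [Field F] [NumberField F] (n : ℕ) : ℕ :=
  ((Ideal.finite_setOfPred_absNorm_eq (S := 𝓞 F) n).toFinset).card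

theorem sum_IS (x : ℕ) (f : ℕ → ℝ) :
    ∑ I ∈ IS F x, f (Ideal.absNorm I) = ∑ n ∈ Ioc 0 x, (an F n : ℝ) * f n := by
  rw [← Finset.sum_fiberwise_of_maps_to (s := IS F x) (t := Ioc 0 x) (g := fun I => Ideal.absNorm I)]
  · refine sum_congr rfl fun n hn => ?_
    rw [mem_Ioc] at hn
    have : (IS F x).filter (fun I => Ideal.absNorm I = n) =
        (Ideal.finite_setOfPred_absNorm_eq (S := 𝓞 F) n).toFinset := by
      ext I
      simp only [mem_filter, mem_IS, Set.Finite.mem_toFinset, Set.mem_ofPred_eq]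
      refine ⟨fun h => h.2, fun h => ⟨⟨?_, h.le.trans hn.2⟩, h⟩⟩
      rintro rfl
      simp at h
      omega
    rw [an, ← this, ← nsmul_eq_mul, ← sum_const]
    refine sum_congr rfl fun I hI => ?_
    rw [(mem_filter.1 hI).2]
  · intro I hI
    rw [mem_IS] at hI
    exact mem_Ioc.2 ⟨norm_pos hI.1, hI.2⟩

theorem card_IS (x : ℕ) : ((IS F x).card : ℝ) = ∑ n ∈ Ioc 0 x, (an F n : ℝ) := by
  have := sum_IS (F := F) x (fun _ => 1)
  simpa using this

theorem card_mult (d : Ideal (𝓞 F)) (hd : d ≠ 0) (x : ℕ) :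
    ((IS F x).filter (fun n => d ∣ n)).card = (IS F (x / Ideal.absNorm d)).card := by
  symm
  refine card_bij (fun k _ => d * k) ?_ ?_ ?_
  · intro k hk
    rw [mem_IS] at hk
    rw [mem_filter, mem_IS]
    refine ⟨⟨mul_ne_zero hd hk.1, ?_⟩, dvd_mul_right _ _⟩
    rw [map_mul, mul_comm]
    exact (Nat.le_div_iff_mul_le (norm_pos hd)).1 hk.2
  · intro k _ l _ h
    exact mul_left_cancel₀ hd h
  · intro n hn
    rw [mem_filter, mem_IS] at hn
    obtain ⟨⟨h0, h1⟩, k, rfl⟩ := hn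
    refine ⟨k, mem_IS.2 ⟨right_ne_zero_of_mul h0, ?_⟩, rfl⟩
    rw [Nat.le_div_iff_mul_le (norm_pos hd), mul_comm, ← map_mul]
    exact h1

theorem mu_mul_prime {P e : Ideal (𝓞 F)} (hP : Prime P) (he : e ≠ 0) (h : ¬ P ∣ e) :
    idealMu (P * e) = - idealMu e := by
  have hrel : IsRelPrime P e := (hP.irreducible.isRelPrime_iff_not_dvd).2 h
  have hsq : Squarefree (P * e) ↔ Squarefree e := by
    rw [squarefree_mul_iff]
    exact ⟨fun h => h.2.2, fun h => ⟨hrel, hP.irreducible.squarefree, h⟩⟩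
  have hc : ∀ I : Ideal (𝓞 F), Multiset.card (factors I) = Multiset.card (normalizedFactors I) := by
    intro I
    rw [normalizedFactors, Multiset.card_map]
  unfold idealMu
  simp only [hsq]
  split_ifs
  · rw [hc, hc, normalizedFactors_mul hP.ne_zero he, normalizedFactors_irreducible hP.irreducible,
      Multiset.card_add, Multiset.card_singleton, pow_add]
    ring
  · simp

theorem mu_eq_zero {P e : Ideal (𝓞 F)} (hP : Prime P) (h : P ∣ e) :
    idealMu (P * e) = 0 := by
  unfold idealMu
  rw [if_neg]
  intro hs
  exact hP.not_isUnit (hs P (mul_dvd_mul_left P h))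

theorem abs_mu_le (e : Ideal (𝓞 F)) : |((idealMu e : ℤ) : ℝ)| ≤ 1 := by
  unfold idealMu
  split_ifs <;> simp

theorem sum_mu (x : ℕ) (m : Ideal (𝓞 F)) (hm : m ∈ IS F x) :
    ∑ e ∈ (IS F x).filter (fun e => e ∣ m), idealMu e = if m = 1 then 1 else 0 := by
  have hm' := mem_IS.1 hm
  split_ifs with h1
  · subst h1
    have : (IS F x).filter (fun e => e ∣ 1) = {1} := by
      ext e
      rw [mem_filter, mem_singleton]
      refine ⟨fun h => ?_, ?_⟩
      · have := isUnit_of_dvd_one h.2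
        rw [Ideal.one_eq_top]; exact Ideal.isUnit_iff.1 this
      · rintro rfl
        exact ⟨hm, dvd_rfl⟩
    rw [this, sum_singleton, idealMu, if_pos squarefree_one]
    rw [factors_one, Multiset.card_zero, pow_zero]
  · have hnu : ¬ IsUnit m := fun h => h1 (by rw [Ideal.one_eq_top]; exact Ideal.isUnit_iff.1 h)
    obtain ⟨P, hP, hPm⟩ := WfDvdMonoid.exists_irreducible_factor hnu hm'.1
    have hP : Prime P := hP.prime
    rw [← sum_filter_add_sum_filter_not _ (fun e => P ∣ e)]
    have key : ∑ e ∈ ((IS F x).filter (fun e => e ∣ m)).filter (fun e => P ∣ e), idealMu e =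
        ∑ e ∈ ((IS F x).filter (fun e => e ∣ m)).filter (fun e => ¬ P ∣ e), idealMu (P * e) := by
      symm
      refine sum_of_injOn (fun e => P * e) ?_ ?_ ?_ ?_
      · intro a _ b _ h
        exact mul_left_cancel₀ hP.ne_zero h
      · intro e he
        simp only [coe_filter, mem_filter, Set.mem_ofPred_eq] at he ⊢
        have hd : P * e ∣ m :=
          ((hP.irreducible.isRelPrime_iff_not_dvd).2 he.2).mul_dvd hPm he.1.2
        refine ⟨⟨?_, hd⟩, dvd_mul_right _ _⟩
        refine mem_IS.2 ⟨mul_ne_zero hP.ne_zero (mem_IS.1 he.1.1).1, ?_⟩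
        exact (Nat.le_of_dvd (norm_pos hm'.1) (map_dvd Ideal.absNorm hd)).trans hm'.2
      · intro e he hne
        simp only [mem_filter] at he
        obtain ⟨k, rfl⟩ := he.2
        by_cases hk : P ∣ k
        · exact mu_eq_zero hP hk
        · exfalso
          apply hne
          refine ⟨k, ?_, rfl⟩
          simp only [coe_filter, mem_filter, Set.mem_ofPred_eq]
          have h0 := (mem_IS.1 he.1.1)
          have hkd : k ∣ P * k := dvd_mul_left _ _
          exact ⟨⟨mem_IS.2 ⟨right_ne_zero_of_mul h0.1,
            (Nat.le_of_dvd (norm_pos h0.1) (map_dvd Ideal.absNorm hkd)).trans h0.2⟩,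
            hkd.trans he.1.2⟩, hk⟩
      · intro e _
        rfl
    rw [key, ← sum_add_distrib]
    refine sum_eq_zero fun e he => ?_
    simp only [mem_filter] at he
    rw [mu_mul_prime hP (mem_IS.1 he.1.1).1 he.2]
    ring

theorem main_term (x : ℕ) (hx : 1 ≤ x) :
    ∑ e ∈ IS F x, idealMu e * ((IS F (x / Ideal.absNorm e)).card : ℤ) = 1 := by
  have h1 : ∑ m ∈ IS F x, ∑ e ∈ (IS F x).filter (fun e => e ∣ m), idealMu e = 1 := by
    rw [sum_congr rfl (sum_mu (F := F) x), sum_ite_eq' (IS F x) 1, if_pos]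
    refine mem_IS.2 ⟨one_ne_zero, by simpa using hx⟩
  rw [← h1]
  simp_rw [sum_filter]
  rw [sum_comm]
  refine sum_congr rfl fun e he => ?_
  rw [← card_mult e (mem_IS.1 he).1, ← sum_filter, sum_const, nsmul_eq_mul, mul_comm]

theorem ram_eq (x : ℕ) (m n : Ideal (𝓞 F)) (hm : m ∈ IS F x) :
    ramanujanSum m n = ∑ e ∈ IS F x, ∑ d ∈ IS F x,
      if d * e = m then (if d ∣ n then (Ideal.absNorm d : ℤ) * idealMu e else 0) else 0 := by
  have hm' := mem_IS.1 hm
  have hs : {p : Ideal (𝓞 F) × Ideal (𝓞 F) | p.1 * p.2 = m ∧ p.1 ∣ n} =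
      ↑((IS F x ×ˢ IS F x).filter (fun p => p.1 * p.2 = m ∧ p.1 ∣ n)) := by
    ext ⟨d, e⟩
    simp only [Set.mem_ofPred_eq, coe_filter, mem_product, mem_IS]
    refine ⟨fun h => ⟨?_, h⟩, fun h => h.2⟩
    have h0 : d * e ≠ 0 := h.1 ▸ hm'.1
    have hN : Ideal.absNorm (d * e) ≤ x := h.1 ▸ hm'.2
    exact ⟨⟨left_ne_zero_of_mul h0, (Nat.le_of_dvd (norm_pos h0)
      (map_dvd Ideal.absNorm (dvd_mul_right _ _))).trans hN⟩, ⟨right_ne_zero_of_mul h0,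
      (Nat.le_of_dvd (norm_pos h0) (map_dvd Ideal.absNorm (dvd_mul_left _ _))).trans hN⟩⟩
  rw [ramanujanSum, hs, finsum_mem_coe_finset, sum_filter, sum_product_right]
  refine sum_congr rfl fun e _ => sum_congr rfl fun d _ => ?_
  by_cases h1 : d * e = m <;> by_cases h2 : d ∣ n <;> simp [h1, h2]

theorem set_eq (X : ℝ) (hX : 0 ≤ X) :
    {m : Ideal (𝓞 F) | m ≠ 0 ∧ (Ideal.absNorm m : ℝ) ≤ X} = ↑(IS F ⌊X⌋₊) := by
  ext m
  simp only [Set.mem_ofPred_eq, mem_coe, mem_IS]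
  rw [Nat.le_floor_iff hX]

theorem C1_eq (X Y : ℝ) (hX : 0 ≤ X) (hY : 0 ≤ Y) :
    C1 F X Y = ∑ e ∈ IS F ⌊X⌋₊, idealMu e * ∑ d ∈ IS F (⌊X⌋₊ / Ideal.absNorm e),
      (Ideal.absNorm d : ℤ) * ((IS F (⌊Y⌋₊ / Ideal.absNorm d)).card : ℤ) := by
  set x := ⌊X⌋₊
  set N := ⌊Y⌋₊
  have h1 : C1 F X Y = ∑ n ∈ IS F N, ∑ m ∈ IS F x, ∑ e ∈ IS F x, ∑ d ∈ IS F x,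
      if d * e = m then (if d ∣ n then (Ideal.absNorm d : ℤ) * idealMu e else 0) else 0 := by
    rw [C1, set_eq X hX, set_eq Y hY, finsum_mem_coe_finset]
    refine sum_congr rfl fun n _ => ?_
    rw [finsum_mem_coe_finset]
    exact sum_congr rfl fun m hm => ram_eq x m n hm
  have h2 : ∀ n ∈ IS F N, ∑ m ∈ IS F x, ∑ e ∈ IS F x, ∑ d ∈ IS F x,
      (if d * e = m then (if d ∣ n then (Ideal.absNorm d : ℤ) * idealMu e else 0) else 0) =
      ∑ e ∈ IS F x, ∑ d ∈ IS F (x / Ideal.absNorm e),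
        (if d ∣ n then (Ideal.absNorm d : ℤ) * idealMu e else 0) := by
    intro n _
    rw [sum_comm]
    refine sum_congr rfl fun e he => ?_
    rw [sum_comm]
    have he' := mem_IS.1 he
    have hf : IS F (x / Ideal.absNorm e) = (IS F x).filter (fun d => d * e ∈ IS F x) := by
      ext d
      simp only [mem_filter, mem_IS, Nat.le_div_iff_mul_le (norm_pos he'.1), map_mul]
      refine ⟨fun h => ⟨⟨h.1, ?_⟩, mul_ne_zero h.1 he'.1, h.2⟩, fun h => ⟨h.1.1, h.2.2⟩⟩
      exact (Nat.le_mul_of_pos_right _ (norm_pos he'.1)).trans h.2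
    rw [hf, sum_filter]
    refine sum_congr rfl fun d _ => ?_
    rw [sum_ite_eq]
  rw [h1, sum_congr rfl h2, sum_comm]
  refine sum_congr rfl fun e he => ?_
  rw [sum_comm, mul_sum]
  refine sum_congr rfl fun d hd => ?_
  rw [← card_mult d (mem_IS.1 hd).1, ← sum_filter, sum_const, nsmul_eq_mul]
  ring

end IdS

end

section

namespace QD
open Finset
variable (Q : QD)

theorem abel_w (f w : ℕ → ℝ) : ∀ Z : ℕ,
    ∑ n ∈ Ioc 0 Z, f n * w n = (∑ n ∈ Ioc 0 Z, f n) * w (Z + 1) +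
      ∑ n ∈ Ioc 0 Z, (∑ m ∈ Ioc 0 n, f m) * (w n - w (n + 1)) := by
  intro Z
  induction Z with
  | zero => simp
  | succ Z ih =>
    rw [sum_Ioc_succ_top (by omega), ih, sum_Ioc_succ_top (by omega : 0 ≤ Z),
      sum_Ioc_succ_top (by omega : 0 ≤ Z), sum_Ioc_succ_top (by omega : 0 ≤ Z)]
    ring

theorem A_le (n : ℕ) : Q.A n ≤ (|Q.ρ| + Q.c) * n := by
  rcases Nat.eq_zero_or_pos n with rfl | h
  · simp [A]
  · have h1 := Q.land n h
    have h1 := (abs_le.1 h1).2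
    change Q.A n - Q.ρ * n ≤ _ at h1
    have hn : (1:ℝ) ≤ n := by exact_mod_cast h
    have h2 : Real.sqrt n ≤ n := by
      rw [Real.sqrt_le_left (by linarith)]
      nlinarith
    have h3 := mul_le_mul_of_nonneg_left h2 Q.c_nonneg
    have h4 := mul_le_mul_of_nonneg_right (le_abs_self Q.ρ) (by linarith : (0:ℝ) ≤ n)
    linarith

theorem sum_a_w (w : ℕ → ℝ) (hw0 : ∀ n, 0 ≤ w n) (hw : ∀ n, 1 ≤ n → w (n + 1) ≤ w n) (Z : ℕ) :
    ∑ n ∈ Ioc 0 Z, Q.a n * w n ≤ (|Q.ρ| + Q.c) * ∑ n ∈ Ioc 0 Z, w n := by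
  have h1 := abel_w (fun _ => 1) w Z
  simp only [one_mul, sum_const, Nat.card_Ioc, Nat.sub_zero, nsmul_eq_mul, mul_one] at h1
  rw [abel_w Q.a w Z, h1, mul_add, mul_sum]
  refine add_le_add ?_ (sum_le_sum fun n hn => ?_)
  · rw [← mul_assoc]
    exact mul_le_mul_of_nonneg_right (Q.A_le Z) (hw0 _)
  · rw [← mul_assoc]
    exact mul_le_mul_of_nonneg_right (Q.A_le n) (sub_nonneg.2 (hw n (mem_Ioc.1 hn).1))

theorem sum_a_inv (Z : ℕ) : ∑ n ∈ Ioc 0 Z, Q.a n * ((1:ℝ) / n) ≤ (|Q.ρ| + Q.c) * lg Z := by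
  refine (Q.sum_a_w (fun n => (1:ℝ) / n) (fun n => by positivity) (fun n hn => ?_) Z).trans ?_
  · have : (0:ℝ) < n := by exact_mod_cast hn
    apply one_div_le_one_div_of_le this
    push_cast; linarith
  · have := Q.c_nonneg
    refine mul_le_mul_of_nonneg_left ?_ (by positivity)
    have := harm_le Z
    rwa [show Icc 1 Z = Ioc 0 Z from rfl] at this

theorem sum_a_inv_sq (Z : ℕ) : ∑ n ∈ Ioc 0 Z, Q.a n * ((1:ℝ) / n) ^ 2 ≤ (|Q.ρ| + Q.c) * 2 := by
  refine (Q.sum_a_w (fun n => ((1:ℝ) / n) ^ 2) (fun n => by positivity) (fun n hn => ?_) Z).trans ?_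
  · have : (0:ℝ) < n := by exact_mod_cast hn
    apply pow_le_pow_left₀ (by positivity)
    apply one_div_le_one_div_of_le this
    push_cast; linarith
  · have := Q.c_nonneg
    refine mul_le_mul_of_nonneg_left ?_ (by positivity)
    rcases Nat.eq_zero_or_pos Z with rfl | h
    · simp
    · rw [← sum_Ioc_consecutive _ (Nat.zero_le 1) h]
      have h1 := sum_Ioc_inv_sq_le_sub (α := ℝ) (k := 1) (by norm_num) h
      have h2 : (0:ℝ) ≤ (Z:ℝ)⁻¹ := by positivity
      simp only [one_div, inv_pow] at h1 ⊢
      rw [show Ioc 0 1 = {1} from rfl, sum_singleton]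
      norm_num at h1 ⊢
      linarith

end QD

namespace IdS
open NumberField Classical Finset
variable {F : Type} [Field F] [NumberField F]

theorem C1_real (Q : QD) (ha : ∀ n, Q.a n = an F n) (X Y : ℝ) (hX : 1 ≤ X) (hY : 0 ≤ Y) :
    (C1 F X Y : ℝ) - Q.ρ * (⌊Y⌋₊ : ℝ) = ∑ e ∈ IS F ⌊X⌋₊, (idealMu e : ℝ) *
      ∑ n ∈ Ioc 0 (⌊X⌋₊ / Ideal.absNorm e), (n : ℝ) * (Q.a n * Q.E ((⌊Y⌋₊ : ℝ) / n)) := by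
  have hA : ∀ n, Q.A n = ((IS F n).card : ℝ) := by
    intro n
    rw [card_IS, QD.A]
    exact sum_congr rfl fun m _ => ha m
  have hx : 1 ≤ ⌊X⌋₊ := (Nat.one_le_floor_iff X).2 hX
  have hm := main_term (F := F) ⌊X⌋₊ hx
  have hm' : ∑ e ∈ IS F ⌊X⌋₊, (idealMu e : ℝ) * ((IS F (⌊X⌋₊ / Ideal.absNorm e)).card : ℝ) = 1 := by
    exact_mod_cast hm
  rw [C1_eq X Y (by linarith) hY]
  push_cast
  rw [show Q.ρ * (⌊Y⌋₊ : ℝ) = Q.ρ * (⌊Y⌋₊ : ℝ) * 1 by ring, ← hm', mul_sum, ← sum_sub_distrib]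
  refine sum_congr rfl fun e _ => ?_
  have h1 := sum_IS (F := F) (⌊X⌋₊ / Ideal.absNorm e)
    (fun n => (n : ℝ) * Q.E ((⌊Y⌋₊ : ℝ) / n))
  have h2 : ∑ n ∈ Ioc 0 (⌊X⌋₊ / Ideal.absNorm e), (n : ℝ) * (Q.a n * Q.E ((⌊Y⌋₊ : ℝ) / n)) =
      ∑ I ∈ IS F (⌊X⌋₊ / Ideal.absNorm e), (Ideal.absNorm I : ℝ) * Q.E ((⌊Y⌋₊ : ℝ) / (Ideal.absNorm I : ℕ)) := by
    rw [h1]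
    refine sum_congr rfl fun n _ => ?_
    rw [ha]; ring
  rw [h2, card_eq_sum_ones]
  push_cast
  rw [← mul_assoc, mul_comm (Q.ρ * _) (idealMu e : ℝ), mul_assoc, ← mul_sub, mul_sum,
    ← sum_sub_distrib]
  congr 1
  refine sum_congr rfl fun d hd => ?_
  have hd0 : (Ideal.absNorm d : ℝ) ≠ 0 := by exact_mod_cast (norm_pos (mem_IS.1 hd).1).ne'
  rw [QD.E, Nat.floor_div_eq_div, hA]
  field_simp

theorem final (Q : QD) (ha : ∀ n, Q.a n = an F n) : ∃ C : ℝ, 0 < C ∧ ∀ X Y : ℝ, 3 ≤ X → X < Y →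
      |(C1 F X Y : ℝ) - Q.ρ * Y|
        ≤ C * (X * Y ^ ((1 : ℝ) / 2) * Real.log Y ^ 7 + X ^ 2) := by
  obtain ⟨K, hK, hR⟩ := Q.R_bound
  have hc := Q.c_nonneg
  set M := |Q.ρ| + Q.c with hM
  have hM0 : 0 ≤ M := by positivity
  refine ⟨K * M * 128 + K * M * 2 + |Q.ρ| + 1, by positivity, fun X Y hX hXY => ?_⟩
  set x := ⌊X⌋₊ with hx
  set N := ⌊Y⌋₊ with hN
  have hx1 : 1 ≤ x := (Nat.one_le_floor_iff X).2 (by linarith)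
  have hxX : (x:ℝ) ≤ X := Nat.floor_le (by linarith)
  have hNY : (N:ℝ) ≤ Y := Nat.floor_le (by linarith)
  have hNY' : Y < N + 1 := Nat.lt_floor_add_one Y
  have hxN : x ≤ N := Nat.floor_mono hXY.le
  have hN1 : (1:ℝ) ≤ N := by exact_mod_cast hx1.trans hxN
  have hx1' : (1:ℝ) ≤ x := by exact_mod_cast hx1
  have hlogY : 1 ≤ Real.log Y := by
    rw [Real.le_log_iff_exp_le (by linarith)]
    linarith [Real.exp_one_lt_d9]
  have hlgN : lg N ≤ 2 * Real.log Y := by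
    have := lg_mono (by linarith) hNY
    unfold lg at this ⊢; linarith
  have hlgx : lg x ≤ 2 * Real.log Y := (lg_mono (by linarith) (by exact_mod_cast hxN)).trans hlgN
  have hlgN1 : 1 ≤ lg N := one_le_lg hN1
  have hlgx1 : 1 ≤ lg x := one_le_lg hx1'
  set W := Real.sqrt N * lg N ^ 6 with hW
  have hW0 : 0 ≤ W := by positivity
  have hmain : |(C1 F X Y : ℝ) - Q.ρ * (N : ℝ)| ≤ K * M * (x * W * lg x) + K * M * 2 * x ^ 2 := by
    rw [C1_real Q ha X Y (by linarith) (by linarith)]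
    refine (abs_sum_le_sum_abs _ _).trans ?_
    calc _ ≤ ∑ e ∈ IS F x, (K * x * W * ((1:ℝ) / (Ideal.absNorm e : ℕ)) +
            K * x ^ 2 * ((1:ℝ) / (Ideal.absNorm e : ℕ)) ^ 2) := by
          refine sum_le_sum fun e he => ?_
          have he' := mem_IS.1 he
          have hp := norm_pos he'.1
          have hZ : 1 ≤ x / Ideal.absNorm e := (Nat.le_div_iff_mul_le hp).2 (by omega)
          have h1 := hR N (x / Ideal.absNorm e) hZ ((Nat.div_le_self _ _).trans hxN)
          have h2 : ((x / Ideal.absNorm e : ℕ) : ℝ) ≤ x * ((1:ℝ) / (Ideal.absNorm e : ℕ)) := by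
            rw [mul_one_div]; exact Nat.cast_div_le
          rw [abs_mul]
          refine (mul_le_of_le_one_left (abs_nonneg _) (abs_mu_le e)).trans (h1.trans ?_)
          set z := ((x / Ideal.absNorm e : ℕ) : ℝ)
          set r := (1:ℝ) / (Ideal.absNorm e : ℕ)
          have hz0 : 0 ≤ z := by positivity
          have h3 : z ^ 2 ≤ (x * r) ^ 2 := pow_le_pow_left₀ hz0 h2 2
          have h4 := mul_le_mul_of_nonneg_right h2 hW0
          calc _ = K * (z * W + z ^ 2) := by rw [hW]; ring
            _ ≤ K * (x * r * W + (x * r) ^ 2) :=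
              mul_le_mul_of_nonneg_left (by linarith) hK
            _ = _ := by ring
      _ = K * x * W * ∑ n ∈ Ioc 0 x, Q.a n * ((1:ℝ) / n) +
            K * x ^ 2 * ∑ n ∈ Ioc 0 x, Q.a n * ((1:ℝ) / n) ^ 2 := by
          rw [sum_IS x (fun n => K * x * W * ((1:ℝ) / n) + K * x ^ 2 * ((1:ℝ) / n) ^ 2), mul_sum,
            mul_sum, ← sum_add_distrib]
          refine sum_congr rfl fun n _ => ?_
          rw [ha]; ring
      _ ≤ K * x * W * (M * lg x) + K * x ^ 2 * (M * 2) := by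
          refine add_le_add (mul_le_mul_of_nonneg_left (Q.sum_a_inv x) (by positivity))
            (mul_le_mul_of_nonneg_left (Q.sum_a_inv_sq x) (by positivity))
      _ = _ := by ring
  have hfl : |Q.ρ * (N:ℝ) - Q.ρ * Y| ≤ |Q.ρ| * X ^ 2 := by
    rw [← mul_sub, abs_mul]
    refine mul_le_mul_of_nonneg_left ?_ (abs_nonneg _)
    rw [abs_le]; constructor <;> nlinarith
  have hsq : Real.sqrt N ≤ Y ^ ((1:ℝ)/2) := by
    rw [← Real.sqrt_eq_rpow]; exact Real.sqrt_le_sqrt hNY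
  set V := Y ^ ((1:ℝ)/2) with hV
  have hV0 : 0 ≤ V := Real.rpow_nonneg (by linarith) _
  have h1 : x * W * lg x ≤ 128 * (X * V * Real.log Y ^ 7) := by
    calc _ ≤ X * (V * (2 * Real.log Y) ^ 6) * (2 * Real.log Y) := by
          rw [hW]; gcongr
      _ = _ := by ring
  have h2 : (x:ℝ) ^ 2 ≤ X ^ 2 := by gcongr
  have hKM : 0 ≤ K * M := by positivity
  have e1 := mul_le_mul_of_nonneg_left h1 hKM
  have e2 := mul_le_mul_of_nonneg_left h2 hKM
  have hA0 : 0 ≤ X * V * Real.log Y ^ 7 := by positivity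
  have hB0 : 0 ≤ X ^ 2 := by positivity
  have := abs_sub_le (C1 F X Y : ℝ) (Q.ρ * (N:ℝ)) (Q.ρ * Y)
  set U := X * V * Real.log Y ^ 7
  have p1 : 0 ≤ K * M * X ^ 2 := by positivity
  have p2 : 0 ≤ K * M * U := by positivity
  have p3 : 0 ≤ |Q.ρ| * U := by positivity
  nlinarith

end IdS

end

section

namespace IdS
open NumberField Classical Finset UniqueFactorizationMonoid

variable {F : Type} [Field F] [NumberField F]

/-- Ideals of norm `n`. -/
noncomputable def IE (F : Type) [Field F] [NumberField F] (n : ℕ) : Finset (Ideal (𝓞 F)) :=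
  (Ideal.finite_setOfPred_absNorm_eq (S := 𝓞 F) n).toFinset

theorem mem_IE {n : ℕ} {I : Ideal (𝓞 F)} : I ∈ IE F n ↔ Ideal.absNorm I = n := by
  simp [IE]

theorem an_eq (n : ℕ) : an F n = (IE F n).card := rfl

theorem ne_zero_of_norm {n : ℕ} (hn : n ≠ 0) {I : Ideal (𝓞 F)} (h : Ideal.absNorm I = n) : I ≠ 0 := by
  rintro rfl
  simp at h
  exact hn h.symm

theorem norm_one {I : Ideal (𝓞 F)} (h : Ideal.absNorm I = 1) : I = 1 := by
  rw [Ideal.one_eq_top]; exact Ideal.absNorm_eq_one_iff.1 h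

theorem an_one : an F 1 = 1 := by
  rw [an_eq, card_eq_one]
  refine ⟨1, ?_⟩
  ext I
  rw [mem_IE, mem_singleton]
  exact ⟨norm_one, fun h => by rw [h]; exact map_one _⟩

theorem rel_of_coprime {I J : Ideal (𝓞 F)} (h : (Ideal.absNorm I).Coprime (Ideal.absNorm J)) :
    IsRelPrime I J := by
  intro D hI hJ
  have h1 : Ideal.absNorm D = 1 :=
    Nat.eq_one_of_dvd_coprimes h (map_dvd Ideal.absNorm hI) (map_dvd Ideal.absNorm hJ)
  rw [norm_one h1]; exact isUnit_one

theorem exists_factor (K : Ideal (𝓞 F)) : ∀ m n : ℕ, m ≠ 0 → n ≠ 0 → m.Coprime n →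
    Ideal.absNorm K = m * n → ∃ I J, Ideal.absNorm I = m ∧ Ideal.absNorm J = n ∧ I * J = K := by
  induction K using UniqueFactorizationMonoid.induction_on_prime with
  | h₁ => intro m n hm hn _ h; simp at h; omega
  | h₂ x hx =>
    intro m n hm hn _ h
    have hx1 : x = 1 := by rw [Ideal.one_eq_top]; exact Ideal.isUnit_iff.1 hx
    rw [hx1, map_one] at h
    have := mul_eq_one.1 h.symm
    refine ⟨1, 1, ?_, ?_, ?_⟩
    · rw [map_one, this.1]
    · rw [map_one, this.2]
    · rw [hx1, one_mul]
  | h₃ a P ha hP ih =>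
    intro m n hm hn hc h
    have hPp : P.IsPrime := Ideal.isPrime_of_prime hP
    have hPm : P.IsMaximal := hPp.isMaximal hP.ne_zero
    obtain ⟨p, f, hf, _, hp, hN⟩ := Ideal.exists_prime_and_absNorm_eq_pow P
    have hpf : IsPrimePow (p ^ f) := hp.isPrimePow.pow hf.ne'
    rw [map_mul, hN] at h
    have hpos : 0 < p ^ f := pow_pos hp.pos f
    rcases (Nat.Coprime.isPrimePow_dvd_mul hc hpf).1 (h ▸ dvd_mul_right _ _) with h1 | h1
    · obtain ⟨m', rfl⟩ := h1
      have : Ideal.absNorm a = m' * n := by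
        rw [mul_assoc] at h; exact Nat.eq_of_mul_eq_mul_left hpos h
      obtain ⟨I, J, e1, e2, e3⟩ := ih m' n (right_ne_zero_of_mul hm) hn
        (Nat.Coprime.coprime_dvd_left (dvd_mul_left _ _) hc) this
      refine ⟨P * I, J, by rw [map_mul, hN, e1], e2, by rw [mul_assoc, e3]⟩
    · obtain ⟨n', rfl⟩ := h1
      have : Ideal.absNorm a = m * n' := by
        rw [mul_left_comm] at h; exact Nat.eq_of_mul_eq_mul_left hpos h
      obtain ⟨I, J, e1, e2, e3⟩ := ih m n' hm (right_ne_zero_of_mul hn)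
        (Nat.Coprime.coprime_dvd_right (dvd_mul_left _ _) hc) this
      refine ⟨I, P * J, e1, by rw [map_mul, hN, e2], by rw [mul_left_comm, e3]⟩

theorem an_mul (m n : ℕ) (hm : m ≠ 0) (hn : n ≠ 0) (h : m.Coprime n) :
    an F (m * n) = an F m * an F n := by
  rw [an_eq, an_eq, an_eq, ← card_product]
  symm
  refine card_bij (fun p _ => p.1 * p.2) ?_ ?_ ?_
  · rintro ⟨I, J⟩ hp
    rw [mem_product, mem_IE, mem_IE] at hp
    rw [mem_IE, map_mul, hp.1, hp.2]
  · rintro ⟨I, J⟩ hp ⟨I', J'⟩ hp' he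
    rw [mem_product, mem_IE, mem_IE] at hp hp'
    obtain ⟨h1, h2⟩ := hp
    obtain ⟨h3, h4⟩ := hp'
    change I * J = I' * J' at he
    dsimp only at h1 h2 h3 h4
    have e1 : I ∣ I' := (rel_of_coprime (I := I) (J := J') (by rw [h1, h4]; exact h)).dvd_of_dvd_mul_right
      (he ▸ dvd_mul_right _ _)
    have e2 : I' ∣ I := (rel_of_coprime (I := I') (J := J) (by rw [h3, h2]; exact h)).dvd_of_dvd_mul_right
      (he ▸ dvd_mul_right _ _)
    have e3 : I = I' := dvd_antisymm e1 e2
    subst e3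
    rw [mul_left_cancel₀ (ne_zero_of_norm hm h1) he]
  · intro K hK
    rw [mem_IE] at hK
    obtain ⟨I, J, e1, e2, e3⟩ := exists_factor K m n hm hn h hK
    exact ⟨(I, J), mem_product.2 ⟨mem_IE.2 e1, mem_IE.2 e2⟩, e3⟩

theorem norm_p (hdeg : Module.finrank ℚ F = 2) (p : ℕ) :
    Ideal.absNorm (Ideal.span {(p : 𝓞 F)}) = p ^ 2 := by
  rw [Ideal.absNorm_span_natCast, RingOfIntegers.rank, hdeg]

theorem prime_factor {p : ℕ} (k : ℕ) (hk : k ≠ 0) (hp : p.Prime) {I : Ideal (𝓞 F)}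
    (hI : Ideal.absNorm I = p ^ k) : ∃ R, Prime R ∧ R ∣ I ∧ R ∣ Ideal.span {(p : 𝓞 F)} := by
  have hI0 : I ≠ 0 := ne_zero_of_norm (pow_ne_zero _ hp.ne_zero) hI
  have hnu : ¬ IsUnit I := fun h => by
    rw [Ideal.isUnit_iff] at h
    rw [h, Ideal.absNorm_top] at hI
    exact (Nat.one_lt_pow hk hp.one_lt).ne hI
  obtain ⟨R, hR, hRI⟩ := WfDvdMonoid.exists_irreducible_factor hnu hI0
  refine ⟨R, hR.prime, hRI, ?_⟩
  have hRp : R.IsPrime := Ideal.isPrime_of_prime hR.prime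
  rw [Ideal.dvd_span_singleton]
  have h1 : ((p ^ k : ℕ) : 𝓞 F) ∈ R := Ideal.le_of_dvd hRI (hI ▸ Ideal.absNorm_mem I)
  push_cast at h1
  exact hRp.mem_of_pow_mem k h1

theorem prime_of_norm {p : ℕ} (hp : p.Prime) {I : Ideal (𝓞 F)} (hI : Ideal.absNorm I = p) : Prime I :=
  (Ideal.irreducible_of_irreducible_absNorm (by rw [hI]; exact hp)).prime

theorem split_cases (hdeg : Module.finrank ℚ F = 2) {p : ℕ} (hp : p.Prime) :
    Prime (Ideal.span {(p : 𝓞 F)}) ∨ ∃ P Q : Ideal (𝓞 F), Ideal.absNorm P = p ∧ Ideal.absNorm Q = p ∧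
      Ideal.span {(p : 𝓞 F)} = P * Q := by
  have hn := norm_p hdeg p
  obtain ⟨R, hR, ⟨J, hJ⟩, _⟩ := prime_factor 2 (by norm_num) hp hn
  rw [hJ, map_mul] at hn
  have h1 : Ideal.absNorm R ∣ p ^ 2 := hn ▸ dvd_mul_right _ _
  obtain ⟨i, hi, h2⟩ := (Nat.dvd_prime_pow hp).1 h1
  interval_cases i
  · exfalso
    rw [pow_zero] at h2
    exact hR.not_isUnit (norm_one h2 ▸ isUnit_one)
  · right
    rw [pow_one] at h2
    refine ⟨R, J, h2, ?_, hJ⟩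
    rw [h2, sq] at hn
    exact Nat.eq_of_mul_eq_mul_left hp.pos hn
  · left
    have : Ideal.absNorm J = 1 := by
      rw [h2] at hn
      exact Nat.eq_of_mul_eq_mul_left (pow_pos hp.pos 2) (by rw [hn, mul_one])
    rw [hJ, norm_one this, mul_one]
    exact hR

theorem eq_of_prime_dvd {P R : Ideal (𝓞 F)} (hP : Prime P) (hR : Prime R) (h : R ∣ P) : R = P :=
  dvd_antisymm h ((hR.irreducible.dvd_symm hP.irreducible) h)

theorem inert_rec (hdeg : Module.finrank ℚ F = 2) {p : ℕ} (hp : p.Prime)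
    (h : Prime (Ideal.span {(p : 𝓞 F)})) (k : ℕ) : an F (p ^ (k + 2)) = an F (p ^ k) := by
  rw [an_eq, an_eq]
  symm
  refine card_bij (fun I _ => Ideal.span {(p : 𝓞 F)} * I) ?_ ?_ ?_
  · intro I hI
    rw [mem_IE] at hI ⊢
    rw [map_mul, norm_p hdeg, hI]; ring
  · intro I _ J _ e
    exact mul_left_cancel₀ h.ne_zero e
  · intro I hI
    rw [mem_IE] at hI
    obtain ⟨R, hR, hRI, hRp⟩ := prime_factor (k + 2) (by omega) hp hI
    rw [eq_of_prime_dvd h hR hRp] at hRI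
    obtain ⟨J, rfl⟩ := hRI
    refine ⟨J, ?_, rfl⟩
    rw [mem_IE]
    rw [map_mul, norm_p hdeg, pow_add, mul_comm] at hI
    exact Nat.eq_of_mul_eq_mul_right (pow_pos hp.pos 2) hI

theorem inert_one (hdeg : Module.finrank ℚ F = 2) {p : ℕ} (hp : p.Prime)
    (h : Prime (Ideal.span {(p : 𝓞 F)})) : an F p = 0 := by
  rw [an_eq, card_eq_zero, eq_empty_iff_forall_notMem]
  intro I hI
  rw [mem_IE] at hI
  obtain ⟨R, hR, hRI, hRp⟩ := prime_factor 1 (by omega) hp (by rw [hI, pow_one])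
  rw [eq_of_prime_dvd h hR hRp] at hRI
  have := map_dvd Ideal.absNorm hRI
  rw [norm_p hdeg, hI] at this
  have := Nat.le_of_dvd hp.pos this
  nlinarith [hp.two_le]

theorem ram_rec {p : ℕ} (hp : p.Prime) {P : Ideal (𝓞 F)} (hP : Ideal.absNorm P = p)
    (h : Ideal.span {(p : 𝓞 F)} = P * P) (k : ℕ) : an F (p ^ (k + 1)) = an F (p ^ k) := by
  have hPp := prime_of_norm hp hP
  rw [an_eq, an_eq]
  symm
  refine card_bij (fun I _ => P * I) ?_ ?_ ?_
  · intro I hI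
    rw [mem_IE] at hI ⊢
    rw [map_mul, hP, hI]; ring
  · intro I _ J _ e
    exact mul_left_cancel₀ hPp.ne_zero e
  · intro I hI
    rw [mem_IE] at hI
    obtain ⟨R, hR, hRI, hRp⟩ := prime_factor (k + 1) (by omega) hp hI
    have hRP : R ∣ P := by
      rw [h] at hRp
      rcases hR.dvd_or_dvd hRp with h1 | h1 <;> exact h1
    rw [eq_of_prime_dvd hPp hR hRP] at hRI
    obtain ⟨J, rfl⟩ := hRI
    refine ⟨J, ?_, rfl⟩
    rw [mem_IE]
    rw [map_mul, hP, pow_succ, mul_comm] at hI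
    exact Nat.eq_of_mul_eq_mul_right hp.pos hI

theorem split_rec {p : ℕ} (hp : p.Prime) {P Q : Ideal (𝓞 F)} (hP : Ideal.absNorm P = p)
    (hQ : Ideal.absNorm Q = p) (hPQ : P ≠ Q)
    (h : Ideal.span {(p : 𝓞 F)} = P * Q) (k : ℕ) : an F (p ^ (k + 1)) = an F (p ^ k) + 1 := by
  have hPp := prime_of_norm hp hP
  have hQp := prime_of_norm hp hQ
  have hnd : ∀ j, ¬ P ∣ Q ^ j := fun j hj =>
    hPQ (eq_of_prime_dvd hQp hPp (hPp.dvd_of_dvd_pow hj))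
  have step : ∀ I : Ideal (𝓞 F), ∀ j, Ideal.absNorm I = p ^ (j + 1) → ¬ P ∣ I → Q ∣ I := by
    intro I j hI hPI
    obtain ⟨R, hR, hRI, hRp⟩ := prime_factor (j + 1) (by omega) hp hI
    rw [h] at hRp
    rcases hR.dvd_or_dvd hRp with h1 | h1
    · exact absurd (eq_of_prime_dvd hPp hR h1 ▸ hRI) hPI
    · exact eq_of_prime_dvd hQp hR h1 ▸ hRI
  have hall : ∀ j, ∀ I : Ideal (𝓞 F), Ideal.absNorm I = p ^ j → ¬ P ∣ I → I = Q ^ j := by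
    intro j
    induction j with
    | zero => intro I hI _; rw [pow_zero] at hI ⊢; exact norm_one hI
    | succ j ih =>
      intro I hI hPI
      obtain ⟨J, rfl⟩ := step I j hI hPI
      rw [pow_succ', ← ih J ?_ (fun hh => hPI (hh.mul_left _))]
      rw [map_mul, hQ, pow_succ'] at hI
      exact Nat.eq_of_mul_eq_mul_left hp.pos hI
  have : IE F (p ^ (k + 1)) = insert (Q ^ (k + 1)) ((IE F (p ^ k)).image (fun I => P * I)) := by
    ext I
    rw [mem_insert, mem_image, mem_IE]
    constructor
    · intro hI
      by_cases hPI : P ∣ I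
      · right
        obtain ⟨J, rfl⟩ := hPI
        refine ⟨J, ?_, rfl⟩
        rw [mem_IE]
        rw [map_mul, hP, pow_succ'] at hI
        exact Nat.eq_of_mul_eq_mul_left hp.pos hI
      · left; exact hall _ I hI hPI
    · rintro (rfl | ⟨J, hJ, rfl⟩)
      · rw [map_pow, hQ]
      · rw [mem_IE] at hJ
        rw [map_mul, hP, hJ, pow_succ']
  rw [an_eq, an_eq, this, card_insert_of_notMem, card_image_of_injective]
  · intro I J e
    exact mul_left_cancel₀ hPp.ne_zero e
  · intro hh
    obtain ⟨J, _, hJ⟩ := mem_image.1 hh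
    exact hnd (k + 1) (hJ ▸ dvd_mul_right _ _)

theorem an_pow (hdeg : Module.finrank ℚ F = 2) {p : ℕ} (hp : p.Prime) (k : ℕ) :
    (an F (p ^ k) : ℤ) = ∑ i ∈ range (k + 1), ((an F p : ℤ) - 1) ^ i := by
  rcases split_cases hdeg hp with h | ⟨P, Q, hP, hQ, h⟩
  · rw [inert_one hdeg hp h]
    induction k using Nat.strong_induction_on with
    | _ k ih =>
      match k with
      | 0 => simp [an_one]
      | 1 => simp [inert_one hdeg hp h, sum_range_succ]
      | k + 2 =>
        rw [inert_rec hdeg hp h, ih k (by omega), sum_range_succ _ (k + 2), sum_range_succ _ (k + 1)]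
        push_cast
        ring
  · by_cases hPQ : P = Q
    · subst hPQ
      have hk : ∀ k, an F (p ^ k) = 1 := by
        intro k
        induction k with
        | zero => simp [an_one]
        | succ k ih => rw [ram_rec hp hP h, ih]
      have h1 := hk 1
      rw [pow_one] at h1
      rw [hk, h1, sum_range_succ']
      simp
    · have hk : ∀ k, an F (p ^ k) = k + 1 := by
        intro k
        induction k with
        | zero => simp [an_one]
        | succ k ih => rw [split_rec hp hP hQ hPQ h, ih]
      have h1 := hk 1
      rw [pow_one] at h1
      rw [hk, h1]
      simp

end IdS

end

section

namespace IdS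
open NumberField Classical Finset

variable {F : Type} [Field F] [NumberField F]

theorem exists_theta (hdeg : Module.finrank ℚ F = 2) : ∃ θ : 𝓞 F,
    (∀ x : 𝓞 F, ∃ a c : ℤ, x = a + c * θ) ∧ (∀ a c : ℤ, (a : 𝓞 F) + c * θ = 0 → a = 0 ∧ c = 0) := by
  have hr : Module.finrank ℤ (𝓞 F) = 2 := by rw [RingOfIntegers.rank, hdeg]
  let b := Module.finBasisOfFinrankEq ℤ (𝓞 F) hr
  have hb : ∀ x : 𝓞 F, x = ((b.repr x 0 : ℤ) : 𝓞 F) * b 0 + ((b.repr x 1 : ℤ) : 𝓞 F) * b 1 := by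
    intro x
    have := b.sum_repr x
    rw [Fin.sum_univ_two] at this
    rw [← zsmul_eq_mul, ← zsmul_eq_mul]
    exact this.symm
  have hbi : ∀ u v : ℤ, (u : 𝓞 F) * b 0 + (v : 𝓞 F) * b 1 = 0 → u = 0 ∧ v = 0 := by
    intro u v h
    have h2 := Fintype.linearIndependent_iff.1 b.linearIndependent ![u, v] (by
      rw [Fin.sum_univ_two]
      simpa [zsmul_eq_mul] using h)
    exact ⟨h2 0, h2 1⟩
  have h1 := hb 1
  set u := b.repr 1 0
  set v := b.repr 1 1
  have hg : u.gcd v = 1 := by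
    obtain ⟨u', hu⟩ := Int.gcd_dvd_left u v
    obtain ⟨v', hv⟩ := Int.gcd_dvd_right u v
    set g := u.gcd v
    have : IsUnit ((g : ℕ) : 𝓞 F) := by
      refine IsUnit.of_mul_eq_one ((u' : 𝓞 F) * b 0 + v' * b 1) ?_
      rw [hu, hv] at h1
      push_cast at h1
      rw [h1]; ring
    have h2 := norm_p hdeg g
    rw [Ideal.span_singleton_eq_top.2 this, Ideal.absNorm_top] at h2
    have := h2.symm
    exact (pow_eq_one_iff.1 this).resolve_right (by norm_num)
  have hbez := Int.gcd_eq_gcd_ab u v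
  rw [hg] at hbez
  set s := Int.gcdA u v
  set r := Int.gcdB u v
  have hbez' : (u : 𝓞 F) * s + v * r = 1 := by exact_mod_cast hbez.symm
  have hz : u * s + v * r = 1 := by exact_mod_cast hbez.symm
  refine ⟨-(r : 𝓞 F) * b 0 + s * b 1, ?_, ?_⟩
  · intro x
    refine ⟨b.repr x 0 * s + b.repr x 1 * r, -(b.repr x 0) * v + b.repr x 1 * u, ?_⟩
    set y := b.repr x 0
    set z := b.repr x 1
    have hx : x = (y : 𝓞 F) * b 0 + (z : 𝓞 F) * b 1 := hb x
    rw [hx]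
    push_cast
    linear_combination (-(y : 𝓞 F) * b 0 - z * b 1) * hbez' + ((y : 𝓞 F) * s + z * r) * (-h1)
  · intro a c h
    have h2 := hbi (a * u - c * r) (a * v + c * s) (by
      push_cast
      linear_combination h - (a : 𝓞 F) * h1)
    constructor
    · linear_combination s * h2.1 + r * h2.2 - a * hz
    · linear_combination (-v) * h2.1 + u * h2.2 - c * hz

/-- Data of an integral basis `1, θ` with `θ² = tθ - n`. -/
structure TH (F : Type) [Field F] [NumberField F] where
  θ : 𝓞 F
  t : ℤ
  n : ℤ
  sp : ∀ x : 𝓞 F, ∃ a c : ℤ, x = a + c * θ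
  un : ∀ a c : ℤ, (a : 𝓞 F) + c * θ = 0 → a = 0 ∧ c = 0
  eq : θ * θ = t * θ - n

theorem exists_TH (hdeg : Module.finrank ℚ F = 2) : Nonempty (TH F) := by
  obtain ⟨θ, h1, h2⟩ := exists_theta hdeg
  obtain ⟨a, c, h⟩ := h1 (θ * θ)
  exact ⟨⟨θ, c, -a, h1, h2, by rw [h]; push_cast; ring⟩⟩

namespace TH
variable (T : TH F)

/-- The discriminant. -/
def d : ℤ := T.t ^ 2 - 4 * T.n

theorem d_ne : T.d ≠ 0 := by
  intro h
  have h1 : (2 * T.θ - T.t) * (2 * T.θ - T.t) = ((T.d : ℤ) : 𝓞 F) := by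
    unfold d; push_cast
    linear_combination 4 * T.eq
  rw [h, Int.cast_zero, mul_self_eq_zero] at h1
  have := T.un (-T.t) 2 (by push_cast; linear_combination h1)
  omega

theorem exists_rh {p : ℕ} (r : ZMod p) (hr : r * r = T.t * r - T.n) :
    ∃ f : 𝓞 F →+* ZMod p, f T.θ = r := by
  choose a c h using T.sp
  have key : ∀ x : 𝓞 F, ∀ u v : ℤ, x = u + v * T.θ → a x = u ∧ c x = v := by
    intro x u v hx
    have h0 := h x
    have := T.un (a x - u) (c x - v) (by push_cast; linear_combination hx - h0)
    constructor <;> omega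
  refine ⟨
  { toFun := fun x => (a x : ZMod p) + c x * r
    map_one' := by
      have := key 1 1 0 (by simp)
      rw [this.1, this.2]; simp
    map_zero' := by
      have := key 0 0 0 (by simp)
      rw [this.1, this.2]; simp
    map_add' := fun x y => by
      have h1 := h x
      have h2 := h y
      have := key (x + y) (a x + a y) (c x + c y) (by push_cast; linear_combination h1 + h2)
      rw [this.1, this.2]; push_cast; ring
    map_mul' := fun x y => by
      have h1 := h x
      have h2 := h y
      have := key (x * y) (a x * a y - T.n * (c x * c y)) (a x * c y + c x * a y + T.t * (c x * c y)) (by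
        push_cast
        have := T.eq
        linear_combination (c x : 𝓞 F) * (c y) * this + y * h1 + (a x + c x * T.θ) * h2)
      rw [this.1, this.2]; push_cast
      linear_combination -(c x : ZMod p) * c y * hr }, ?_⟩
  have := key T.θ 0 1 (by simp)
  change (a T.θ : ZMod p) + c T.θ * r = r
  rw [this.1, this.2]; simp

/-- The ring homomorphism to `ZMod p` attached to a root. -/
noncomputable def hom {p : ℕ} (r : ZMod p) (hr : r * r = T.t * r - T.n) : 𝓞 F →+* ZMod p :=
  Classical.choose (T.exists_rh r hr)

theorem hom_apply {p : ℕ} (r : ZMod p) (hr : r * r = T.t * r - T.n) : T.hom r hr T.θ = r :=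
  Classical.choose_spec (T.exists_rh r hr)

theorem hom_ext {p : ℕ} (f g : 𝓞 F →+* ZMod p) (h : f T.θ = g T.θ) : f = g := by
  ext x
  obtain ⟨a, c, rfl⟩ := T.sp x
  simp [h]

theorem norm_ker {p : ℕ} [NeZero p] (f : 𝓞 F →+* ZMod p) : Ideal.absNorm (RingHom.ker f) = p := by
  have hs : Function.Surjective f := fun y => ⟨((ZMod.cast y : ℤ) : 𝓞 F), by simp⟩
  rw [Ideal.absNorm_apply]
  change Nat.card (𝓞 F ⧸ RingHom.ker f) = p
  rw [Nat.card_congr (RingHom.quotientKerEquivOfSurjective hs).toEquiv, Nat.card_zmod]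

theorem exists_hom {p : ℕ} (hp : p.Prime) (I : Ideal (𝓞 F)) (hI : Ideal.absNorm I = p) :
    ∃ f : 𝓞 F →+* ZMod p, RingHom.ker f = I := by
  have hc : Nat.card (𝓞 F ⧸ I) = p := hI
  have : Finite (𝓞 F ⧸ I) := Nat.finite_of_card_ne_zero (by rw [hc]; exact hp.ne_zero)
  have := Fintype.ofFinite (𝓞 F ⧸ I)
  rw [Nat.card_eq_fintype_card] at hc
  let e := ZMod.ringEquivOfPrime (𝓞 F ⧸ I) hp hc
  refine ⟨(e.symm : (𝓞 F ⧸ I) →+* ZMod p).comp (Ideal.Quotient.mk I), ?_⟩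
  ext x
  rw [RingHom.mem_ker, RingHom.comp_apply]
  change e.symm (Ideal.Quotient.mk I x) = 0 ↔ _
  rw [map_eq_zero_iff e.symm e.symm.injective, Ideal.Quotient.eq_zero_iff_mem]

theorem an_roots {p : ℕ} [hp : Fact p.Prime] :
    an F p = ((univ : Finset (ZMod p)).filter (fun r => r * r = (T.t : ZMod p) * r - (T.n : ZMod p))).card := by
  rw [an_eq]
  symm
  refine card_bij (fun r hr => RingHom.ker (T.hom r (mem_filter.1 hr).2)) ?_ ?_ ?_
  · intro r hr
    rw [mem_IE]
    exact norm_ker _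
  · intro r hr s hs h
    have h1 := T.hom_apply r (mem_filter.1 hr).2
    have h2 := T.hom_apply s (mem_filter.1 hs).2
    have h3 : T.θ - ((ZMod.cast r : ℤ) : 𝓞 F) ∈ RingHom.ker (T.hom r (mem_filter.1 hr).2) := by
      rw [RingHom.mem_ker, map_sub, h1, map_intCast]; simp
    change RingHom.ker (T.hom r (mem_filter.1 hr).2) = RingHom.ker (T.hom s (mem_filter.1 hs).2) at h
    rw [h, RingHom.mem_ker, map_sub, h2, map_intCast] at h3
    simp at h3
    exact (sub_eq_zero.1 h3).symm
  · intro I hI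
    rw [mem_IE] at hI
    obtain ⟨f, hf⟩ := exists_hom hp.out I hI
    have hr : f T.θ * f T.θ = T.t * f T.θ - T.n := by
      rw [← map_mul, T.eq]; simp
    refine ⟨f T.θ, by rw [mem_filter]; exact ⟨mem_univ _, hr⟩, ?_⟩
    rw [← hf]
    congr 1
    exact T.hom_ext _ _ (T.hom_apply _ _)

theorem an_odd {p : ℕ} [hp : Fact p.Prime] (h2 : p ≠ 2) : (an F p : ℤ) = jacobiSym T.d p + 1 := by
  rw [← jacobiSym.legendreSym.to_jacobiSym, ← legendreSym.card_sqrts p h2, T.an_roots]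
  have h20 : (2 : ZMod p) ≠ 0 := by
    intro h
    have : ((2 : ℕ) : ZMod p) = 0 := by exact_mod_cast h
    rw [ZMod.natCast_eq_zero_iff] at this
    exact h2 ((Nat.prime_dvd_prime_iff_eq hp.out Nat.prime_two).1 this)
  norm_cast
  refine card_bij (fun (r : ZMod p) _ => 2 * r - (T.t : ZMod p)) ?_ ?_ ?_
  · intro r hr
    rw [mem_filter] at hr
    rw [Set.mem_toFinset, Set.mem_ofPred_eq]
    unfold d; push_cast
    linear_combination 4 * hr.2
  · intro r _ s _ h
    have : 2 * (r - s) = 0 := by linear_combination h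
    rcases mul_eq_zero.1 this with h | h
    · exact absurd h h20
    · exact sub_eq_zero.1 h
  · intro y hy
    rw [Set.mem_toFinset, Set.mem_ofPred_eq] at hy
    unfold d at hy
    push_cast at hy
    have hi : (2 : ZMod p) * 2⁻¹ = 1 := mul_inv_cancel₀ h20
    refine ⟨(y + T.t) * 2⁻¹, ?_, ?_⟩
    · rw [mem_filter]
      refine ⟨mem_univ _, ?_⟩
      have h40 : (4 : ZMod p) ≠ 0 := by
        rw [show (4 : ZMod p) = 2 * 2 by norm_num]; exact mul_ne_zero h20 h20
      apply mul_left_cancel₀ h40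
      generalize (2 : ZMod p)⁻¹ = w at *
      linear_combination hy + ((y + T.t) ^ 2 * (2 * w + 1) - 2 * T.t * (y + T.t)) * hi
    · linear_combination (y + T.t) * hi

theorem roots_two : ∀ t n : ZMod 2,
    ((univ : Finset (ZMod 2)).filter (fun r => r * r = t * r - n)).card =
      if t = 0 then 1 else if n = 0 then 2 else 0 := by decide

theorem an_two : (an F 2 : ℤ) = if T.t % 2 = 0 then 1 else if T.n % 2 = 0 then 2 else 0 := by
  have := Fact.mk Nat.prime_two
  have h1 := T.an_roots (p := 2)
  have h2 := roots_two T.t T.n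
  have h3 : an F 2 = if (T.t : ZMod 2) = 0 then 1 else if (T.n : ZMod 2) = 0 then 2 else 0 := by
    rw [h1, ← h2]
  have e : ∀ z : ℤ, (z : ZMod 2) = 0 ↔ z % 2 = 0 := fun z => by
    rw [ZMod.intCast_zmod_eq_zero_iff_dvd z 2]; omega
  simp only [e] at h3
  rw [h3]
  split_ifs <;> rfl

end TH
end IdS

end

section

namespace IdS
open NumberField Classical Finset

variable {F : Type} [Field F] [NumberField F]

open ArithmeticFunction ArithmeticFunction.zeta in
theorem an_eq_sum (hdeg : Module.finrank ℚ F = 2) (χ : ℕ → ℤ) (h1 : χ 1 = 1)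
    (hm : ∀ m n, m ≠ 0 → n ≠ 0 → χ (m * n) = χ m * χ n)
    (hp : ∀ p : ℕ, p.Prime → χ p = (an F p : ℤ) - 1) (n : ℕ) (hn : 1 ≤ n) :
    (an F n : ℤ) = ∑ b ∈ n.divisors, χ b := by
  let f : ArithmeticFunction ℤ := ⟨fun n => if n = 0 then 0 else (an F n : ℤ), by simp⟩
  let g : ArithmeticFunction ℤ := ⟨fun n => if n = 0 then 0 else χ n, by simp⟩
  have fa : ∀ n, n ≠ 0 → f n = an F n := fun n hn => if_neg hn
  have ga : ∀ n, n ≠ 0 → g n = χ n := fun n hn => if_neg hn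
  have hf : f.IsMultiplicative := by
    rw [IsMultiplicative.iff_ne_zero]
    refine ⟨by rw [fa 1 one_ne_zero, an_one]; rfl, fun {m n} h0 h0' hc => ?_⟩
    rw [fa _ h0, fa _ h0', fa _ (mul_ne_zero h0 h0'), an_mul m n h0 h0' hc]
    push_cast; rfl
  have hg : g.IsMultiplicative := by
    rw [IsMultiplicative.iff_ne_zero]
    refine ⟨by rw [ga 1 one_ne_zero, h1], fun {m n} h0 h0' hc => ?_⟩
    rw [ga _ h0, ga _ h0', ga _ (mul_ne_zero h0 h0'), hm m n h0 h0']
  have hgz : (g * (ζ : ArithmeticFunction ℤ)).IsMultiplicative := hg.mul isMultiplicative_zeta.natCast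
  have key : f = g * (ζ : ArithmeticFunction ℤ) := by
    rw [IsMultiplicative.eq_iff_eq_on_prime_powers f hf _ hgz]
    intro p k hpp
    rw [coe_mul_zeta_apply, Nat.sum_divisors_prime_pow hpp, fa _ (pow_ne_zero _ hpp.ne_zero),
      an_pow hdeg hpp]
    refine sum_congr rfl fun i _ => ?_
    rw [ga _ (pow_ne_zero _ hpp.ne_zero), ← hp p hpp]
    clear * - hm h1 hpp
    induction i with
    | zero => simp [h1]
    | succ i ih => rw [pow_succ, pow_succ, hm _ _ (pow_ne_zero _ hpp.ne_zero) hpp.ne_zero, ih]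
  have := congrArg (fun h => h n) key
  simp only [coe_mul_zeta_apply] at this
  rw [fa n (by omega)] at this
  rw [this]
  refine sum_congr rfl fun b hb => ga b ?_
  exact (Nat.pos_of_mem_divisors hb).ne'

theorem recip_odd (d : ℤ) (hd : d % 4 = 1) (p : ℕ) (hp : Odd p) :
    jacobiSym d p = jacobiSym (p : ℤ) d.natAbs := by
  have hpo := Nat.odd_iff.1 hp
  rcases le_or_gt 0 d with h | h
  · obtain ⟨e, rfl⟩ := Int.eq_ofNat_of_zero_le h
    rw [Int.natAbs_natCast]
    exact jacobiSym.quadratic_reciprocity_one_mod_four (by omega) hp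
  · obtain ⟨e, he⟩ := Int.eq_ofNat_of_zero_le (show 0 ≤ -d by omega)
    obtain rfl : d = -(e : ℤ) := by omega
    rw [Int.natAbs_neg, Int.natAbs_natCast, jacobiSym.neg _ hp]
    have he3 : e % 4 = 3 := by omega
    rcases (show p % 4 = 1 ∨ p % 4 = 3 by omega) with h1 | h1
    · rw [ZMod.χ₄_nat_one_mod_four h1, one_mul]
      exact jacobiSym.quadratic_reciprocity_one_mod_four' (Nat.odd_iff.2 (by omega)) h1
    · rw [ZMod.χ₄_nat_three_mod_four h1, jacobiSym.quadratic_reciprocity_three_mod_four he3 h1]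
      ring

theorem exists_chi (hdeg : Module.finrank ℚ F = 2) : ∃ (q : ℕ) (χ : ℕ → ℤ), 0 < q ∧
    (∀ n, χ (n + q) = χ n) ∧ (∀ n, |χ n| ≤ 1) ∧ χ 1 = 1 ∧
    (∀ m n, m ≠ 0 → n ≠ 0 → χ (m * n) = χ m * χ n) ∧
    (∀ p : ℕ, p.Prime → χ p = (an F p : ℤ) - 1) := by
  obtain ⟨T⟩ := exists_TH hdeg
  have hd := T.d_ne
  have hd0 : 0 < T.d.natAbs := Int.natAbs_pos.2 hd
  have hJ : ∀ (a : ℤ) (b : ℕ), |jacobiSym a b| ≤ 1 := by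
    intro a b
    rcases jacobiSym.trichotomy a b with h | h | h <;> rw [h] <;> decide
  have h2 := T.an_two
  by_cases ht : T.t % 2 = 0
  · refine ⟨4 * T.d.natAbs, fun b => if b % 2 = 0 then 0 else jacobiSym T.d b, by omega, ?_, ?_, ?_, ?_, ?_⟩
    · intro n
      have e : (n + 4 * T.d.natAbs) % 2 = n % 2 := by omega
      simp only [e]
      split_ifs with h
      · rfl
      · rw [jacobiSym.mod_right T.d (Nat.odd_iff.2 (by omega : (n + 4 * T.d.natAbs) % 2 = 1)),
          jacobiSym.mod_right T.d (Nat.odd_iff.2 (by omega : n % 2 = 1)), Nat.add_mod_right]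
    · intro n
      dsimp only
      split_ifs
      · simp
      · exact hJ _ _
    · simp
    · intro m n hm hn
      dsimp only
      rcases Nat.mod_two_eq_zero_or_one m with h | h <;>
      rcases Nat.mod_two_eq_zero_or_one n with h' | h' <;>
      simp [Nat.mul_mod, h, h', jacobiSym.mul_right' T.d hm hn]
    · intro p hp
      have := Fact.mk hp
      dsimp only
      rcases eq_or_ne p 2 with rfl | hp2
      · rw [h2, if_pos ht]; simp
      · rw [T.an_odd hp2, if_neg (by have := hp.eq_two_or_odd; omega)]; ring
  · have hd4 : T.d % 4 = 1 ∧ (T.n % 2 = 0 → T.d % 8 = 1) ∧ (T.n % 2 ≠ 0 → T.d % 8 = 5) := by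
      obtain ⟨k, hk⟩ : ∃ k, T.t = 2 * k + 1 := ⟨T.t / 2, by omega⟩
      obtain ⟨j, hj⟩ : ∃ j, k * (k + 1) = 2 * j := (Int.even_mul_succ_self k).two_dvd
      have e : T.d = 8 * j + 1 - 4 * T.n := by
        rw [TH.d, hk]; linear_combination 4 * hj
      omega
    obtain ⟨hd4, hn0, hn1⟩ := hd4
    refine ⟨T.d.natAbs, fun b => jacobiSym (b : ℤ) T.d.natAbs, hd0, ?_, ?_, ?_, ?_, ?_⟩
    · intro n
      refine jacobiSym.mod_left' ?_
      rw [Nat.cast_add, Int.add_emod_right]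
    · exact fun n => hJ _ _
    · simp [jacobiSym.one_left]
    · intro m n _ _
      dsimp only
      rw [Nat.cast_mul, jacobiSym.mul_left]
    · intro p hp
      have := Fact.mk hp
      dsimp only
      rcases eq_or_ne p 2 with rfl | hp2
      · rw [h2, if_neg ht]
        have e := jacobiSym.at_two (Nat.odd_iff.2 (by omega : T.d.natAbs % 2 = 1))
        rw [Nat.cast_ofNat, e, ZMod.χ₈_nat_eq_if_mod_eight, if_neg (by omega)]
        by_cases h : T.n % 2 = 0
        · have := hn0 h
          rw [if_pos h, if_pos (by omega)]; rfl
        · have := hn1 h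
          rw [if_neg h, if_neg (by omega)]; rfl
      · rw [T.an_odd hp2, ← recip_odd T.d hd4 p (hp.odd_of_ne_two hp2)]; ring

theorem exists_QD (hdeg : Module.finrank ℚ F = 2) (ρ : ℝ)
    (hρ : ∃ c : ℝ, ∀ x : ℝ, 1 ≤ x →
      |(Nat.card {I : Ideal (𝓞 F) // I ≠ 0 ∧ (Ideal.absNorm I : ℝ) ≤ x} : ℝ) - ρ * x|
        ≤ c * x ^ ((1 : ℝ) / 3)) :
    ∃ Q : QD, (∀ n, Q.a n = an F n) ∧ Q.ρ = ρ := by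
  obtain ⟨q, χ, hq, per, bd, h1, hm, hp⟩ := exists_chi (F := F) hdeg
  obtain ⟨c, hc⟩ := hρ
  refine ⟨QD.mk q (fun n => (χ n : ℝ)) (fun n => (an F n : ℝ)) ρ |c| hq
    (fun n => by rw [per]) (fun n => by exact_mod_cast bd n)
    (fun n hn => by exact_mod_cast an_eq_sum hdeg χ h1 hm hp n hn)
    (fun n => Nat.cast_nonneg _) ?_, fun _ => rfl, rfl⟩
  intro n hn
  have hn' : (1 : ℝ) ≤ n := by exact_mod_cast hn
  have h := hc n hn'
  have e : Nat.card {I : Ideal (𝓞 F) // I ≠ 0 ∧ (Ideal.absNorm I : ℝ) ≤ (n : ℝ)} = (IS F n).card := by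
    have := set_eq (F := F) (n : ℝ) (by positivity)
    rw [Nat.floor_natCast] at this
    rw [← Set.ncard_coe_finset, ← this]
    rfl
  rw [e, card_IS] at h
  refine h.trans ?_
  rw [Real.sqrt_eq_rpow]
  exact mul_le_mul (le_abs_self c) (Real.rpow_le_rpow_of_exponent_le hn' (by norm_num))
    (by positivity) (abs_nonneg c)

end IdS

end


theorem C1_asymptotic (F : Type) [Field F] [NumberField F]
    (hdeg : Module.finrank ℚ F = 2) (ρ : ℝ)
    (hρ : ∃ c : ℝ, ∀ x : ℝ, 1 ≤ x →
      |(Nat.card {I : Ideal (𝓞 F) // I ≠ 0 ∧ (Ideal.absNorm I : ℝ) ≤ x} : ℝ) - ρ * x|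
        ≤ c * x ^ ((1 : ℝ) / 3)) :
    ∃ C : ℝ, 0 < C ∧ ∀ X Y : ℝ, 3 ≤ X → X < Y →
      |(C1 F X Y : ℝ) - ρ * Y|
        ≤ C * (X * Y ^ ((1 : ℝ) / 2) * Real.log Y ^ 7 + X ^ 2) := by
  obtain ⟨Q, ha, hr⟩ := IdS.exists_QD hdeg ρ hρ
  have h := IdS.final (F := F) Q ha
  rw [hr] at h
  exact h
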